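/- Let n ≥ 2. For every choice of exponents satisfying q ≥ 2, 2 ≤ r < ∞, 2/q + (n−1)/r ≤ (n−1)/2, and σ = 1/q + n/r − (n−1)/2, there is a constant C > 0 such that for every Schwartz function f on ℝ^n, ‖ (√−Δ)^σ e^{it√−Δ} f ‖_{L^q_t L^r_x} ≤ C ‖f‖_{Ḣ^{1/2}}. -/

import Mathlib

noncomputable section

open MeasureTheory Metric Complex
open scoped ENNReal FourierTransform SchwartzMap

/-- The Fourier multiplier operator `m(√−Δ)` on `ℝⁿ`:
`m(√−Δ)h = 𝓕⁻¹(m(|ξ|) 𝓕h(ξ))`. -/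
def mOp (n : ℕ) (m : ℝ → ℂ) (h : EuclideanSpace ℝ (Fin n) → ℂ) :
    EuclideanSpace ℝ (Fin n) → ℂ :=
  fun x => 𝓕⁻ (fun ξ : EuclideanSpace ℝ (Fin n) => m ‖ξ‖ * 𝓕 h ξ) x

/-- The multiplier of `e^{it√−Δ}`, i.e. `ρ ↦ e^{itρ}`. -/
def expMult (t : ℝ) : ℝ → ℂ := fun ρ => Complex.exp (Complex.I * t * ρ)

/-- The multiplier of `cos(t√−Δ)`, i.e. `ρ ↦ cos (tρ)`. -/
def cosMult (t : ℝ) : ℝ → ℂ := fun ρ => ((Real.cos (t * ρ) : ℝ) : ℂ)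

/-- The multiplier of `sin(t√−Δ)/√−Δ`, i.e. `ρ ↦ sin (tρ)/ρ`. -/
def sincMult (t : ℝ) : ℝ → ℂ := fun ρ => ((Real.sin (t * ρ) / ρ : ℝ) : ℂ)

/-- The multiplier of `sin(t√−Δ)`, i.e. `ρ ↦ sin (tρ)`. -/
def sinMult (t : ℝ) : ℝ → ℂ := fun ρ => ((Real.sin (t * ρ) : ℝ) : ℂ)

/-- The multiplier of `(√−Δ)^γ`, i.e. `ρ ↦ ρ^γ`. -/
def powMult (γ : ℝ) : ℝ → ℂ := fun ρ => ((ρ ^ γ : ℝ) : ℂ)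

/-- A function is Schwartz if it agrees pointwise with some Schwartz map. -/
def IsSchwartz {n : ℕ} (h : EuclideanSpace ℝ (Fin n) → ℂ) : Prop :=
  ∃ φ : 𝓢(EuclideanSpace ℝ (Fin n), ℂ), ∀ x, h x = φ x

/-- The Fefferman–Phong norm
`‖V‖_{𝓕^p} = sup_{x, r>0} r^(2-n/p) (∫_{B_r(x)} |V|^p)^(1/p)`. -/
def fpNorm (n : ℕ) (p : ℝ) (V : EuclideanSpace ℝ (Fin n) → ℂ) : ℝ≥0∞ :=
  ⨆ (x : EuclideanSpace ℝ (Fin n)) (r : ℝ) (_ : 0 < r),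
    ENNReal.ofReal (r ^ (2 - n / p)) *
      (∫⁻ y in ball x r, ENNReal.ofReal (‖V y‖ ^ p)) ^ (1 / p)

/-- The weak `L^{n/2}` quasinorm `sup_{λ>0} λ · |{|V| > λ}|^{2/n}`. -/
def wkNorm (n : ℕ) (V : EuclideanSpace ℝ (Fin n) → ℂ) : ℝ≥0∞ :=
  ⨆ (l : ℝ) (_ : 0 < l),
    ENNReal.ofReal l * (volume {x : EuclideanSpace ℝ (Fin n) | l < ‖V x‖}) ^ ((2 : ℝ) / n)

/-- The mixed norm `‖F‖_{L^q_t L^r_x}` for `F : ℝⁿ × ℝ → ℂ`, curried as `F x t`. -/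
def mixedNorm (n : ℕ) (q r : ℝ) (F : EuclideanSpace ℝ (Fin n) → ℝ → ℂ) : ℝ≥0∞ :=
  (∫⁻ t : ℝ, (∫⁻ x : EuclideanSpace ℝ (Fin n), (‖F x t‖₊ : ℝ≥0∞) ^ r) ^ (q / r)) ^ (1 / q)

/-- The weighted norm `‖h‖_{L²_{x,t}(w)}` with weight `w : ℝⁿ → [0,∞]`. -/
def wtNorm (n : ℕ) (w : EuclideanSpace ℝ (Fin n) → ℝ≥0∞)
    (h : EuclideanSpace ℝ (Fin n) → ℝ → ℂ) : ℝ≥0∞ :=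
  (∫⁻ t : ℝ, ∫⁻ x : EuclideanSpace ℝ (Fin n), (‖h x t‖₊ : ℝ≥0∞) ^ (2 : ℝ) * w x) ^ ((1 : ℝ) / 2)

/-- The homogeneous Sobolev norm `‖h‖_{Ḣ^γ} = ‖(√−Δ)^γ h‖_{L²}`. -/
def sobNorm (n : ℕ) (γ : ℝ) (h : EuclideanSpace ℝ (Fin n) → ℂ) : ℝ≥0∞ :=
  eLpNorm (mOp n (powMult γ) h) 2 volume

/-- The point `x/|x|` of the unit sphere, for `x ≠ 0`. -/
def sphMap (n : ℕ) (x : EuclideanSpace ℝ (Fin n)) (hx : x ≠ 0) :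
    Metric.sphere (0 : EuclideanSpace ℝ (Fin n)) 1 :=
  ⟨‖x‖⁻¹ • x, by
    rw [mem_sphere_zero_iff_norm, norm_smul, norm_inv, norm_norm,
      inv_mul_cancel₀ (norm_ne_zero_iff.mpr hx)]⟩

set_option linter.unusedSectionVars false

section P0
variable {V : Type*} [NormedAddCommGroup V] [InnerProductSpace ℝ V] [FiniteDimensional ℝ V]
  [MeasurableSpace V] [BorelSpace V]

lemma p0_fourierInv_continuous {g : V → ℂ} (hg : Integrable g) : Continuous (𝓕⁻ g) := by
  have h1 : Continuous (𝓕 g) :=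
    VectorFourier.fourierIntegral_continuous Real.continuous_fourierChar
      (by exact continuous_inner) hg
  have : 𝓕⁻ g = fun x => 𝓕 g (-x) := by
    ext x; exact Real.fourierInv_eq_fourier_neg g x
  rw [this]
  exact h1.comp continuous_neg

lemma p0_plancherel_ae {g : V → ℂ} (hg : Integrable g) (hg2 : MemLp g 2) :
    ((𝓕⁻ (hg2.toLp g) : Lp ℂ 2 (volume : Measure V)) : V → ℂ) =ᵐ[volume] 𝓕⁻ g := by
  apply ae_eq_of_integral_contDiff_smul_eq
  · exact (Lp.memLp _).locallyIntegrable (by norm_num)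
  · exact (p0_fourierInv_continuous hg).locallyIntegrable
  · intro φ φs φc
    have hg₁ : HasCompactSupport (Complex.ofRealCLM ∘ φ) := φc.comp_left rfl
    have hg₂ : ContDiff ℝ ((⊤ : ℕ∞) : WithTop ℕ∞) (Complex.ofRealCLM ∘ φ) := by fun_prop
    set ψ : 𝓢(V, ℂ) := hg₁.toSchwartzMap hg₂ with hψ
    have key := Lp.fourierInv_toTemperedDistribution_eq (hg2.toLp g)
    have k2 := congrArg (fun T => T ψ) key
    simp only [TemperedDistribution.fourierInv_apply, Lp.toTemperedDistribution_apply] at k2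
    have e1 : ∫ x, φ x • (𝓕⁻ (hg2.toLp g) : Lp ℂ 2 (volume : Measure V)) x
        = ∫ x, ψ x • (𝓕⁻ (hg2.toLp g) : Lp ℂ 2 (volume : Measure V)) x := by
      congr
    rw [e1, ← k2]
    have e2 : ∫ x, (𝓕⁻ ψ) x • (hg2.toLp g : V → ℂ) x = ∫ x, (𝓕⁻ ψ) x • g x := by
      apply integral_congr_ae
      filter_upwards [hg2.coeFn_toLp] with x hx
      rw [hx]
    rw [e2]
    have e3 := VectorFourier.integral_fourierIntegral_smul_eq_flip (L := innerₗ V) (μ := volume)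
      (ν := volume)
      Real.continuous_fourierChar continuous_inner (f := (fun x => ψ (-x))) (g := g)
      (ψ.integrable.comp_neg) hg
    have e4 : ∀ ξ, VectorFourier.fourierIntegral 𝐞 volume (innerₗ V) (fun x => ψ (-x)) ξ
        = 𝓕⁻ ψ ξ := by
      intro ξ
      rw [SchwartzMap.fourierInv_coe, Real.fourierInv_eq_fourier_comp_neg]
      rfl
    simp only [e4] at e3
    rw [e3, ← integral_neg_eq_self]
    simp only [neg_neg]
    apply integral_congr_ae
    filter_upwards with x
    have : VectorFourier.fourierIntegral 𝐞 volume (innerₗ V).flip g (-x) = 𝓕⁻ g x := by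
      rw [Real.fourierInv_eq_fourier_neg, flip_innerₗ]; rfl
    rw [this]
    rfl

lemma p0_plancherel {g : V → ℂ} (hg : Integrable g) (hg2 : MemLp g 2) :
    eLpNorm (𝓕⁻ g) 2 volume = eLpNorm g 2 volume := by
  rw [← eLpNorm_congr_ae (p0_plancherel_ae hg hg2), ← eLpNorm_congr_ae hg2.coeFn_toLp]
  have h : ‖(𝓕⁻ (hg2.toLp g) : Lp ℂ 2 (volume : Measure V))‖ = ‖hg2.toLp g‖ :=
    (Lp.fourierTransformₗᵢ V ℂ).symm.norm_map _
  rw [Lp.norm_def, Lp.norm_def] at h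
  rwa [ENNReal.toReal_eq_toReal_iff' (Lp.memLp _).2.ne (Lp.memLp _).2.ne] at h

lemma p0_plancherel' {g : V → ℂ} (hg : Integrable g) (hg2 : MemLp g 2) :
    eLpNorm (𝓕 g) 2 volume = eLpNorm g 2 volume := by
  rw [← p0_plancherel hg hg2]
  have : 𝓕 g = (𝓕⁻ g) ∘ (fun x => -x) := by
    ext x; simp [Real.fourierInv_eq_fourier_neg g]
  rw [this, eLpNorm_comp_measurePreserving]
  · exact (p0_fourierInv_continuous hg).aestronglyMeasurable
  · exact Measure.measurePreserving_neg _

end P0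

section P0b
variable {α β : Type*} [MeasurableSpace α] [MeasurableSpace β]

lemma p0_mink_aux {p : ℝ} (hp : 1 < p) (μ : Measure α) [SFinite μ] (ν : Measure β) [SFinite ν]
    {f : α → β → ℝ≥0∞} (hf : Measurable (Function.uncurry f)) {G : β → ℝ≥0∞} (hG : Measurable G)
    (hGle : ∀ y, G y ≤ ∫⁻ x, f x y ∂μ) (hfin : ∫⁻ y, G y ^ p ∂ν ≠ ∞) :
    (∫⁻ y, G y ^ p ∂ν) ^ (1 / p) ≤ ∫⁻ x, (∫⁻ y, f x y ^ p ∂ν) ^ (1 / p) ∂μ := by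
  have hp0 : 0 < p := by linarith
  obtain ⟨p', hpp⟩ : ∃ p', p.HolderConjugate p' := ⟨_, Real.HolderConjugate.conjExponent hp⟩
  set I := ∫⁻ y, G y ^ p ∂ν with hI
  set R := ∫⁻ x, (∫⁻ y, f x y ^ p ∂ν) ^ (1 / p) ∂μ with hR
  have h1 : I ≤ R * I ^ (1 / p') := by
    calc I = ∫⁻ y, G y * G y ^ (p - 1) ∂ν := by
          apply lintegral_congr; intro y
          rcases eq_or_ne (G y) 0 with h | h
          · simp [h, hp0]
          rcases eq_or_ne (G y) ∞ with h' | h'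
          · have : 0 < p - 1 := by linarith
            simp [h', hp0, this]
          nth_rw 2 [← ENNReal.rpow_one (G y)]
          rw [← ENNReal.rpow_add _ _ h h']; congr 1; ring
      _ ≤ ∫⁻ y, (∫⁻ x, f x y ∂μ) * G y ^ (p - 1) ∂ν := by
          gcongr with y; exact hGle y
      _ = ∫⁻ y, ∫⁻ x, f x y * G y ^ (p - 1) ∂μ ∂ν := by
          apply lintegral_congr; intro y
          rw [lintegral_mul_const]
          exact hf.comp (measurable_id.prodMk measurable_const)
      _ = ∫⁻ x, ∫⁻ y, f x y * G y ^ (p - 1) ∂ν ∂μ := by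
          rw [lintegral_lintegral_swap]
          apply Measurable.aemeasurable
          exact (hf.comp measurable_swap).mul ((hG.comp measurable_fst).pow_const _)
      _ ≤ ∫⁻ x, (∫⁻ y, f x y ^ p ∂ν) ^ (1 / p) * I ^ (1 / p') ∂μ := by
          gcongr with x
          have := ENNReal.lintegral_mul_le_Lp_mul_Lq ν hpp
            (f := fun y => f x y) (g := fun y => G y ^ (p - 1))
            (hf.comp (measurable_const.prodMk measurable_id)).aemeasurable
            (hG.pow_const _).aemeasurable
          refine this.trans_eq ?_
          congr 2
          apply lintegral_congr; intro y
          rw [← ENNReal.rpow_mul, hpp.sub_one_mul_conj]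
      _ = R * I ^ (1 / p') := by
          rw [lintegral_mul_const]
          apply Measurable.pow_const
          exact (hf.pow_const p).lintegral_prod_right
  rcases eq_or_ne I 0 with h0 | h0
  · simp [h0, hp0]
  have hI' : I ^ (1 / p') ≠ 0 := by
    simp [ENNReal.rpow_eq_zero_iff, h0, hfin]
  have hI'' : I ^ (1 / p') ≠ ∞ := by
    have : 0 ≤ 1 / p' := by have := hpp.symm.pos; positivity
    exact ENNReal.rpow_ne_top_of_nonneg this hfin
  have e : I = I ^ (1 / p) * I ^ (1 / p') := by
    rw [← ENNReal.rpow_add _ _ h0 hfin]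
    have := hpp.inv_add_inv_eq_one
    rw [one_div, one_div, this, ENNReal.rpow_one]
  have h2 : I ^ (1 / p) * I ^ (1 / p') ≤ R * I ^ (1 / p') := by rw [← e]; exact h1
  exact (ENNReal.mul_le_mul_iff_left hI' hI'').1 h2

/-- Minkowski's integral inequality. -/
lemma p0_minkowski {p : ℝ} (hp : 1 ≤ p) (μ : Measure α) [SFinite μ] (ν : Measure β) [SigmaFinite ν]
    {f : α → β → ℝ≥0∞} (hf : Measurable (Function.uncurry f)) :
    (∫⁻ y, (∫⁻ x, f x y ∂μ) ^ p ∂ν) ^ (1 / p) ≤ ∫⁻ x, (∫⁻ y, f x y ^ p ∂ν) ^ (1 / p) ∂μ := by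
  rcases eq_or_lt_of_le hp with rfl | hp
  · simp only [ENNReal.rpow_one, one_div, inv_one]
    rw [lintegral_lintegral_swap]
    exact (hf.comp measurable_swap).aemeasurable
  have hp0 : 0 < p := by linarith
  set G : β → ℝ≥0∞ := fun y => ∫⁻ x, f x y ∂μ with hG
  have hGm : Measurable G :=
    Measurable.lintegral_prod_right (f := fun y x => f x y) (hf.comp measurable_swap)
  let S := spanningSets ν
  let Gn : ℕ → β → ℝ≥0∞ := fun N => (S N).indicator (fun y => min (G y) N)
  have hGn : ∀ N, Measurable (Gn N) := fun N =>
    (hGm.min measurable_const).indicator (measurableSet_spanningSets ν N)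
  have hmono : Monotone Gn := by
    intro a b hab y
    simp only [Gn]
    refine (Set.indicator_le_indicator_of_subset (monotone_spanningSets ν hab)
      (fun _ => zero_le) y).trans ?_
    refine Set.indicator_le_indicator ?_
    gcongr
  have hsup : ∀ y, ⨆ N, Gn N y = G y := by
    intro y
    apply le_antisymm
    · apply iSup_le; intro N
      simp only [Gn]
      exact (Set.indicator_le_self _ _ y).trans (min_le_left _ _)
    · have ⟨N0, hN0⟩ : ∃ N0, y ∈ S N0 := by
        have := iUnion_spanningSets ν
        have hy : y ∈ ⋃ i, spanningSets ν i := by rw [this]; trivial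
        exact Set.mem_iUnion.1 hy
      apply le_of_forall_lt
      intro c hc
      have ⟨N1, hN1⟩ : ∃ N1 : ℕ, c < N1 := ENNReal.exists_nat_gt hc.ne_top
      refine lt_of_lt_of_le ?_ (le_iSup _ (max N0 N1))
      have : y ∈ S (max N0 N1) := monotone_spanningSets ν (le_max_left _ _) hN0
      simp only [Gn, Set.indicator_of_mem this]
      refine lt_min hc (hN1.trans_le ?_)
      exact_mod_cast le_max_right _ _
  have h1 : ∀ N, (∫⁻ y, Gn N y ^ p ∂ν) ^ (1 / p) ≤ ∫⁻ x, (∫⁻ y, f x y ^ p ∂ν) ^ (1 / p) ∂μ := by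
    intro N
    apply p0_mink_aux hp μ ν hf (hGn N)
    · intro y
      simp only [Gn]
      exact (Set.indicator_le_self _ _ y).trans (min_le_left _ _)
    · apply ne_of_lt
      calc ∫⁻ y, Gn N y ^ p ∂ν ≤ ∫⁻ y, (S N).indicator (fun _ => (N : ℝ≥0∞) ^ p) y ∂ν := by
            gcongr with y
            simp only [Gn]
            by_cases hy : y ∈ S N
            · simp only [Set.indicator_of_mem hy]
              gcongr; exact min_le_right _ _
            · simp [Set.indicator_of_notMem hy, hp0]
        _ = (N : ℝ≥0∞) ^ p * ν (S N) := by
            rw [lintegral_indicator (measurableSet_spanningSets ν N), lintegral_const]; simp [S]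
        _ < ∞ := by
            apply ENNReal.mul_lt_top
            · exact ENNReal.rpow_lt_top_of_nonneg hp0.le (by simp)
            · exact measure_spanningSets_lt_top ν N
  have h2 : ∫⁻ y, G y ^ p ∂ν = ⨆ N, ∫⁻ y, Gn N y ^ p ∂ν := by
    rw [← lintegral_iSup (fun N => (hGn N).pow_const p)]
    · apply lintegral_congr; intro y
      rw [← hsup y]
      exact (ENNReal.orderIsoRpow p hp0).map_iSup _
    · intro a b hab y
      have := hmono hab y
      simp only
      gcongr
  rw [h2]
  have : (⨆ N, ∫⁻ y, Gn N y ^ p ∂ν) ^ (1 / p) = ⨆ N, (∫⁻ y, Gn N y ^ p ∂ν) ^ (1 / p) :=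
    (ENNReal.orderIsoRpow (1 / p) (by positivity)).map_iSup _
  rw [this]
  exact iSup_le h1

end P0b

section P1a

lemma p1_integral_sinh {c : ℝ} (hc : 0 < c) :
    ∫ u : ℝ, Real.cosh u * Real.exp (-c * (Real.sinh u)^2) = Real.sqrt (Real.pi / c) := by
  have h := integral_image_eq_integral_abs_deriv_smul (s := Set.univ) (f := Real.sinh)
    (f' := Real.cosh) MeasurableSet.univ (fun x _ => (Real.hasDerivAt_sinh x).hasDerivWithinAt)
    Real.sinh_injective.injOn (fun v => Real.exp (-c * v^2))
  rw [Set.image_univ, Real.sinh_surjective.range_eq] at h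
  simp only [Measure.restrict_univ, smul_eq_mul, abs_of_pos (Real.cosh_pos _)] at h
  rw [← h, integral_gaussian]

lemma p1_integrable_sinh {c : ℝ} (hc : 0 < c) :
    Integrable (fun u : ℝ => Real.cosh u * Real.exp (-c * (Real.sinh u)^2)) := by
  have h := integrableOn_image_iff_integrableOn_abs_deriv_smul (s := Set.univ) (f := Real.sinh)
    (f' := Real.cosh) MeasurableSet.univ (fun x _ => (Real.hasDerivAt_sinh x).hasDerivWithinAt)
    Real.sinh_injective.injOn (fun v => Real.exp (-c * v^2))
  rw [Set.image_univ, Real.sinh_surjective.range_eq, integrableOn_univ, integrableOn_univ] at h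
  simp only [smul_eq_mul, abs_of_pos (Real.cosh_pos _)] at h
  exact h.1 (integrable_exp_neg_mul_sq hc)

lemma p1_integral_exp_sinh {c : ℝ} (hc : 0 < c) :
    ∫ u : ℝ, Real.exp u * Real.exp (-c * (Real.sinh u)^2) = Real.sqrt (Real.pi / c) := by
  have hI := p1_integrable_sinh hc
  have hm : Integrable (fun u : ℝ => Real.exp u * Real.exp (-c * (Real.sinh u)^2)) := by
    refine (hI.const_mul 2).mono' (by fun_prop) ?_
    filter_upwards with u
    rw [Real.norm_of_nonneg (by positivity), ← mul_assoc]
    gcongr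
    rw [Real.cosh_eq]; have := Real.exp_pos (-u); linarith
  have h1 := integral_neg_eq_self (fun u : ℝ => Real.exp u * Real.exp (-c * (Real.sinh u)^2)) volume
  have h2 : ∫ u : ℝ, Real.cosh u * Real.exp (-c * (Real.sinh u)^2) =
      (1/2) * ((∫ u : ℝ, Real.exp u * Real.exp (-c * (Real.sinh u)^2)) +
       ∫ u : ℝ, Real.exp (-u) * Real.exp (-c * (Real.sinh (-u))^2)) := by
    rw [← integral_add hm hm.comp_neg, ← integral_const_mul]
    congr 1; ext u
    rw [Real.cosh_eq, Real.sinh_neg]; ring_nf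
  rw [← p1_integral_sinh hc, h2, h1]; ring

/-- subordination -/
lemma p1_subord {y ρ : ℝ} (hy : 0 < y) (hρ : 0 < ρ) :
    ∫ w in Set.Ioi (0:ℝ), w ^ (-(1/2) : ℝ) * Real.exp (-(y^2/4) * w) * Real.exp (-(1/w) * ρ^2)
      = (2 * Real.sqrt Real.pi / y) * Real.exp (-y * ρ) := by
  set a := 2 * ρ / y with ha
  have ha0 : 0 < a := by positivity
  have himg : Set.image (fun u : ℝ => a * Real.exp (2*u)) Set.univ = Set.Ioi 0 := by
    ext w; constructor
    · rintro ⟨u, -, rfl⟩; simp only [Set.mem_Ioi]; positivity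
    · intro (hw : 0 < w)
      refine ⟨Real.log (w/a) / 2, trivial, ?_⟩
      simp only
      rw [mul_div_cancel₀ _ (by norm_num : (2:ℝ) ≠ 0), Real.exp_log (by positivity)]
      field_simp
  have h := integral_image_eq_integral_abs_deriv_smul (s := Set.univ)
    (f := fun u : ℝ => a * Real.exp (2*u))
    (f' := fun u => a * (Real.exp (2*u) * 2)) MeasurableSet.univ
    (fun x _ => by
      have h0 : HasDerivAt (fun u : ℝ => 2 * u) 2 x := by
        simpa using (hasDerivAt_id x).const_mul 2
      exact (h0.exp.const_mul a).hasDerivWithinAt)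
    (by
      intro u _ v _ huv
      have := mul_left_cancel₀ ha0.ne' huv
      have := Real.exp_injective this
      linarith)
    (fun w => w ^ (-(1/2) : ℝ) * Real.exp (-(y^2/4) * w) * Real.exp (-(1/w) * ρ^2))
  rw [himg] at h
  rw [h, Measure.restrict_univ]
  have key : ∀ u : ℝ, |a * (Real.exp (2*u) * 2)| • ((a * Real.exp (2*u)) ^ (-(1/2) : ℝ) *
      Real.exp (-(y^2/4) * (a * Real.exp (2*u))) * Real.exp (-(1/(a * Real.exp (2*u))) * ρ^2))
      = (2 * Real.sqrt a * Real.exp (-y*ρ)) * (Real.exp u * Real.exp (-(2*y*ρ) * (Real.sinh u)^2)) := by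
    intro u
    rw [abs_of_pos (by positivity), smul_eq_mul]
    have e1 : (a * Real.exp (2*u)) ^ (-(1/2) : ℝ) = (Real.sqrt a)⁻¹ * Real.exp (-u) := by
      rw [Real.mul_rpow ha0.le (Real.exp_pos _).le, ← Real.exp_mul, Real.rpow_neg ha0.le,
        ← Real.sqrt_eq_rpow]
      congr 2; ring
    have e2 : Real.exp (-(y^2/4) * (a * Real.exp (2*u))) * Real.exp (-(1/(a * Real.exp (2*u))) * ρ^2)
        = Real.exp (-y*ρ) * Real.exp (-(2*y*ρ) * (Real.sinh u)^2) := by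
      rw [← Real.exp_add, ← Real.exp_add]
      congr 1
      have : 1/(a * Real.exp (2*u)) = a⁻¹ * Real.exp (-(2*u)) := by
        rw [Real.exp_neg]; field_simp
      rw [this, Real.sinh_eq, ha]
      have e3 : Real.exp (2*u) = Real.exp u ^ 2 := by rw [← Real.exp_nat_mul]; norm_num
      have e4 : Real.exp (-(2*u)) = Real.exp (-u) ^ 2 := by
        rw [← Real.exp_nat_mul]; norm_num
      have e5 : Real.exp u * Real.exp (-u) = 1 := by rw [← Real.exp_add]; simp
      rw [e3, e4]
      field_simp
      linear_combination (-8) * e5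
    rw [e1, mul_assoc ((Real.sqrt a)⁻¹ * _), e2]
    have e3 : Real.exp (2*u) * Real.exp (-u) = Real.exp u := by rw [← Real.exp_add]; ring_nf
    have e4 : a * (Real.sqrt a)⁻¹ = Real.sqrt a := by
      rw [← div_eq_mul_inv, Real.div_sqrt]
    calc _ = 2 * (a * (Real.sqrt a)⁻¹) * (Real.exp (2*u) * Real.exp (-u)) *
          (Real.exp (-y*ρ) * Real.exp (-(2*y*ρ) * (Real.sinh u)^2)) := by ring
      _ = _ := by rw [e3, e4]; ring
  simp_rw [key]
  rw [integral_const_mul, p1_integral_exp_sinh (by positivity)]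
  have : Real.sqrt a * Real.sqrt (Real.pi / (2*y*ρ)) = Real.sqrt Real.pi / y := by
    rw [← Real.sqrt_mul ha0.le]
    have : a * (Real.pi / (2*y*ρ)) = Real.pi / y^2 := by rw [ha]; field_simp
    rw [this, Real.sqrt_div Real.pi_pos.le, Real.sqrt_sq hy.le]
  calc _ = 2 * Real.exp (-y*ρ) * (Real.sqrt a * Real.sqrt (Real.pi / (2*y*ρ))) := by ring
    _ = _ := by rw [this]; ring

end P1a

section P1b
variable {V : Type*} [NormedAddCommGroup V] [InnerProductSpace ℝ V] [FiniteDimensional ℝ V]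
  [MeasurableSpace V] [BorelSpace V]

lemma p1_gauss (x : V) {w : ℝ} (hw : 0 < w) :
    ∫ ξ : V, cexp (↑(2 * Real.pi * inner ℝ ξ x) * I) * ((Real.exp (-(1/w) * ‖ξ‖^2) : ℝ) : ℂ)
      = (((Real.pi * w) ^ ((Module.finrank ℝ V : ℝ)/2) *
          Real.exp (-(Real.pi^2 * ‖x‖^2) * w) : ℝ) : ℂ) := by
  have h := GaussianFourier.integral_cexp_neg_mul_sq_norm_add (V := V) (b := ((1/w : ℝ) : ℂ))
    (by rw [ofReal_re]; positivity) (2 * Real.pi * I) x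
  have e1 : ∀ ξ : V, cexp (↑(2 * Real.pi * inner ℝ ξ x) * I) *
      ((Real.exp (-(1/w) * ‖ξ‖^2) : ℝ) : ℂ) =
      cexp (-((1/w : ℝ) : ℂ) * ‖ξ‖ ^ 2 + (2 * Real.pi * I) * (inner ℝ x ξ : ℝ)) := by
    intro ξ
    rw [Complex.ofReal_exp, ← Complex.exp_add, real_inner_comm]
    congr 1
    push_cast; ring
  simp_rw [e1]
  rw [h]
  push_cast
  rw [Complex.ofReal_cpow (by positivity)]
  have hw' : (w : ℂ) ≠ 0 := by exact_mod_cast hw.ne'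
  congr 1
  · push_cast
    congr 1
    field_simp
  · congr 1
    field_simp
    rw [I_sq]; ring

lemma p1_gauss_integrable {w : ℝ} (hw : 0 < w) :
    Integrable (fun ξ : V => Real.exp (-w * ‖ξ‖^2)) := by
  have h := GaussianFourier.integrable_cexp_neg_mul_sq_norm_add (V := V) (b := ((w : ℝ) : ℂ))
    (by rw [ofReal_re]; positivity) 0 0
  refine h.norm.congr ?_
  filter_upwards with ξ
  rw [Complex.norm_exp]
  congr 1
  have : (-(w:ℂ) * (‖ξ‖:ℂ) ^ 2 + 0 * (inner ℝ (0:V) ξ : ℝ)) = ((-w * ‖ξ‖^2 : ℝ) : ℂ) := by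
    push_cast; ring
  rw [this, ofReal_re]

lemma p1_rpow_exp_integrableOn {a b : ℝ} (ha : -1 < a) (hb : 0 < b) :
    IntegrableOn (fun w : ℝ => w ^ a * Real.exp (-b * w)) (Set.Ioi 0) := by
  have := integrableOn_rpow_mul_exp_neg_mul_rpow (s := a) (p := 1) (b := b) ha one_pos hb
  simpa using this

lemma p1_joint_int (x : V) {y : ℝ} (hy : 0 < y) :
    Integrable (Function.uncurry fun (ξ : V) (w : ℝ) =>
      cexp (↑(2 * Real.pi * inner ℝ ξ x) * I) *
      ((w ^ (-(1/2) : ℝ) * Real.exp (-(y^2/4) * w) * Real.exp (-(1/w) * ‖ξ‖^2) : ℝ) : ℂ))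
      ((volume : Measure V).prod (volume.restrict (Set.Ioi (0:ℝ)))) := by
  have hm : AEStronglyMeasurable (Function.uncurry fun (ξ : V) (w : ℝ) =>
      cexp (↑(2 * Real.pi * inner ℝ ξ x) * I) *
      ((w ^ (-(1/2) : ℝ) * Real.exp (-(y^2/4) * w) * Real.exp (-(1/w) * ‖ξ‖^2) : ℝ) : ℂ))
      ((volume : Measure V).prod (volume.restrict (Set.Ioi (0:ℝ)))) := by
    apply Measurable.aestronglyMeasurable
    unfold Function.uncurry
    fun_prop
  rw [integrable_prod_iff' hm]
  constructor
  · rw [ae_restrict_iff' measurableSet_Ioi]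
    filter_upwards with w (hw : 0 < w)
    refine ((p1_gauss_integrable (V := V) (w := 1/w) (by positivity)).const_mul
      (w ^ (-(1/2) : ℝ) * Real.exp (-(y^2/4) * w))).mono' ?_ ?_
    · apply Measurable.aestronglyMeasurable
      unfold Function.uncurry
      fun_prop
    · filter_upwards with ξ
      simp only [Function.uncurry]
      rw [norm_mul, Complex.norm_exp_ofReal_mul_I, one_mul, Complex.norm_real,
        Real.norm_of_nonneg (by positivity)]
  · have h2 := (p1_rpow_exp_integrableOn (a := (-(1/2) : ℝ) + (Module.finrank ℝ V : ℝ)/2)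
      (b := y^2/4) (by have : (0:ℝ) ≤ Module.finrank ℝ V := by positivity
                       linarith) (by positivity)).const_mul
                       (Real.pi ^ ((Module.finrank ℝ V : ℝ)/2))
    refine h2.congr ?_
    rw [Filter.EventuallyEq, ae_restrict_iff' measurableSet_Ioi]
    filter_upwards with w (hw : 0 < w)
    simp only [Function.uncurry]
    have e : ∀ ξ : V, ‖cexp (↑(2 * Real.pi * inner ℝ ξ x) * I) *
      ((w ^ (-(1/2) : ℝ) * Real.exp (-(y^2/4) * w) * Real.exp (-(1/w) * ‖ξ‖^2) : ℝ) : ℂ)‖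
       = (w ^ (-(1/2) : ℝ) * Real.exp (-(y^2/4) * w)) * Real.exp (-(1/w) * ‖ξ‖^2) := by
      intro ξ
      rw [norm_mul, Complex.norm_exp_ofReal_mul_I, one_mul, Complex.norm_real,
        Real.norm_of_nonneg (by positivity)]
    simp_rw [e]
    rw [integral_const_mul, GaussianFourier.integral_rexp_neg_mul_sq_norm (by positivity),
      Real.rpow_add hw]
    have : Real.pi / (1/w) = Real.pi * w := by field_simp
    rw [this, Real.mul_rpow Real.pi_pos.le hw.le]
    ring

def p1c (V : Type*) [NormedAddCommGroup V] [InnerProductSpace ℝ V] : ℝ :=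
  (Real.pi ^ ((Module.finrank ℝ V : ℝ)/2) / (2 * Real.sqrt Real.pi)) *
    Real.Gamma (((Module.finrank ℝ V : ℝ)+1)/2)

lemma p1_real [Nontrivial V] (x : V) {y : ℝ} (hy : 0 < y) :
    ∫ ξ : V, cexp (↑(2 * Real.pi * inner ℝ ξ x) * I) * cexp (-y * ‖ξ‖)
      = ((p1c V * y * (y^2/4 + Real.pi^2 * ‖x‖^2) ^ (-(((Module.finrank ℝ V : ℝ)+1)/2)) : ℝ) : ℂ) := by
  have hsq : 0 < Real.sqrt Real.pi := Real.sqrt_pos.2 Real.pi_pos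
  have hsw := integral_integral_swap (p1_joint_int x hy)
  have e1 : ∀ᵐ ξ : V, cexp (↑(2 * Real.pi * inner ℝ ξ x) * I) * cexp (-y * ‖ξ‖) =
     ((y / (2 * Real.sqrt Real.pi) : ℝ) : ℂ) * ∫ w in Set.Ioi (0:ℝ),
      cexp (↑(2 * Real.pi * inner ℝ ξ x) * I) *
      ((w ^ (-(1/2) : ℝ) * Real.exp (-(y^2/4) * w) * Real.exp (-(1/w) * ‖ξ‖^2) : ℝ) : ℂ) := by
    have : ∀ᵐ ξ : V, ξ ≠ 0 := by
      simp [ae_iff]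
    filter_upwards [this] with ξ hξ
    rw [integral_const_mul, integral_complex_ofReal, p1_subord hy (norm_pos_iff.2 hξ)]
    rw [mul_left_comm, ← ofReal_mul]
    have : y / (2 * Real.sqrt Real.pi) * (2 * Real.sqrt Real.pi / y * Real.exp (-y * ‖ξ‖))
      = Real.exp (-y * ‖ξ‖) := by field_simp
    rw [this]; push_cast; rfl
  rw [integral_congr_ae e1, integral_const_mul, hsw]
  have e2 : ∀ w ∈ Set.Ioi (0:ℝ), ∫ ξ : V, cexp (↑(2 * Real.pi * inner ℝ ξ x) * I) *
      ((w ^ (-(1/2) : ℝ) * Real.exp (-(y^2/4) * w) * Real.exp (-(1/w) * ‖ξ‖^2) : ℝ) : ℂ)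
      = ((Real.pi ^ ((Module.finrank ℝ V : ℝ)/2) * (w ^ (((Module.finrank ℝ V : ℝ)+1)/2 - 1) *
         Real.exp (-((y^2/4 + Real.pi^2 * ‖x‖^2) * w))) : ℝ) : ℂ) := by
    intro w (hw : 0 < w)
    have : ∀ ξ : V, cexp (↑(2 * Real.pi * inner ℝ ξ x) * I) *
      ((w ^ (-(1/2) : ℝ) * Real.exp (-(y^2/4) * w) * Real.exp (-(1/w) * ‖ξ‖^2) : ℝ) : ℂ)
      = ((w ^ (-(1/2) : ℝ) * Real.exp (-(y^2/4) * w) : ℝ) : ℂ) *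
      (cexp (↑(2 * Real.pi * inner ℝ ξ x) * I) * ((Real.exp (-(1/w) * ‖ξ‖^2) : ℝ) : ℂ)) := by
      intro ξ; rw [ofReal_mul (w ^ (-(1/2) : ℝ) * Real.exp (-(y^2/4) * w))]; ring
    simp_rw [this]
    rw [integral_const_mul, p1_gauss x hw, ← ofReal_mul]
    congr 1
    rw [Real.mul_rpow Real.pi_pos.le hw.le]
    have e3 : w ^ (((Module.finrank ℝ V : ℝ)+1)/2 - 1) =
       w ^ (-(1/2) : ℝ) * w ^ ((Module.finrank ℝ V : ℝ)/2) := by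
      rw [← Real.rpow_add hw]; congr 1; ring
    have e4 : Real.exp (-((y^2/4 + Real.pi^2 * ‖x‖^2) * w)) =
      Real.exp (-(y^2/4) * w) * Real.exp (-(Real.pi^2 * ‖x‖^2) * w) := by
      rw [← Real.exp_add]; congr 1; ring
    rw [e3, e4]; ring
  rw [setIntegral_congr_fun measurableSet_Ioi e2, integral_complex_ofReal, integral_const_mul,
    Real.integral_rpow_mul_exp_neg_mul_Ioi (by positivity) (by positivity), ← ofReal_mul]
  congr 1
  rw [Real.rpow_neg (by positivity), one_div, Real.inv_rpow (by positivity), p1c]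
  ring

end P1b

section P1c
variable {V : Type*} [NormedAddCommGroup V] [InnerProductSpace ℝ V] [FiniteDimensional ℝ V]
  [MeasurableSpace V] [BorelSpace V]

lemma p1_norm_rpow_exp_integrable [Nontrivial V] {a b : ℝ} (ha : -(Module.finrank ℝ V : ℝ) < a)
    (hb : 0 < b) : Integrable (fun ξ : V => ‖ξ‖ ^ a * Real.exp (-b * ‖ξ‖)) := by
  have := (integrable_fun_norm_addHaar (volume : Measure V)
    (f := fun t : ℝ => t ^ a * Real.exp (-b * t))).2 ?_
  · exact this
  have h1 := p1_rpow_exp_integrableOn (a := (Module.finrank ℝ V : ℝ) - 1 + a) (b := b)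
    (by linarith) hb
  refine h1.congr_fun ?_ measurableSet_Ioi
  intro t (ht : 0 < t)
  have hd : 1 ≤ Module.finrank ℝ V := Module.finrank_pos
  simp only [smul_eq_mul]
  rw [Real.rpow_add ht, ← Real.rpow_natCast, Nat.cast_sub hd]
  push_cast; ring

lemma p1_exp_integrable [Nontrivial V] {b : ℝ}
    (hb : 0 < b) : Integrable (fun ξ : V => Real.exp (-b * ‖ξ‖)) := by
  have hd : (0:ℝ) < Module.finrank ℝ V := by exact_mod_cast Module.finrank_pos
  have := p1_norm_rpow_exp_integrable (V := V) (a := 0) (b := b) (by linarith) hb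
  simpa using this

lemma p1_slit {z : ℂ} (hz : 0 < z.re) {b : ℝ} (hb : 0 ≤ b) : z^2/4 + b ∈ slitPlane := by
  rw [mem_slitPlane_iff]
  by_cases hi : z.im = 0
  · left
    have : z^2/4 + b = ((z.re^2/4 + b : ℝ) : ℂ) := by
      have : z = (z.re : ℂ) := by apply Complex.ext <;> simp [hi]
      rw [this]; push_cast; simp
    rw [this, ofReal_re]; positivity
  · right
    have : (z^2/4 + b).im = z.re * z.im / 2 := by
      have : z^2/4 + (b:ℂ) = ((1/4:ℝ):ℂ) * (z*z) + b := by push_cast; ring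
      rw [this, add_im, Complex.im_ofReal_mul, mul_im, ofReal_im]; ring
    rw [this]
    have := mul_ne_zero hz.ne' hi
    intro h; apply this; linarith

lemma p1_lhs_diff [Nontrivial V] (x : V) {z : ℂ} (hz : 0 < z.re) :
    DifferentiableAt ℂ (fun z : ℂ => ∫ ξ : V, cexp (↑(2 * Real.pi * inner ℝ ξ x) * I) *
      cexp (-z * ‖ξ‖)) z := by
  have hd : (0:ℝ) < Module.finrank ℝ V := by exact_mod_cast Module.finrank_pos
  have h := hasDerivAt_integral_of_dominated_loc_of_deriv_le (𝕜 := ℂ) (μ := (volume : Measure V))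
    (F := fun z ξ => cexp (↑(2 * Real.pi * inner ℝ ξ x) * I) * cexp (-z * ‖ξ‖))
    (F' := fun z ξ => cexp (↑(2 * Real.pi * inner ℝ ξ x) * I) * (cexp (-z * ‖ξ‖) * (-‖ξ‖)))
    (s := {w : ℂ | z.re/2 < w.re}) (x₀ := z)
    (bound := fun ξ : V => ‖ξ‖ ^ (1:ℝ) * Real.exp (-(z.re/2) * ‖ξ‖)) ?_ ?_ ?_ ?_ ?_ ?_ ?_
  · exact h.2.differentiableAt
  · apply (isOpen_lt continuous_const continuous_re).mem_nhds
    simp only [Set.mem_setOf_eq]; linarith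
  · filter_upwards with w
    apply Continuous.aestronglyMeasurable
    fun_prop
  · refine (p1_exp_integrable (V := V) hz).mono' (by
      apply Continuous.aestronglyMeasurable
      fun_prop) ?_
    filter_upwards with ξ
    rw [norm_mul, Complex.norm_exp_ofReal_mul_I, one_mul, Complex.norm_exp]
    simp
  · apply Continuous.aestronglyMeasurable
    fun_prop
  · filter_upwards with ξ w (hw : z.re/2 < w.re)
    rw [norm_mul, Complex.norm_exp_ofReal_mul_I, one_mul, norm_mul, Complex.norm_exp, mul_comm]
    simp only [norm_neg, norm_real, norm_norm, Real.rpow_one]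
    gcongr
    simp; gcongr
  · exact p1_norm_rpow_exp_integrable (by linarith) (by linarith)
  · filter_upwards with ξ w _
    have h1 : HasDerivAt (fun w : ℂ => -w * ‖ξ‖) (-‖ξ‖ : ℂ) w := by
      simpa using ((hasDerivAt_id w).neg.mul_const (‖ξ‖ : ℂ))
    exact (h1.cexp).const_mul _

lemma p1_complex [Nontrivial V] (x : V) {z : ℂ} (hz : 0 < z.re) :
    ∫ ξ : V, cexp (↑(2 * Real.pi * inner ℝ ξ x) * I) * cexp (-z * ‖ξ‖)
      = p1c V * z * (z^2/4 + (Real.pi^2 * ‖x‖^2 : ℝ)) ^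
        ((-(((Module.finrank ℝ V : ℝ)+1)/2) : ℝ) : ℂ) := by
  set U : Set ℂ := {w : ℂ | 0 < w.re} with hU
  have hUo : IsOpen U := isOpen_lt continuous_const continuous_re
  have hUc : IsPreconnected U := (convex_halfSpace_re_gt 0).isPreconnected
  set f : ℂ → ℂ := fun z => ∫ ξ : V, cexp (↑(2 * Real.pi * inner ℝ ξ x) * I) * cexp (-z * ‖ξ‖)
  set g : ℂ → ℂ := fun z => p1c V * z * (z^2/4 + (Real.pi^2 * ‖x‖^2 : ℝ)) ^
        ((-(((Module.finrank ℝ V : ℝ)+1)/2) : ℝ) : ℂ)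
  have hf : AnalyticOnNhd ℂ f U := DifferentiableOn.analyticOnNhd
    (fun w hw => (p1_lhs_diff x hw).differentiableWithinAt) hUo
  have hg : AnalyticOnNhd ℂ g U := by
    refine DifferentiableOn.analyticOnNhd (fun w hw => ?_) hUo
    apply DifferentiableAt.differentiableWithinAt
    apply DifferentiableAt.mul (by fun_prop)
    exact DifferentiableAt.cpow (by fun_prop) (by fun_prop) (p1_slit hw (by positivity))
  have := AnalyticOnNhd.eqOn_of_preconnected_of_frequently_eq hf hg hUc (z₀ := 1)
    (by simp [hU]) ?_
  · exact this hz
  have hfr : ∃ᶠ (y : ℝ) in nhdsWithin 1 {1}ᶜ, f y = g y := by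
    apply Filter.Eventually.frequently
    have : ∀ᶠ y : ℝ in nhdsWithin 1 {1}ᶜ, 0 < y :=
      nhdsWithin_le_nhds (lt_mem_nhds one_pos)
    filter_upwards [this] with y hy
    simp only [f, g]
    rw [p1_real x hy]
    push_cast
    rw [Complex.ofReal_cpow (by positivity)]
    push_cast; rfl
  have ht : Filter.Tendsto (fun y : ℝ => (y : ℂ)) (nhdsWithin 1 {1}ᶜ) (nhdsWithin 1 {1}ᶜ) := by
    apply tendsto_nhdsWithin_of_tendsto_nhds_of_eventually_within
    · have : Filter.Tendsto (fun y : ℝ => (y : ℂ)) (nhds 1) (nhds ((1:ℝ):ℂ)) :=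
        Complex.continuous_ofReal.tendsto 1
      rw [ofReal_one] at this
      exact this.mono_left nhdsWithin_le_nhds
    · filter_upwards [self_mem_nhdsWithin] with y hy
      simpa using hy
  exact ht.frequently hfr

lemma p1_base_lower {y τ b : ℝ} (hy : 0 < y) (hb : 0 ≤ b) :
    y * ‖(y + τ * I : ℂ)‖ / 4 ≤ ‖((y + τ * I : ℂ))^2/4 + (b^2 : ℝ)‖ := by
  wlog hτ : 0 ≤ τ generalizing τ
  · have h := this (τ := -τ) (by linarith)
    have e1 : (y + (-τ : ℝ) * I : ℂ) = (starRingEnd ℂ) (y + τ * I : ℂ) := by simp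
    have e2 : (starRingEnd ℂ (y + τ * I : ℂ))^2/4 + (b^2 : ℝ) =
       starRingEnd ℂ ((y + τ * I : ℂ)^2/4 + (b^2 : ℝ)) := by
      have : (starRingEnd ℂ) 4 = 4 := Complex.conj_ofNat 4
      simp [this]
    rw [e1, e2, Complex.norm_conj, Complex.norm_conj] at h
    exact h
  have e : ((y + τ * I : ℂ))^2/4 + (b^2 : ℝ) =
      ((y + (τ + 2*b) * I) * (y + (τ - 2*b) * I)) / 4 := by
    push_cast; ring_nf; rw [I_sq]; ring
  rw [e, norm_div, norm_mul]
  have h4 : ‖(4:ℂ)‖ = 4 := by simp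
  rw [h4, mul_comm y]
  gcongr
  · rw [Complex.norm_add_mul_I]
    have : ((τ:ℂ) + 2 * b) = ((τ + 2*b : ℝ) : ℂ) := by push_cast; rfl
    rw [this, Complex.norm_add_mul_I]
    gcongr
    linarith
  · have := Complex.abs_re_le_norm ((y + (τ - 2*b) * I : ℂ))
    simp at this
    exact (le_abs_self y).trans this

/-- dispersive estimate -/
lemma p1_disp (V : Type*) [NormedAddCommGroup V] [InnerProductSpace ℝ V] [FiniteDimensional ℝ V]
    [MeasurableSpace V] [BorelSpace V] [Nontrivial V] :
    ∃ C > (0:ℝ), ∀ (x : V) (y τ : ℝ), 0 < y → τ ≠ 0 →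
    ‖∫ ξ : V, cexp (↑(2 * Real.pi * inner ℝ ξ x) * I) * cexp (-(y + τ * I) * ‖ξ‖)‖ ≤
      C * y ^ (-(((Module.finrank ℝ V : ℝ)+1)/2)) * |τ| ^ (-(((Module.finrank ℝ V : ℝ)-1)/2)) := by
  have hd : (1:ℝ) ≤ Module.finrank ℝ V := by exact_mod_cast Module.finrank_pos (R := ℝ) (M := V)
  set d : ℝ := (Module.finrank ℝ V : ℝ) with hdd
  have hc : 0 < p1c V := by
    unfold p1c
    have : 0 < Real.Gamma (((Module.finrank ℝ V : ℝ)+1)/2) := Real.Gamma_pos_of_pos (by positivity)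
    positivity
  refine ⟨p1c V * (1/4) ^ (-((d+1)/2)), by positivity, ?_⟩
  intro x y τ hy hτ
  have hre : 0 < (y + τ * I : ℂ).re := by simpa using hy
  rw [p1_complex x hre]
  set z : ℂ := y + τ * I with hz
  have hτz : |τ| ≤ ‖z‖ := by
    have := Complex.abs_im_le_norm z
    simpa [hz] using this
  have hτ0 : 0 < |τ| := abs_pos.2 hτ
  have hz0 : 0 < ‖z‖ := hτ0.trans_le hτz
  have hb := p1_base_lower (y := y) (τ := τ) (b := Real.pi * ‖x‖) hy (by positivity)
  rw [← hz, mul_pow] at hb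
  rw [norm_mul, norm_mul, Complex.norm_real, Real.norm_of_nonneg hc.le,
    Complex.norm_cpow_real]
  calc p1c V * ‖z‖ * ‖z ^ 2 / 4 + ((Real.pi ^ 2 * ‖x‖ ^ 2 : ℝ) : ℂ)‖ ^ (-((d + 1) / 2))
      ≤ p1c V * ‖z‖ * (y * ‖z‖ / 4) ^ (-((d + 1) / 2)) := by
        gcongr p1c V * ‖z‖ * ?_
        exact Real.rpow_le_rpow_of_nonpos (by positivity) hb (by linarith)
    _ = p1c V * (1/4) ^ (-((d+1)/2)) * y ^ (-((d + 1) / 2)) * ‖z‖ ^ (-((d - 1)/2)) := by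
        have : y * ‖z‖ / 4 = (1/4) * y * ‖z‖ := by ring
        rw [this, Real.mul_rpow (by positivity) hz0.le, Real.mul_rpow (by positivity) hy.le]
        have : ‖z‖ ^ (-((d - 1)/2)) = ‖z‖ * ‖z‖ ^ (-((d + 1)/2)) := by
          nth_rw 2 [← Real.rpow_one ‖z‖]
          rw [← Real.rpow_add hz0]; congr 1; ring
        rw [this]; ring
    _ ≤ _ := by
        gcongr _ * ?_
        exact Real.rpow_le_rpow_of_nonpos hτ0 hτz (by linarith)

end P1c

section P2a

lemma p2_geom_summable {ε : ℝ} (hε : 0 < ε) :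
    Summable (fun k : ℤ => (2:ℝ) ^ (-(ε * |(k:ℝ)|))) := by
  have h0 : Summable (fun k : ℕ => ((2:ℝ) ^ (-ε)) ^ k) := by
    apply summable_geometric_of_lt_one (by positivity)
    apply Real.rpow_lt_one_of_one_lt_of_neg (by norm_num) (by linarith)
  apply Summable.of_nat_of_neg
  · refine h0.congr ?_
    intro k
    rw [← Real.rpow_natCast, ← Real.rpow_mul (by norm_num)]
    simp
  · refine h0.congr ?_
    intro k
    rw [← Real.rpow_natCast, ← Real.rpow_mul (by norm_num)]
    simp

lemma p2_geom {ε : ℝ} (hε : 0 < ε) : ∃ B > (0:ℝ), ∀ (a : ℝ) (K : Finset ℤ),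
    ∑ m ∈ K, (2:ℝ) ^ (-(ε * |(m:ℝ) + a|)) ≤ B := by
  refine ⟨2 ^ ε * ∑' k : ℤ, (2:ℝ) ^ (-(ε * |(k:ℝ)|)), ?_, ?_⟩
  · apply mul_pos (by positivity)
    exact (p2_geom_summable hε).tsum_pos (fun _ => by positivity) 0 (by positivity)
  intro a K
  calc ∑ m ∈ K, (2:ℝ) ^ (-(ε * |(m:ℝ) + a|))
      ≤ ∑ m ∈ K, 2 ^ ε * (2:ℝ) ^ (-(ε * |((m + ⌊a⌋ : ℤ):ℝ)|)) := by
        apply Finset.sum_le_sum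
        intro m _
        rw [← Real.rpow_add (by norm_num)]
        apply Real.rpow_le_rpow_of_exponent_le (by norm_num)
        have h1 : |((m + ⌊a⌋ : ℤ):ℝ)| ≤ |(m:ℝ) + a| + 1 := by
          push_cast
          have h2 := Int.floor_le a
          have h3 := Int.lt_floor_add_one a
          have := abs_sub_abs_le_abs_sub ((m:ℝ) + ⌊a⌋) (m + a)
          have h4 : |((m:ℝ) + ⌊a⌋) - (m + a)| ≤ 1 := by
            rw [abs_le]; constructor <;> linarith
          linarith
        nlinarith
    _ = 2 ^ ε * ∑ k ∈ K.map (Equiv.addRight ⌊a⌋).toEmbedding, (2:ℝ) ^ (-(ε * |(k:ℝ)|)) := by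
        rw [Finset.sum_map, Finset.mul_sum]
        rfl
    _ ≤ _ := by
        gcongr
        exact (p2_geom_summable hε).sum_le_tsum _ (fun _ _ => by positivity)

/-- Schur test on finite sets. -/
lemma p2_schur {ι : Type*} (K : Finset ι) (k : ι → ι → ℝ) (hk : ∀ i j, 0 ≤ k i j)
    {B : ℝ} (h1 : ∀ i, ∑ j ∈ K, k i j ≤ B) (h2 : ∀ j, ∑ i ∈ K, k i j ≤ B)
    (x y : ι → ℝ) (hx : ∀ i, 0 ≤ x i) (hy : ∀ i, 0 ≤ y i) :
    ∑ i ∈ K, ∑ j ∈ K, k i j * x i * y j ≤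
      B * Real.sqrt (∑ i ∈ K, x i ^ 2) * Real.sqrt (∑ j ∈ K, y j ^ 2) := by
  rcases K.eq_empty_or_nonempty with rfl | ⟨i0, hi0⟩
  · simp
  have hB : 0 ≤ B := (Finset.sum_nonneg (fun j _ => hk i0 j)).trans (h1 i0)
  have hcs := Finset.sum_mul_sq_le_sq_mul_sq (K ×ˢ K)
    (fun p => Real.sqrt (k p.1 p.2) * x p.1) (fun p => Real.sqrt (k p.1 p.2) * y p.2)
  have e0 : ∑ p ∈ K ×ˢ K, Real.sqrt (k p.1 p.2) * x p.1 * (Real.sqrt (k p.1 p.2) * y p.2)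
      = ∑ i ∈ K, ∑ j ∈ K, k i j * x i * y j := by
    rw [Finset.sum_product]
    refine Finset.sum_congr rfl fun i _ => Finset.sum_congr rfl fun j _ => ?_
    have := Real.mul_self_sqrt (hk i j)
    calc _ = (Real.sqrt (k i j) * Real.sqrt (k i j)) * x i * y j := by ring
      _ = _ := by rw [this]
  have e1 : ∑ p ∈ K ×ˢ K, (Real.sqrt (k p.1 p.2) * x p.1) ^ 2 ≤ B * ∑ i ∈ K, x i ^ 2 := by
    rw [Finset.sum_product, Finset.mul_sum]
    refine Finset.sum_le_sum fun i _ => ?_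
    calc ∑ j ∈ K, (Real.sqrt (k i j) * x i) ^ 2 = (∑ j ∈ K, k i j) * x i ^ 2 := by
          rw [Finset.sum_mul]
          refine Finset.sum_congr rfl fun j _ => ?_
          rw [mul_pow, Real.sq_sqrt (hk i j)]
      _ ≤ _ := by gcongr; exact h1 i
  have e2 : ∑ p ∈ K ×ˢ K, (Real.sqrt (k p.1 p.2) * y p.2) ^ 2 ≤ B * ∑ i ∈ K, y i ^ 2 := by
    rw [Finset.sum_product_right, Finset.mul_sum]
    refine Finset.sum_le_sum fun i _ => ?_
    calc ∑ j ∈ K, (Real.sqrt (k j i) * y i) ^ 2 = (∑ j ∈ K, k j i) * y i ^ 2 := by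
          rw [Finset.sum_mul]
          refine Finset.sum_congr rfl fun j _ => ?_
          rw [mul_pow, Real.sq_sqrt (hk j i)]
      _ ≤ _ := by gcongr; exact h2 i
  rw [e0] at hcs
  have hx0 : 0 ≤ ∑ i ∈ K, x i ^ 2 := Finset.sum_nonneg fun _ _ => sq_nonneg _
  have hy0 : 0 ≤ ∑ i ∈ K, y i ^ 2 := Finset.sum_nonneg fun _ _ => sq_nonneg _
  apply le_of_sq_le_sq _ (by positivity)
  rw [mul_pow, mul_pow, Real.sq_sqrt hx0, Real.sq_sqrt hy0]
  calc _ ≤ _ := hcs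
    _ ≤ (B * ∑ i ∈ K, x i ^ 2) * (B * ∑ i ∈ K, y i ^ 2) := by
        gcongr
    _ = _ := by ring

lemma p2_min3 {γ : ℝ} (hγ : 0 < γ) (x y : ℝ) :
    min (min x y) (-(γ * (x + y))) ≤ -((min 1 γ / 3) * (|x| + |y|)) := by
  wlog hxy : x ≤ y generalizing x y
  · have := this y x (by linarith)
    rwa [min_comm y x, add_comm y x, add_comm |y|] at this
  rw [min_eq_left hxy]
  have h1 : min 1 γ ≤ 1 := min_le_left _ _
  have h2 : min 1 γ ≤ γ := min_le_right _ _
  have h3 : 0 < min 1 γ := lt_min one_pos hγ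
  set δ := min 1 γ
  rcases le_or_gt 0 x with hx | hx
  · rw [abs_of_nonneg hx, abs_of_nonneg (hx.trans hxy)]
    refine (min_le_right _ _).trans ?_
    nlinarith
  · rw [abs_of_neg hx]
    rcases le_or_gt y 0 with hy | hy
    · rw [abs_of_nonpos hy]
      refine (min_le_left _ _).trans ?_
      nlinarith
    · rw [abs_of_pos hy]
      rcases le_or_gt y (-2*x) with h | h
      · refine (min_le_left _ _).trans ?_
        nlinarith
      · refine (min_le_right _ _).trans ?_
        nlinarith

end P2a

section P2b

lemma p2_lint_abs (g : ℝ → ℝ≥0∞) :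
    ∫⁻ x : ℝ, g |x| = 2 * ∫⁻ x in Set.Ioi (0:ℝ), g x := by
  have h1 : ∫⁻ x : ℝ, g |x| = (∫⁻ x in Set.Ioi (0:ℝ), g |x|) + ∫⁻ x in Set.Iic (0:ℝ), g |x| := by
    rw [← lintegral_add_compl _ (measurableSet_Ioi (a := (0:ℝ))), Set.compl_Ioi]
  have h2 : ∫⁻ x in Set.Ioi (0:ℝ), g |x| = ∫⁻ x in Set.Ioi (0:ℝ), g x :=
    setLIntegral_congr_fun measurableSet_Ioi (fun x (hx : 0 < x) => by simp only [abs_of_pos hx])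
  have h3 : ∫⁻ x in Set.Iic (0:ℝ), g |x| = ∫⁻ x in Set.Ioi (0:ℝ), g x := by
    rw [setLIntegral_congr Iio_ae_eq_Iic.symm]
    have hmp := (Measure.measurePreserving_neg (volume : Measure ℝ)).setLIntegral_comp_preimage_emb
      (MeasurableEquiv.neg ℝ).measurableEmbedding g (Set.Ioi 0)
    rw [← hmp]
    have : (fun x : ℝ => -x) ⁻¹' Set.Ioi 0 = Set.Iio 0 := by ext; simp
    change _ = ∫⁻ (a : ℝ) in (fun x : ℝ => -x) ⁻¹' Set.Ioi 0, g (-a)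
    rw [this]
    exact setLIntegral_congr_fun measurableSet_Iio
      (fun x (hx : x < 0) => by simp only [abs_of_neg hx])
  rw [h1, h2, h3, two_mul]

lemma p2_near {α ρ : ℝ} (hα : α < 1) (hρ : 0 < ρ) :
    ∫⁻ x in Set.Ioi (0:ℝ), (if x < ρ then ENNReal.ofReal (x ^ (-α)) else 0)
      = ENNReal.ofReal (ρ ^ (1-α) / (1-α)) := by
  have h1 : ∫⁻ x in Set.Ioi (0:ℝ), (if x < ρ then ENNReal.ofReal (x ^ (-α)) else 0)
     = ∫⁻ x in Set.Ioo (0:ℝ) ρ, ENNReal.ofReal (x ^ (-α)) := by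
    rw [← lintegral_indicator measurableSet_Ioi, ← lintegral_indicator measurableSet_Ioo]
    congr 1; ext x
    simp only [Set.indicator, Set.mem_Ioi, Set.mem_Ioo]
    by_cases h : 0 < x <;> by_cases h' : x < ρ <;> simp [h, h']
  rw [h1, setLIntegral_congr Ioo_ae_eq_Ioc, ← ofReal_integral_eq_lintegral_ofReal]
  · rw [← intervalIntegral.integral_of_le hρ.le, integral_rpow (Or.inl (by linarith))]
    rw [Real.zero_rpow (by linarith)]
    congr 1
    rw [show -α + 1 = 1 - α by ring]; ring
  · have := intervalIntegral.intervalIntegrable_rpow' (a := 0) (b := ρ) (r := -α) (by linarith)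
    rwa [intervalIntegrable_iff_integrableOn_Ioc_of_le hρ.le] at this
  · rw [Filter.EventuallyLE, ae_restrict_iff' measurableSet_Ioc]
    filter_upwards with x hx
    have := hx.1
    simp only [Pi.zero_apply]; positivity

lemma p2_far {S ρ : ℝ} (hS : 1 < S) (hρ : 0 < ρ) :
    ∫⁻ x in Set.Ioi (0:ℝ), (if x < ρ then 0 else ENNReal.ofReal (x ^ (-S)))
      = ENNReal.ofReal (ρ ^ (1-S) / (S-1)) := by
  have h1 : ∫⁻ x in Set.Ioi (0:ℝ), (if x < ρ then 0 else ENNReal.ofReal (x ^ (-S)))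
     = ∫⁻ x in Set.Ici ρ, ENNReal.ofReal (x ^ (-S)) := by
    rw [← lintegral_indicator measurableSet_Ioi, ← lintegral_indicator measurableSet_Ici]
    congr 1; ext x
    simp only [Set.indicator, Set.mem_Ioi, Set.mem_Ici]
    by_cases h : 0 < x <;> by_cases h' : x < ρ
    · simp [h, h']
    · simp [h, h']
    · simp [h, h']
    · exact absurd (hρ.trans_le (not_lt.1 h')) h
  rw [h1, setLIntegral_congr Ioi_ae_eq_Ici.symm, ← ofReal_integral_eq_lintegral_ofReal]
  · rw [integral_Ioi_rpow_of_lt (by linarith) hρ]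
    congr 1
    rw [show -S + 1 = 1 - S by ring, neg_div, ← div_neg]; congr 1; ring
  · exact integrableOn_Ioi_rpow_of_lt (by linarith) hρ
  · rw [Filter.EventuallyLE, ae_restrict_iff' measurableSet_Ioi]
    filter_upwards with x (hx : ρ < x)
    have := hρ.trans hx
    simp only [Pi.zero_apply]; positivity

lemma p2_hls_inner {α : ℝ} (hα0 : 0 < α) (hα : α < 1) {φ : ℝ → ℝ≥0∞} (hφ : Measurable φ)
    {I : ℝ} (hI : 0 < I) (hφI : ∫⁻ t, φ t ^ (2/(2-α)) = ENNReal.ofReal I) (s : ℝ) {l : ℝ} (hl : 0 < l) :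
    ∫⁻ t, (if φ t ≤ ENNReal.ofReal l then ENNReal.ofReal (|t - s| ^ (-α)) * φ t else 0)
      ≤ ENNReal.ofReal ((2/(1-α) + 2) * I ^ (1-α) * l ^ (2/(2-α) - 1)) := by
  set p := 2/(2-α) with hp
  have h2α : 0 < 2 - α := by linarith
  set ρ := I * l ^ (-p) with hρd
  have hρ : 0 < ρ := by positivity
  have hconj : Real.HolderConjugate p (2/α) := by
    rw [Real.holderConjugate_iff]
    constructor
    · rw [hp, lt_div_iff₀ h2α]; linarith
    · rw [hp]; field_simp; ring
  calc ∫⁻ t, (if φ t ≤ ENNReal.ofReal l then ENNReal.ofReal (|t - s| ^ (-α)) * φ t else 0)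
      ≤ ∫⁻ t, ((if |t - s| < ρ then ENNReal.ofReal (|t - s| ^ (-α)) else 0) * ENNReal.ofReal l +
        φ t * (if |t - s| < ρ then 0 else ENNReal.ofReal (|t - s| ^ (-α)))) := by
        apply lintegral_mono; intro t
        simp only
        split_ifs with h h'
        · simp only [mul_zero, add_zero]; gcongr
        · simp [mul_comm]
        · simp
        · simp
    _ = (∫⁻ t, (if |t - s| < ρ then ENNReal.ofReal (|t - s| ^ (-α)) else 0)) * ENNReal.ofReal l +
        ∫⁻ t, φ t * (if |t - s| < ρ then 0 else ENNReal.ofReal (|t - s| ^ (-α))) := by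
        have hm : Measurable fun t : ℝ =>
          (if |t - s| < ρ then ENNReal.ofReal (|t - s| ^ (-α)) else 0) :=
          Measurable.ite (measurableSet_lt (by fun_prop) measurable_const) (by fun_prop)
            measurable_const
        rw [lintegral_add_left (hm.mul_const _), lintegral_mul_const _ hm]
    _ ≤ ENNReal.ofReal (2 * (ρ ^ (1-α) / (1-α))) * ENNReal.ofReal l +
        ENNReal.ofReal (I ^ (1/p)) * ENNReal.ofReal ((2 * (ρ ^ (1-2:ℝ) / (2-1))) ^ (1/(2/α))) := by
        gcongr ?_ * _ + ?_
        · have := lintegral_sub_right_eq_self (μ := (volume : Measure ℝ))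
            (fun t => (if |t| < ρ then ENNReal.ofReal (|t| ^ (-α)) else 0)) s
          rw [this, p2_lint_abs (fun t => if t < ρ then ENNReal.ofReal (t ^ (-α)) else 0),
            p2_near hα hρ, ENNReal.ofReal_mul (by norm_num)]
          simp
        · refine (ENNReal.lintegral_mul_le_Lp_mul_Lq volume hconj hφ.aemeasurable ?_).trans ?_
          · exact (Measurable.ite (measurableSet_lt (by fun_prop) measurable_const)
              measurable_const (by fun_prop)).aemeasurable
          rw [hφI, ENNReal.ofReal_rpow_of_nonneg hI.le (by positivity)]
          gcongr
          have e : ∀ t : ℝ, (if |t - s| < ρ then (0:ℝ≥0∞) else ENNReal.ofReal (|t - s| ^ (-α))) ^ (2/α)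
             = (if |t - s| < ρ then 0 else ENNReal.ofReal (|t - s| ^ (-(2:ℝ)))) := by
            intro t
            split_ifs with h
            · apply ENNReal.zero_rpow_of_pos; positivity
            · rw [ENNReal.ofReal_rpow_of_nonneg (by positivity) (by positivity),
                ← Real.rpow_mul (abs_nonneg _)]
              congr 2; field_simp
          simp_rw [e]
          have := lintegral_sub_right_eq_self (μ := (volume : Measure ℝ))
            (fun t => (if |t| < ρ then 0 else ENNReal.ofReal (|t| ^ (-(2:ℝ))))) s
          rw [this, p2_lint_abs (fun t => if t < ρ then 0 else ENNReal.ofReal (t ^ (-(2:ℝ)))),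
            p2_far (by norm_num) hρ]
          rw [← ENNReal.ofReal_rpow_of_nonneg (by positivity) (by positivity),
            ENNReal.ofReal_mul (p := 2) (by norm_num)]
          simp
    _ ≤ _ := by
        have h1α : 0 < 1 - α := by linarith
        have e1 : ρ ^ (1-α) * l = I ^ (1-α) * l ^ (p-1) := by
          rw [hρd, Real.mul_rpow hI.le (by positivity), ← Real.rpow_mul hl.le, mul_assoc]
          congr 1
          nth_rw 2 [← Real.rpow_one l]
          rw [← Real.rpow_add hl]; congr 1
          rw [hp]; field_simp; ring
        have e2 : I ^ (1/p) * (ρ ^ (-1:ℝ)) ^ (α/2) = I ^ (1-α) * l ^ (p-1) := by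
          rw [hρd, Real.mul_rpow hI.le (by positivity), ← Real.rpow_mul hl.le,
            Real.mul_rpow (by positivity) (by positivity), ← Real.rpow_mul hI.le,
            ← Real.rpow_mul hl.le, ← mul_assoc, ← Real.rpow_add hI]
          congr 2
          · rw [hp]; field_simp; ring
          · rw [hp]; field_simp; ring
        rw [← ENNReal.ofReal_mul (by positivity), ← ENNReal.ofReal_mul (by positivity),
          ← ENNReal.ofReal_add (by positivity) (by positivity)]
        apply ENNReal.ofReal_le_ofReal
        have e3 : (2 * (ρ ^ (1-2:ℝ) / (2-1))) ^ (1/(2/α)) = 2 ^ (α/2) * (ρ ^ (-1:ℝ)) ^ (α/2) := by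
          rw [Real.mul_rpow (by norm_num) (by positivity)]
          norm_num
        rw [e3]
        calc _ = (2/(1-α)) * (ρ ^ (1-α) * l) + 2 ^ (α/2) * (I ^ (1/p) * (ρ ^ (-1:ℝ)) ^ (α/2)) := by
              ring
          _ = (2/(1-α) + 2^(α/2)) * (I ^ (1-α) * l ^ (p-1)) := by rw [e1, e2]; ring
          _ ≤ (2/(1-α) + 2) * (I ^ (1-α) * l ^ (p-1)) := by
              gcongr
              calc (2:ℝ)^(α/2) ≤ 2^(1:ℝ) := Real.rpow_le_rpow_of_exponent_le (by norm_num) (by linarith)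
                _ = 2 := by norm_num
          _ = _ := by ring

/-- quadratic Hardy-Littlewood-Sobolev -/
lemma p2_hls {α : ℝ} (hα0 : 0 < α) (hα : α < 1) {φ : ℝ → ℝ≥0∞} (hφ : Measurable φ)
    (hfin : ∫⁻ t, φ t ^ (2/(2-α)) ≠ ∞) :
    ∫⁻ s, ∫⁻ t, ENNReal.ofReal (|t - s| ^ (-α)) * φ s * φ t ≤
      ENNReal.ofReal (2 * (2/(1-α) + 2)) * (∫⁻ t, φ t ^ (2/(2-α))) ^ (2-α) := by
  have h2α : 0 < 2 - α := by linarith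
  have hp : 0 < 2/(2-α) := by positivity
  set J := ∫⁻ t, φ t ^ (2/(2-α)) with hJ
  rcases eq_or_ne J 0 with h0 | h0
  · have : φ =ᵐ[volume] 0 := by
      rw [hJ, lintegral_eq_zero_iff (hφ.pow_const _)] at h0
      filter_upwards [h0] with t ht
      simpa [ENNReal.rpow_eq_zero_iff, hp, hp.not_gt] using ht
    have h3 : ∫⁻ s, ∫⁻ t, ENNReal.ofReal (|t - s| ^ (-α)) * φ s * φ t = 0 := by
      have : ∀ᵐ s, ∫⁻ t, ENNReal.ofReal (|t - s| ^ (-α)) * φ s * φ t = 0 := by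
        filter_upwards [this] with s hs
        simp [hs]
      rw [lintegral_congr_ae this]; simp
    rw [h3]; exact zero_le
  set I := J.toReal with hI
  have hIpos : 0 < I := ENNReal.toReal_pos h0 hfin
  have hJI : J = ENNReal.ofReal I := (ENNReal.ofReal_toReal hfin).symm
  have hmK : Measurable (Function.uncurry fun s t : ℝ =>
      (if φ t ≤ φ s then ENNReal.ofReal (|t - s| ^ (-α)) * φ s * φ t else 0)) := by
    apply Measurable.ite
    · exact measurableSet_le (by fun_prop) (by fun_prop)
    · fun_prop
    · fun_prop
  have step1 : ∫⁻ s, ∫⁻ t, ENNReal.ofReal (|t - s| ^ (-α)) * φ s * φ t ≤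
      2 * ∫⁻ s, ∫⁻ t, (if φ t ≤ φ s then ENNReal.ofReal (|t - s| ^ (-α)) * φ s * φ t else 0) := by
    calc _ ≤ ∫⁻ s, ∫⁻ t,
          ((if φ t ≤ φ s then ENNReal.ofReal (|t - s| ^ (-α)) * φ s * φ t else 0) +
          (if φ s ≤ φ t then ENNReal.ofReal (|s - t| ^ (-α)) * φ t * φ s else 0)) := by
          apply lintegral_mono; intro s
          apply lintegral_mono; intro t
          simp only
          rcases le_total (φ t) (φ s) with h | h
          · simp only [h, if_true]; exact le_self_add
          · simp only [h, if_true]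
            rw [abs_sub_comm t s, mul_right_comm]; exact le_add_self
      _ = (∫⁻ s, ∫⁻ t, (if φ t ≤ φ s then ENNReal.ofReal (|t - s| ^ (-α)) * φ s * φ t else 0)) +
          ∫⁻ s, ∫⁻ t, (if φ s ≤ φ t then ENNReal.ofReal (|s - t| ^ (-α)) * φ t * φ s else 0) := by
          rw [← lintegral_add_left hmK.lintegral_prod_right]
          apply lintegral_congr; intro s
          rw [lintegral_add_left]
          exact hmK.comp (measurable_const.prodMk measurable_id)
      _ = _ := by
          rw [two_mul]; congr 1
          rw [lintegral_lintegral_swap]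
          exact (hmK.comp measurable_swap).aemeasurable
  refine step1.trans ?_
  have hae : ∀ᵐ s, φ s < ∞ := by
    have := ae_lt_top (hφ.pow_const (2/(2-α))) hfin
    filter_upwards [this] with s hs
    by_contra h
    have h' : φ s = ∞ := not_lt_top_iff.1 h
    simp [h', hp] at hs
  have step2 : ∀ᵐ s, ∫⁻ t, (if φ t ≤ φ s then ENNReal.ofReal (|t - s| ^ (-α)) * φ s * φ t else 0)
      ≤ ENNReal.ofReal ((2/(1-α) + 2) * I ^ (1-α)) * φ s ^ (2/(2-α)) := by
    filter_upwards [hae] with s hs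
    rcases eq_or_ne (φ s) 0 with h | h
    · simp [h]
    set l := (φ s).toReal with hl
    have hl0 : 0 < l := ENNReal.toReal_pos h hs.ne
    have hls : φ s = ENNReal.ofReal l := (ENNReal.ofReal_toReal hs.ne).symm
    have hin := p2_hls_inner hα0 hα hφ hIpos (hJ.symm.trans hJI) s hl0
    calc _ = ∫⁻ t, φ s * (if φ t ≤ ENNReal.ofReal l then ENNReal.ofReal (|t - s| ^ (-α)) * φ t else 0) := by
          apply lintegral_congr; intro t
          rw [← hls]
          split_ifs
          · ring
          · simp
      _ = φ s * ∫⁻ t, (if φ t ≤ ENNReal.ofReal l then ENNReal.ofReal (|t - s| ^ (-α)) * φ t else 0) := by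
          rw [lintegral_const_mul]
          exact Measurable.ite (measurableSet_le hφ measurable_const) (by fun_prop) measurable_const
      _ ≤ ENNReal.ofReal l * ENNReal.ofReal ((2/(1-α) + 2) * I ^ (1-α) * l ^ (2/(2-α) - 1)) := by
          exact mul_le_mul' hls.le hin
      _ = _ := by
          have h1α : 0 < 1 - α := by linarith
          rw [hls, ENNReal.ofReal_rpow_of_pos hl0, ← ENNReal.ofReal_mul hl0.le,
            ← ENNReal.ofReal_mul (by positivity)]
          congr 1
          have : l ^ (2/(2-α)) = l * l ^ (2/(2-α) - 1) := by
            nth_rw 2 [← Real.rpow_one l]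
            rw [← Real.rpow_add hl0]; congr 1; ring
          rw [this]; ring
  calc _ ≤ 2 * ∫⁻ s, ENNReal.ofReal ((2/(1-α) + 2) * I ^ (1-α)) * φ s ^ (2/(2-α)) := by
        exact mul_le_mul' le_rfl (lintegral_mono_ae step2)
    _ = _ := by
        have h1α : 0 < 1 - α := by linarith
        rw [lintegral_const_mul _ (hφ.pow_const _), ← hJ, hJI, ENNReal.ofReal_rpow_of_pos hIpos,
          ← ENNReal.ofReal_mul (by positivity), ← ENNReal.ofReal_mul (by positivity)]
        have : (2:ℝ≥0∞) = ENNReal.ofReal 2 := by simp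
        rw [this, ← ENNReal.ofReal_mul (by norm_num)]
        congr 1
        have : I ^ (2-α) = I ^ (1-α) * I := by
          nth_rw 3 [← Real.rpow_one I]
          rw [← Real.rpow_add hIpos]; congr 1; ring
        rw [this]; ring

end P2b

section P2c

variable {H : Type*} [NormedAddCommGroup H] [InnerProductSpace ℂ H] [CompleteSpace H]

lemma p2_inner_int {X Y : Type*} [MeasurableSpace X] [MeasurableSpace Y] {μ : Measure X}
    {ν : Measure Y} {w : X → H} {w' : Y → H}
    (hw : Integrable w μ) (hw' : Integrable w' ν) :
    ‖inner ℂ (∫ s, w s ∂μ) (∫ t, w' t ∂ν)‖ₑ ≤ ∫⁻ s, ∫⁻ t, ‖inner ℂ (w s) (w' t)‖ₑ ∂ν ∂μ := by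
  have e1 : inner ℂ (∫ s, w s ∂μ) (∫ t, w' t ∂ν)
      = (starRingEnd ℂ) (∫ s, inner ℂ (∫ t, w' t ∂ν) (w s) ∂μ) := by
    rw [integral_inner hw, inner_conj_symm]
  rw [e1]
  have : ∀ z : ℂ, ‖(starRingEnd ℂ) z‖ₑ = ‖z‖ₑ := by
    intro z; rw [← ofReal_norm, ← ofReal_norm, RCLike.norm_conj]
  rw [this]
  refine (enorm_integral_le_lintegral_enorm _).trans (lintegral_mono fun s => ?_)
  rw [← inner_conj_symm, this, ← integral_inner hw']
  exact enorm_integral_le_lintegral_enorm _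

lemma p2_young {k f g : ℝ → ℝ≥0∞} (hk : Measurable k) (hf : Measurable f) (hg : Measurable g) :
    ∫⁻ s, ∫⁻ t, k (t - s) * f s * g t ≤
      (∫⁻ u, k u) * ((∫⁻ s, f s ^ (2:ℝ)) ^ (1/2:ℝ) * (∫⁻ s, g s ^ (2:ℝ)) ^ (1/2:ℝ)) := by
  have e1 : ∀ s, ∫⁻ t, k (t - s) * f s * g t = ∫⁻ u, k u * (f s * g (u + s)) := by
    intro s
    rw [← lintegral_sub_right_eq_self (fun u => k u * (f s * g (u + s))) s]
    apply lintegral_congr; intro t; simp [mul_assoc]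
  simp_rw [e1]
  rw [lintegral_lintegral_swap (by fun_prop)]
  rw [← lintegral_mul_const _ hk]
  refine lintegral_mono fun u => ?_
  rw [lintegral_const_mul _ (by fun_prop)]
  gcongr
  refine (ENNReal.lintegral_mul_le_Lp_mul_Lq volume (p := 2) (q := 2) ?_ hf.aemeasurable
    (by fun_prop)).trans ?_
  · rw [Real.holderConjugate_iff]; norm_num
  have := lintegral_add_left_eq_self (μ := (volume : Measure ℝ)) (fun s => g s ^ (2:ℝ)) u
  rw [this]

/-- pointwise kernel -/
def p2ker (S β : ℝ) (τ : ℝ) (k : ℝ) : ℝ := min (|τ| ^ (-S) * 2 ^ (-k)) (2 ^ (k * β))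

lemma p2_ker_le {S β τ : ℝ} (hβ : 0 < β) (hτ : τ ≠ 0) : ∃ k0 : ℝ, ∀ k : ℝ,
    p2ker S β τ k ≤ |τ| ^ (-(S * β / (1 + β))) * 2 ^ (-(min 1 β * |k + k0|)) := by
  have ht : 0 < |τ| := abs_pos.2 hτ
  have hl2 : 0 < Real.log 2 := Real.log_pos (by norm_num)
  set L := Real.logb 2 |τ| with hL
  have hτL : |τ| = 2 ^ L := by rw [hL, Real.rpow_logb] <;> simp [ht]
  refine ⟨S * L / (1 + β), fun k => ?_⟩
  unfold p2ker
  rw [hτL, ← Real.rpow_mul (by norm_num), ← Real.rpow_mul (by norm_num),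
    ← Real.rpow_add (by norm_num), ← Real.rpow_add (by norm_num)]
  set k0 := S * L / (1 + β) with hk0
  have e1 : L * -S = - (k0 * (1 + β)) := by rw [hk0]; field_simp
  have e2 : L * -(S * β / (1 + β)) = - (k0 * β) := by rw [hk0]; field_simp
  rw [e1, e2]
  have h1 : min 1 β ≤ 1 := min_le_left _ _
  have h2 : min 1 β ≤ β := min_le_right _ _
  have h0 : 0 < min 1 β := lt_min one_pos hβ
  rcases le_total 0 (k + k0) with h | h
  · refine (min_le_left _ _).trans ?_
    apply Real.rpow_le_rpow_of_exponent_le (by norm_num)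
    rw [abs_of_nonneg h]; nlinarith
  · refine (min_le_right _ _).trans ?_
    apply Real.rpow_le_rpow_of_exponent_le (by norm_num)
    rw [abs_of_nonpos h]; nlinarith

lemma p2_sum_ker {S β : ℝ} (hβ : 0 < β) : ∃ B > 0, ∀ (τ : ℝ), τ ≠ 0 → ∀ (K : Finset ℤ)
    (x y : ℤ → ℝ), (∀ i, 0 ≤ x i) → (∀ i, 0 ≤ y i) →
    ∑ m ∈ K, ∑ l ∈ K, p2ker S β τ ((m:ℝ) + l) * x m * y l ≤
      B * |τ| ^ (-(S * β / (1 + β))) * √(∑ m ∈ K, x m ^ 2) * √(∑ m ∈ K, y m ^ 2) := by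
  obtain ⟨B, hB, h⟩ := p2_geom (ε := min 1 β) (lt_min one_pos hβ)
  refine ⟨B, hB, fun τ hτ K x y hx hy => ?_⟩
  obtain ⟨k0, hk⟩ := p2_ker_le (S := S) hβ hτ
  set D := |τ| ^ (-(S * β / (1 + β))) with hD
  have hD0 : 0 ≤ D := by positivity
  have := p2_schur (B := B) K (fun m l => 2 ^ (-(min 1 β * |(m:ℝ) + l + k0|)))
    (fun i j => by positivity)
    (fun i => by
      refine (le_of_eq ?_).trans (h ((i:ℝ) + k0) K)
      refine Finset.sum_congr rfl fun j _ => ?_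
      congr 4; ring) (fun j => by
      refine (le_of_eq ?_).trans (h ((j:ℝ) + k0) K)
      refine Finset.sum_congr rfl fun i _ => ?_
      congr 4; ring) x y hx hy
  calc _ ≤ ∑ m ∈ K, ∑ l ∈ K, D * (2 ^ (-(min 1 β * |(m:ℝ) + l + k0|)) * x m * y l) := by
        refine Finset.sum_le_sum fun m _ => Finset.sum_le_sum fun l _ => ?_
        have := mul_le_mul_of_nonneg_right (mul_le_mul_of_nonneg_right (hk ((m:ℝ)+l)) (hx m)) (hy l)
        refine this.trans (le_of_eq ?_); ring
    _ = D * ∑ m ∈ K, ∑ l ∈ K, (2 ^ (-(min 1 β * |(m:ℝ) + l + k0|)) * x m * y l) := by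
        simp_rw [Finset.mul_sum]
    _ ≤ D * (B * √(∑ m ∈ K, x m ^ 2) * √(∑ m ∈ K, y m ^ 2)) := by gcongr
    _ = _ := by ring

lemma p2_inner_sum_le {S β : ℝ} {K : Finset ℤ} {w : ℤ → H} {w' : ℤ → H} {x y : ℤ → ℝ} {τ : ℝ}
    (h : ∀ m l, ‖inner ℂ (w m) (w' l)‖ ≤ p2ker S β τ ((m:ℝ)+l) * x m * y l) :
    ‖inner ℂ (∑ m ∈ K, w m) (∑ m ∈ K, w' m)‖ ≤
      ∑ m ∈ K, ∑ l ∈ K, p2ker S β τ ((m:ℝ) + l) * x m * y l := by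
  rw [sum_inner]
  refine (norm_sum_le _ _).trans (Finset.sum_le_sum fun m _ => ?_)
  rw [inner_sum]
  exact (norm_sum_le _ _).trans (Finset.sum_le_sum fun l _ => h m l)

lemma p2_lemA {S β : ℝ} (hβ : 0 < β) (hS : 0 < S) (hα : S * β / (1 + β) < 1) :
    ∃ C > 0, ∀ (K : Finset ℤ) (w : ℤ → ℝ → H) (c : ℤ → ℝ → ℝ) (φ : ℝ → ℝ),
    (∀ m, Integrable (w m)) → (∀ m s, 0 ≤ c m s) → (∀ m, Measurable (c m)) →
    (∀ s, 0 ≤ φ s) → Measurable φ →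
    (∫⁻ s, ENNReal.ofReal (φ s) ^ (2 / (2 - S * β / (1 + β))) ≠ ∞) →
    (∀ s, ∑ m ∈ K, c m s ^ 2 ≤ φ s ^ 2) →
    (∀ m l s t, s ≠ t → ‖inner ℂ (w m s) (w l t)‖ ≤ p2ker S β (t - s) ((m:ℝ)+l) * c m s * c l t) →
    (∀ m l s t, ‖inner ℂ (w m s) (w l t)‖ ≤ 2 ^ (((m:ℝ)+l) * β) * c m s * c l t) →
    ‖∫ s, ∑ m ∈ K, w m s‖ₑ ^ (2:ℝ) ≤ ENNReal.ofReal C *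
      (∫⁻ s, ENNReal.ofReal (φ s) ^ (2 / (2 - S * β / (1 + β)))) ^ (2 - S * β / (1 + β)) := by
  set α := S * β / (1 + β) with hαd
  have hα0 : 0 < α := by positivity
  obtain ⟨B, hB, h⟩ := p2_sum_ker (S := S) hβ
  have h1α : 0 < 1 - α := by linarith
  refine ⟨B * (2 * (2/(1-α)+2)), by positivity, ?_⟩
  intro K w c φ hw hc hcm hφ hφm hfin hsum hd _
  have hintg : Integrable (fun s => ∑ m ∈ K, w m s) := integrable_finsetSum K fun m _ => hw m
  have e1 : ‖∫ s, ∑ m ∈ K, w m s‖ₑ ^ (2:ℝ)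
      = ‖inner ℂ (∫ s, ∑ m ∈ K, w m s) (∫ s, ∑ m ∈ K, w m s)‖ₑ := by
    rw [inner_self_eq_norm_sq_to_K]
    rw [← ofReal_norm (_ ^ 2), norm_pow, RCLike.norm_ofReal, abs_norm, ENNReal.ofReal_pow (norm_nonneg _),
      ofReal_norm]
    norm_num
  rw [e1]
  refine (p2_inner_int hintg hintg).trans ?_
  have key : ∀ s t, s ≠ t → ‖inner ℂ (∑ m ∈ K, w m s) (∑ m ∈ K, w m t)‖ ≤
      B * |t - s| ^ (-α) * φ s * φ t := by
    intro s t hst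
    refine (p2_inner_sum_le (fun m l => hd m l s t hst)).trans ?_
    refine (h (t - s) (sub_ne_zero.2 hst.symm) K _ _ (fun i => hc i s) (fun i => hc i t)).trans ?_
    have : ∀ s, √(∑ m ∈ K, c m s ^ 2) ≤ φ s := fun s => Real.sqrt_le_iff.2 ⟨hφ s, hsum s⟩
    have h1 := this s
    have h2 := this t
    have h3 := hφ s
    gcongr
  calc _ ≤ ∫⁻ s, ∫⁻ t, ENNReal.ofReal B * (ENNReal.ofReal (|t-s|^(-α)) * ENNReal.ofReal (φ s) *
        ENNReal.ofReal (φ t)) := by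
        refine lintegral_mono fun s => lintegral_mono_ae ?_
        have : ∀ᵐ t : ℝ, t ≠ s := by
          simp [ae_iff]
        filter_upwards [this] with t ht
        rw [← ENNReal.ofReal_mul (by positivity), ← ENNReal.ofReal_mul (mul_nonneg (by positivity) (hφ s)),
          ← ENNReal.ofReal_mul hB.le, ← ofReal_norm]
        apply ENNReal.ofReal_le_ofReal
        refine (key s t ht.symm).trans (le_of_eq ?_)
        ring
    _ = ENNReal.ofReal B * ∫⁻ s, ∫⁻ t, (ENNReal.ofReal (|t-s|^(-α)) * ENNReal.ofReal (φ s) *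
        ENNReal.ofReal (φ t)) := by
        rw [← lintegral_const_mul _ (by fun_prop)]
        refine lintegral_congr fun s => ?_
        rw [lintegral_const_mul _ (by fun_prop)]
    _ ≤ _ := by
        rw [ENNReal.ofReal_mul hB.le, mul_assoc]
        gcongr
        exact p2_hls hα0 hα (by fun_prop) hfin

end P2c

section P2d

variable {H : Type*} [NormedAddCommGroup H] [InnerProductSpace ℂ H] [CompleteSpace H]

def p2b (A : Set ℝ) (w w' : ℝ → H) : ℂ :=
  ∫ p in {p : ℝ × ℝ | p.2 - p.1 ∈ A}, inner ℂ (w p.1) (w' p.2)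

def p2a (c : ℝ → ℝ) : ℝ≥0∞ := (∫⁻ s, ENNReal.ofReal (c s) ^ (2:ℝ)) ^ (1/2:ℝ)

lemma p2_prod_int {w w' : ℝ → H} (hw : Integrable w) (hw' : Integrable w') :
    Integrable (fun p : ℝ × ℝ => inner ℂ (w p.1) (w' p.2)) :=
  hw.op_fst_snd (op := fun x y => inner ℂ x y) (by fun_prop)
    ⟨1, fun x y => by simpa using norm_inner_le_norm x y⟩ hw'

lemma p2_setA {A : Set ℝ} (hA : MeasurableSet A) : MeasurableSet {p : ℝ × ℝ | p.2 - p.1 ∈ A} :=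
  (measurable_snd.sub measurable_fst) hA

lemma p2_b_eq {A : Set ℝ} (hA : MeasurableSet A) {w w' : ℝ → H} (hw : Integrable w)
    (hw' : Integrable w') :
    p2b A w w' = ∫ t, inner ℂ (∫ s in {s | t - s ∈ A}, w s) (w' t) := by
  unfold p2b
  rw [← integral_indicator (p2_setA hA), Measure.volume_eq_prod, integral_prod_symm]
  swap
  · exact (p2_prod_int hw hw').indicator (p2_setA hA)
  refine integral_congr_ae (Filter.Eventually.of_forall fun t => ?_)
  simp only
  have hm : MeasurableSet {s | t - s ∈ A} := (measurable_const.sub measurable_id) hA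
  rw [← inner_conj_symm, ← integral_inner hw.integrableOn, ← integral_conj,
    ← integral_indicator hm]
  refine integral_congr_ae (Filter.Eventually.of_forall fun s => ?_)
  simp only [Set.indicator, Set.mem_ofPred_eq, inner_conj_symm]

lemma p2_b_symm {A : Set ℝ} (hA : MeasurableSet A) (hsym : ∀ u, u ∈ A → -u ∈ A) (w w' : ℝ → H) :
    ‖p2b A w w'‖ₑ = ‖p2b A w' w‖ₑ := by
  have : p2b A w w' = (starRingEnd ℂ) (p2b A w' w) := by
    unfold p2b
    rw [← integral_conj, ← integral_indicator (p2_setA hA), ← integral_indicator (p2_setA hA),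
      Measure.volume_eq_prod, ← integral_prod_swap]
    refine integral_congr_ae (Filter.Eventually.of_forall fun p => ?_)
    have e : p.1 - p.2 ∈ A ↔ p.2 - p.1 ∈ A :=
      ⟨fun h => by simpa using hsym _ h, fun h => by simpa using hsym _ h⟩
    by_cases hp : p.2 - p.1 ∈ A
    · simp [Set.indicator, hp, e.2 hp]
    · simp [Set.indicator, hp, mt e.1 hp]
  rw [this, ← ofReal_norm, ← ofReal_norm, RCLike.norm_conj]

lemma p2_b_one {A : Set ℝ} (hA : MeasurableSet A) {w w' : ℝ → H}
    {c c' : ℝ → ℝ} (hc : Measurable c) (hc' : Measurable c') (hc0 : ∀ s, 0 ≤ c s)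
    {D : ℝ} (hD : 0 ≤ D)
    (h : ∀ s t, t - s ∈ A → ‖inner ℂ (w s) (w' t)‖ ≤ D * c s * c' t) :
    ‖p2b A w w'‖ₑ ≤ ENNReal.ofReal D * volume A * (p2a c * p2a c') := by
  unfold p2b
  refine (enorm_integral_le_lintegral_enorm _).trans ?_
  rw [← lintegral_indicator (p2_setA hA)]
  have := p2_young (k := A.indicator (fun _ => ENNReal.ofReal D)) (f := fun s => ENNReal.ofReal (c s))
    (g := fun s => ENNReal.ofReal (c' s)) (measurable_const.indicator hA) (by fun_prop) (by fun_prop)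
  rw [lintegral_indicator hA, setLIntegral_const] at this
  refine le_trans ?_ this
  rw [lintegral_lintegral, Measure.volume_eq_prod]
  swap
  · have : Measurable (A.indicator (fun _ => ENNReal.ofReal D)) := measurable_const.indicator hA
    fun_prop
  refine lintegral_mono fun p => ?_
  by_cases hp : p.2 - p.1 ∈ A
  · simp only [Set.indicator, Set.mem_ofPred_eq, hp, if_true]
    rw [← ENNReal.ofReal_mul hD, ← ENNReal.ofReal_mul (mul_nonneg hD (hc0 _)), ← ofReal_norm]
    exact ENNReal.ofReal_le_ofReal (h _ _ hp)
  · simp [Set.indicator, hp]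

lemma p2_b_two {A : Set ℝ} (hA : MeasurableSet A) {w w' : ℝ → H} (hw : Integrable w)
    (hw' : Integrable w')
    {c c' : ℝ → ℝ} (hc : Measurable c) (hc' : Measurable c')
    {κ : ℝ≥0∞} {D : ℝ} (hD : 0 ≤ D)
    (h1 : ∀ I : Set ℝ, MeasurableSet I →
      ‖∫ s in I, w s‖ₑ ^ (2:ℝ) ≤ κ * ∫⁻ s in I, ENNReal.ofReal (c s) ^ (2:ℝ))
    (h2 : ∀ t, ‖w' t‖ ≤ D * c' t) :
    ‖p2b A w w'‖ₑ ≤ (κ * volume A) ^ (1/2:ℝ) * ENNReal.ofReal D * (p2a c * p2a c') := by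
  rw [p2_b_eq hA hw hw']
  refine (enorm_integral_le_lintegral_enorm _).trans ?_
  set G : ℝ → ℝ≥0∞ := fun t => (κ * ∫⁻ s in {s | t - s ∈ A}, ENNReal.ofReal (c s) ^ (2:ℝ)) ^ (1/2:ℝ)
    with hG
  have hGe : ∀ t, ∫⁻ s in {s | t - s ∈ A}, ENNReal.ofReal (c s) ^ (2:ℝ) =
      ∫⁻ s, A.indicator (fun _ => (1:ℝ≥0∞)) (t - s) * ENNReal.ofReal (c s) ^ (2:ℝ) := by
    intro t
    have hm : MeasurableSet {s | t - s ∈ A} := (measurable_const.sub measurable_id) hA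
    rw [← lintegral_indicator hm]
    refine lintegral_congr fun s => ?_
    by_cases hp : t - s ∈ A <;> simp [Set.indicator, hp]
  have hind : Measurable (A.indicator (fun _ => (1:ℝ≥0∞))) := measurable_const.indicator hA
  have hGm : Measurable G := by
    simp only [hG]
    simp_rw [hGe]
    refine Measurable.pow_const (Measurable.const_mul ?_ _) _
    exact Measurable.lintegral_prod_right' (f := fun p : ℝ × ℝ =>
      A.indicator (fun _ => (1:ℝ≥0∞)) (p.1 - p.2) * ENNReal.ofReal (c p.2) ^ (2:ℝ)) (by fun_prop)
  have step : ∫⁻ t, ‖inner ℂ (∫ s in {s | t - s ∈ A}, w s) (w' t)‖ₑ ≤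
      ∫⁻ t, G t * (ENNReal.ofReal D * ENNReal.ofReal (c' t)) := by
    refine lintegral_mono fun t => ?_
    have hm : MeasurableSet {s | t - s ∈ A} := (measurable_const.sub measurable_id) hA
    have h3 : ‖∫ s in {s | t - s ∈ A}, w s‖ₑ ≤ G t := by
      simp only [hG]
      rw [one_div, ENNReal.le_rpow_inv_iff (by norm_num)]
      exact h1 _ hm
    have h4 : ‖w' t‖ₑ ≤ ENNReal.ofReal D * ENNReal.ofReal (c' t) := by
      rw [← ENNReal.ofReal_mul hD, ← ofReal_norm]
      exact ENNReal.ofReal_le_ofReal (h2 t)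
    refine le_trans ?_ (mul_le_mul' h3 h4)
    rw [← ofReal_norm, ← ofReal_norm, ← ofReal_norm, ← ENNReal.ofReal_mul (norm_nonneg _)]
    exact ENNReal.ofReal_le_ofReal (norm_inner_le_norm _ _)
  refine step.trans ?_
  have e3 : ∀ t, G t * (ENNReal.ofReal D * ENNReal.ofReal (c' t)) =
      ENNReal.ofReal D * (G t * ENNReal.ofReal (c' t)) := fun t => by ring
  simp_rw [e3]
  rw [lintegral_const_mul _ (by fun_prop)]
  have hold := ENNReal.lintegral_mul_le_Lp_mul_Lq volume (p := 2) (q := 2)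
    (by rw [Real.holderConjugate_iff]; norm_num) hGm.aemeasurable
    (g := fun t => ENNReal.ofReal (c' t)) (by fun_prop)
  have hG2 : ∫⁻ t, G t ^ (2:ℝ) = κ * volume A * ∫⁻ s, ENNReal.ofReal (c s) ^ (2:ℝ) := by
    have : ∀ t, G t ^ (2:ℝ) = κ * ∫⁻ s, A.indicator (fun _ => (1:ℝ≥0∞)) (t - s) * ENNReal.ofReal (c s) ^ (2:ℝ) := by
      intro t
      simp only [hG]
      rw [← ENNReal.rpow_mul, hGe]; norm_num
    simp_rw [this]
    rw [lintegral_const_mul _ (Measurable.lintegral_prod_right' (f := fun p : ℝ × ℝ =>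
      A.indicator (fun _ => (1:ℝ≥0∞)) (p.1 - p.2) * ENNReal.ofReal (c p.2) ^ (2:ℝ)) (by fun_prop)),
      lintegral_lintegral_swap (by fun_prop), mul_assoc]
    congr 1
    rw [← lintegral_const_mul _ (by fun_prop)]
    refine lintegral_congr fun s => ?_
    simp only
    rw [lintegral_mul_const _ (by fun_prop)]
    congr 1
    rw [lintegral_sub_right_eq_self (fun t => A.indicator (fun _ => (1:ℝ≥0∞)) t) s,
      lintegral_indicator hA]
    simp
  calc _ ≤ ENNReal.ofReal D * _ := mul_le_mul' le_rfl hold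
    _ = _ := by
      have : (fun a => G a) = G := rfl
      rw [hG2, ENNReal.mul_rpow_of_nonneg _ _ (by norm_num)]
      unfold p2a
      ring

lemma p2_ker_L1 {S β : ℝ} (hS : 1 < S) (hβ : β * (S - 1) = 1) (m : ℤ) :
    ∫⁻ u, ENNReal.ofReal (p2ker S β u ((m:ℝ) + m)) ≤ ENNReal.ofReal (2 + 2 * β) := by
  set ρ : ℝ := 2 ^ (-(2 * m * β)) with hρd
  have hρ : 0 < ρ := by positivity
  have hβ0 : 0 < β := by
    by_contra h
    have : β * (S - 1) ≤ 0 := mul_nonpos_of_nonpos_of_nonneg (by linarith) (by linarith)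
    linarith
  calc ∫⁻ u, ENNReal.ofReal (p2ker S β u ((m:ℝ) + m))
      ≤ ∫⁻ u : ℝ, (Set.Icc (-ρ) ρ).indicator (fun _ => ENNReal.ofReal (2 ^ (2 * m * β))) u +
        ENNReal.ofReal (2 ^ (-(2 * m:ℝ))) * (fun u : ℝ => if u < ρ then 0 else ENNReal.ofReal (u ^ (-S))) |u| := by
        refine lintegral_mono fun u => ?_
        simp only
        by_cases h : |u| < ρ
        · have : u ∈ Set.Icc (-ρ) ρ := Set.mem_Icc.2 (abs_le.1 h.le)
          simp only [h, Set.indicator, this, if_true, mul_zero, add_zero]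
          apply ENNReal.ofReal_le_ofReal
          refine (min_le_right _ _).trans (le_of_eq ?_)
          congr 1; ring
        · simp only [h, if_false]
          refine le_trans ?_ le_add_self
          rw [← ENNReal.ofReal_mul (by positivity)]
          apply ENNReal.ofReal_le_ofReal
          refine (min_le_left _ _).trans (le_of_eq ?_)
          rw [mul_comm]; congr 2; ring
    _ = ENNReal.ofReal (2 ^ (2 * m * β)) * volume (Set.Icc (-ρ) ρ) +
        ENNReal.ofReal (2 ^ (-(2 * m:ℝ))) * (2 * ENNReal.ofReal (ρ ^ (1-S) / (S-1))) := by
        rw [lintegral_add_left (measurable_const.indicator measurableSet_Icc),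
          lintegral_indicator measurableSet_Icc, setLIntegral_const, lintegral_const_mul,
          p2_lint_abs (fun u : ℝ => if u < ρ then 0 else ENNReal.ofReal (u ^ (-S))), p2_far hS hρ]
        have hmm : Measurable (fun u : ℝ => if u < ρ then 0 else ENNReal.ofReal (u ^ (-S))) :=
          Measurable.ite (measurableSet_lt measurable_id measurable_const)
              measurable_const (by fun_prop)
        exact hmm.comp (measurable_norm (α := ℝ))
    _ = _ := by
        have h2 : (2:ℝ≥0∞) = ENNReal.ofReal 2 := by simp
        have hS1 : 0 < S - 1 := by linarith
        rw [Real.volume_Icc, ← ENNReal.ofReal_mul (by positivity), h2,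
          ← ENNReal.ofReal_mul (by positivity), ← ENNReal.ofReal_mul (by positivity),
          ← ENNReal.ofReal_add (by rw [sub_neg_eq_add]; positivity) (by positivity)]
        congr 1
        have e1 : (2:ℝ) ^ (2 * m * β) * ρ = 1 := by
          rw [hρd, ← Real.rpow_add (by norm_num)]; simp
        have e2 : (2:ℝ) ^ (-(2 * m:ℝ)) * ρ ^ (1 - S) = 1 := by
          rw [hρd, ← Real.rpow_mul (by norm_num), ← Real.rpow_add (by norm_num)]
          have : -(2 * m:ℝ) + -(2 * m * β) * (1 - S) = 0 := by
            have : -(2 * m:ℝ) + -(2 * m * β) * (1 - S) = 2 * m * (β * (S - 1) - 1) := by ring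
            rw [this, hβ]; ring
          rw [this]; simp
        have e3 : 1 / (S - 1) = β := by field_simp; linarith
        calc _ = 2 * ((2:ℝ) ^ (2 * m * β) * ρ) + 2 * ((2:ℝ) ^ (-(2 * m:ℝ)) * ρ ^ (1 - S)) * (1 / (S - 1)) := by
              ring
          _ = _ := by rw [e1, e2, e3]; ring

end P2d

section P2e

variable {H : Type*} [NormedAddCommGroup H] [InnerProductSpace ℂ H] [CompleteSpace H]

def p2shell (j : ℤ) : Set ℝ := {u | |u| ∈ Set.Ico ((2:ℝ) ^ j) (2 ^ (j+1))}

lemma p2_shell_meas (j : ℤ) : MeasurableSet (p2shell j) :=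
  (measurable_norm (α := ℝ)) measurableSet_Ico

lemma p2_shell_vol (j : ℤ) : volume (p2shell j) ≤ ENNReal.ofReal (2 * 2 ^ (j:ℝ)) := by
  have h : p2shell j ⊆ Set.Icc (2 ^ j) (2 ^ (j+1)) ∪ Set.Icc (-(2 ^ (j+1))) (-(2^j)) := by
    intro u hu
    simp only [p2shell, Set.mem_ofPred_eq, Set.mem_Ico] at hu
    rcases le_total 0 u with h | h
    · rw [abs_of_nonneg h] at hu
      exact Or.inl ⟨hu.1, hu.2.le⟩
    · rw [abs_of_nonpos h] at hu
      exact Or.inr ⟨by linarith [hu.2], by linarith [hu.1]⟩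
  refine (measure_mono h).trans ((measure_union_le _ _).trans ?_)
  rw [Real.volume_Icc, Real.volume_Icc, Real.rpow_intCast, zpow_add₀ (by norm_num)]
  have : (0:ℝ) < 2 ^ j := by positivity
  rw [← ENNReal.ofReal_add (by norm_num; linarith) (by norm_num; linarith)]
  apply ENNReal.ofReal_le_ofReal
  norm_num; linarith

lemma p2_hasSum {w w' : ℝ → H} (hw : Integrable w) (hw' : Integrable w') :
    HasSum (fun j : ℤ => p2b (p2shell j) w w') (inner ℂ (∫ s, w s) (∫ t, w' t)) := by
  have h := hasSum_integral_iUnion (μ := (volume : Measure (ℝ × ℝ)))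
    (f := fun p : ℝ × ℝ => inner ℂ (w p.1) (w' p.2))
    (s := fun j : ℤ => {p : ℝ × ℝ | p.2 - p.1 ∈ p2shell j})
    (fun j => p2_setA (p2_shell_meas j)) ?_ (p2_prod_int hw hw').integrableOn
  · have h1 := p2_b_eq MeasurableSet.univ hw hw'
    simp only [p2b, Set.mem_univ, Set.ofPred_true, Measure.restrict_univ] at h1
    have h2 : inner ℂ (∫ s, w s) (∫ t, w' t) = ∫ p : ℝ × ℝ, inner ℂ (w p.1) (w' p.2) := by
      rw [h1, integral_inner hw']
    rw [h2]
    have : (⋃ j : ℤ, {p : ℝ × ℝ | p.2 - p.1 ∈ p2shell j}) =ᵐ[volume] Set.univ := by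
      rw [ae_eq_univ]
      have hsub : (⋃ j : ℤ, {p : ℝ × ℝ | p.2 - p.1 ∈ p2shell j})ᶜ ⊆ {p : ℝ × ℝ | p.2 = p.1} := by
        intro p hp
        by_contra hne
        have hpos : 0 < |p.2 - p.1| := abs_pos.2 (sub_ne_zero.2 hne)
        obtain ⟨j, hj⟩ := exists_mem_Ico_zpow hpos (one_lt_two)
        exact hp (Set.mem_iUnion.2 ⟨j, hj⟩)
      refine measure_mono_null hsub ?_
      rw [Measure.volume_eq_prod, Measure.measure_prod_null (measurableSet_eq_fun measurable_snd measurable_fst)]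
      refine Filter.Eventually.of_forall fun x => ?_
      simp only [Set.preimage_setOf_eq, Set.setOf_eq_eq_singleton, Pi.zero_apply]
      exact Real.volume_singleton
    rw [setIntegral_congr_set this, setIntegral_univ] at h
    exact h
  · intro i j hij
    rw [Function.onFun, Set.disjoint_left]
    intro p hp hq
    simp only [p2shell, Set.mem_ofPred_eq, Set.mem_Ico] at hp hq
    rcases lt_or_gt_of_ne hij with h | h
    · have : (2:ℝ) ^ (i+1) ≤ 2 ^ j := zpow_le_zpow_right₀ (by norm_num) (by omega)
      linarith [hp.2, hq.1]
    · have : (2:ℝ) ^ (j+1) ≤ 2 ^ i := zpow_le_zpow_right₀ (by norm_num) (by omega)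
      linarith [hq.2, hp.1]

lemma p2_setint {S β : ℝ} (hS : 1 < S) (hβ : β * (S - 1) = 1) (m : ℤ) {w : ℝ → H} (hw : Integrable w)
    {c : ℝ → ℝ} (hc : Measurable c) (hc0 : ∀ s, 0 ≤ c s)
    (hd : ∀ s t, s ≠ t → ‖inner ℂ (w s) (w t)‖ ≤ p2ker S β (t - s) ((m:ℝ)+m) * c s * c t)
    (I : Set ℝ) (hI : MeasurableSet I) :
    ‖∫ s in I, w s‖ₑ ^ (2:ℝ) ≤ ENNReal.ofReal (2 + 2 * β) * ∫⁻ s in I, ENNReal.ofReal (c s) ^ (2:ℝ) := by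
  have e1 : ‖∫ s in I, w s‖ₑ ^ (2:ℝ) = ‖inner ℂ (∫ s in I, w s) (∫ s in I, w s)‖ₑ := by
    rw [inner_self_eq_norm_sq_to_K]
    rw [← ofReal_norm (_ ^ 2), norm_pow, RCLike.norm_ofReal, abs_norm, ENNReal.ofReal_pow (norm_nonneg _),
      ofReal_norm]
    norm_num
  rw [e1]
  refine (p2_inner_int hw.integrableOn hw.integrableOn).trans ?_
  set f : ℝ → ℝ≥0∞ := I.indicator (fun s => ENNReal.ofReal (c s)) with hf
  have hfm : Measurable f := by
    rw [hf]; exact Measurable.indicator (by fun_prop) hI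
  have hker0 : ∀ u, 0 ≤ p2ker S β u ((m:ℝ)+m) := fun u => by unfold p2ker; positivity
  have hkm : Measurable fun u => ENNReal.ofReal (p2ker S β u ((m:ℝ)+m)) := by
    unfold p2ker
    refine ENNReal.measurable_ofReal.comp (Measurable.min ?_ measurable_const)
    exact (measurable_norm.pow_const _).mul_const _
  have hy := p2_young hkm hfm hfm
  have hf2 : ∫⁻ s, f s ^ (2:ℝ) = ∫⁻ s in I, ENNReal.ofReal (c s) ^ (2:ℝ) := by
    rw [← lintegral_indicator hI]
    refine lintegral_congr fun s => ?_
    by_cases hs : s ∈ I <;> simp [hf, hs]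
  rw [hf2, ← ENNReal.rpow_add_of_nonneg _ _ (by norm_num) (by norm_num)] at hy
  rw [show (1/2:ℝ) + 1/2 = 1 by norm_num, ENNReal.rpow_one] at hy
  refine le_trans ?_ (hy.trans (by gcongr; exact p2_ker_L1 hS hβ m))
  rw [← lintegral_indicator hI]
  refine lintegral_mono fun s => ?_
  by_cases hs : s ∈ I
  · simp only [Set.indicator, hs, if_true]
    rw [← lintegral_indicator hI]
    have : ∀ᵐ t : ℝ, t ≠ s := by simp [ae_iff]
    refine lintegral_mono_ae ?_
    filter_upwards [this] with t ht
    by_cases h : t ∈ I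
    · simp only [Set.indicator, h, hf, hs, if_true]
      rw [← ENNReal.ofReal_mul (hker0 _), ← ENNReal.ofReal_mul (mul_nonneg (hker0 _) (hc0 _)),
        ← ofReal_norm]
      exact ENNReal.ofReal_le_ofReal (hd s t ht.symm)
    · simp [Set.indicator, h]
  · simp [Set.indicator, hs]

lemma p2_shell_bound {S β : ℝ} (hS : 1 < S) (hβ : β * (S - 1) = 1) (m l j : ℤ) {w w' : ℝ → H}
    (hw : Integrable w) (hw' : Integrable w')
    {c c' : ℝ → ℝ} (hc : Measurable c) (hc0 : ∀ s, 0 ≤ c s) (hc' : Measurable c') (hc0' : ∀ s, 0 ≤ c' s)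
    (hd : ∀ s t, s ≠ t → ‖inner ℂ (w s) (w t)‖ ≤ p2ker S β (t - s) ((m:ℝ)+m) * c s * c t)
    (hd' : ∀ s t, s ≠ t → ‖inner ℂ (w' s) (w' t)‖ ≤ p2ker S β (t - s) ((l:ℝ)+l) * c' s * c' t)
    (hdd : ∀ s t, s ≠ t → ‖inner ℂ (w s) (w' t)‖ ≤ p2ker S β (t - s) ((m:ℝ)+l) * c s * c' t)
    (hn : ∀ s, ‖w s‖ ≤ 2 ^ (m * β) * c s) (hn' : ∀ s, ‖w' s‖ ≤ 2 ^ (l * β) * c' s) :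
    ‖p2b (p2shell j) w w'‖ₑ ≤ ENNReal.ofReal ((4 + 4 * β) *
      2 ^ (-((min 1 (S-1) / 3) * (|(j:ℝ)/2 + l * β| + |(j:ℝ)/2 + m * β|)))) * (p2a c * p2a c') := by
  have hγ : 0 < S - 1 := by linarith
  have hβ0 : 0 < β := by
    by_contra h
    have : β * (S - 1) ≤ 0 := mul_nonpos_of_nonpos_of_nonneg (by linarith) (by linarith)
    linarith
  have two : ∀ (m l : ℤ) (w w' : ℝ → H) (c c' : ℝ → ℝ), Integrable w → Integrable w' → Measurable c →
      (∀ s, 0 ≤ c s) → Measurable c' →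
      (∀ s t, s ≠ t → ‖inner ℂ (w s) (w t)‖ ≤ p2ker S β (t - s) ((m:ℝ)+m) * c s * c t) →
      (∀ s, ‖w' s‖ ≤ 2 ^ (l * β) * c' s) → 
      ‖p2b (p2shell j) w w'‖ₑ ≤ ENNReal.ofReal ((4 + 4 * β) * 2 ^ ((j:ℝ)/2 + l * β)) * (p2a c * p2a c') := by
    intro m l w w' c c' hw hw' hc hc0 hc' hd hn'
    refine (p2_b_two (p2_shell_meas j) hw hw' hc hc' (by positivity)
      (p2_setint hS hβ m hw hc hc0 hd) hn').trans ?_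
    refine mul_le_mul' ?_ le_rfl
    calc (ENNReal.ofReal (2 + 2 * β) * volume (p2shell j)) ^ (1/2:ℝ) * ENNReal.ofReal (2 ^ (l * β))
        ≤ (ENNReal.ofReal (2 + 2 * β) * ENNReal.ofReal (2 * 2 ^ (j:ℝ))) ^ (1/2:ℝ) * ENNReal.ofReal (2 ^ (l * β)) := by
          gcongr; exact p2_shell_vol j
      _ = ENNReal.ofReal (((4 + 4 * β) * 2 ^ (j:ℝ)) ^ (1/2:ℝ) * 2 ^ (l * β)) := by
          rw [← ENNReal.ofReal_mul (by positivity), ENNReal.ofReal_rpow_of_nonneg (by positivity) (by norm_num),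
            ← ENNReal.ofReal_mul (by positivity)]
          congr 3; ring
      _ ≤ _ := by
          apply ENNReal.ofReal_le_ofReal
          rw [Real.mul_rpow (by positivity) (by positivity), ← Real.rpow_mul (by norm_num), mul_assoc,
            ← Real.rpow_add (by norm_num)]
          have h1 : (4 + 4 * β) ^ (1/2:ℝ) ≤ 4 + 4 * β := by
            conv_rhs => rw [← Real.rpow_one (4 + 4 * β)]
            exact Real.rpow_le_rpow_of_exponent_le (by linarith) (by norm_num)
          have h2 : (j:ℝ) * (1/2) + l * β = (j:ℝ)/2 + l * β := by ring
          rw [h2]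
          gcongr
  have b2 := two m l w w' c c' hw hw' hc hc0 hc' hd hn'
  have b3 := two l m w' w c' c hw' hw hc' hc0' hc hd' hn
  rw [p2_b_symm (p2_shell_meas j) (by intro u hu; simpa [p2shell] using hu), mul_comm (p2a c')] at b3
  have b1 : ‖p2b (p2shell j) w w'‖ₑ ≤ ENNReal.ofReal ((4 + 4 * β) *
      2 ^ (-((S-1) * (((j:ℝ)/2 + l * β) + ((j:ℝ)/2 + m * β))))) * (p2a c * p2a c') := by
    refine (p2_b_one (p2_shell_meas j) hc hc' hc0 (D := 2 ^ (-(j * S) - ((m:ℝ) + l))) (by positivity) ?_).trans ?_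
    · intro s t hst
      have hpos : (0:ℝ) < 2 ^ j := by positivity
      have hne : s ≠ t := by
        rintro rfl
        simp only [p2shell, Set.mem_ofPred_eq, Set.mem_Ico, sub_self, abs_zero] at hst
        linarith [hst.1]
      refine (hdd s t hne).trans ?_
      have h0 := hc0 s
      have h0' := hc0' t
      gcongr
      refine (min_le_left _ _).trans ?_
      rw [sub_eq_add_neg (-(j * S)), Real.rpow_add (by norm_num)]
      gcongr
      have : (2:ℝ) ^ (-(j * S)) = (2 ^ j) ^ (-S) := by
        rw [← Real.rpow_intCast, ← Real.rpow_mul (by norm_num)]; congr 1; ring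
      rw [this]
      exact Real.rpow_le_rpow_of_nonpos hpos hst.1 (by linarith)
    · refine mul_le_mul' ?_ le_rfl
      refine (mul_le_mul' le_rfl (p2_shell_vol j)).trans ?_
      rw [← ENNReal.ofReal_mul (by positivity)]
      apply ENNReal.ofReal_le_ofReal
      rw [mul_left_comm, ← Real.rpow_add (by norm_num)]
      have e : -(j * S) - ((m:ℝ) + l) + j = -((S-1) * (((j:ℝ)/2 + l * β) + ((j:ℝ)/2 + m * β))) := by
        have : -((S-1) * (((j:ℝ)/2 + l * β) + ((j:ℝ)/2 + m * β))) = 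
          -((S-1) * j) - (β * (S-1)) * ((m:ℝ) + l) := by ring
        rw [this, hβ]; ring
      rw [e]
      gcongr; linarith
  have hmin := p2_min3 hγ ((j:ℝ)/2 + l * β) ((j:ℝ)/2 + m * β)
  have mono : ∀ z, z ≤ -((min 1 (S-1) / 3) * (|(j:ℝ)/2 + l * β| + |(j:ℝ)/2 + m * β|)) →
    ENNReal.ofReal ((4 + 4 * β) * 2 ^ z) * (p2a c * p2a c') ≤ ENNReal.ofReal ((4 + 4 * β) *
      2 ^ (-((min 1 (S-1) / 3) * (|(j:ℝ)/2 + l * β| + |(j:ℝ)/2 + m * β|)))) * (p2a c * p2a c') := by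
    intro z hz
    gcongr
    norm_num
  rcases min_le_iff.1 hmin with h | h
  · rcases min_le_iff.1 h with h | h
    · exact b2.trans (mono _ h)
    · exact b3.trans (mono _ h)
  · exact b1.trans (mono _ h)

end P2e

section P2f

variable {H : Type*} [NormedAddCommGroup H] [InnerProductSpace ℂ H] [CompleteSpace H]

lemma p2_dyadic {β ε : ℝ} (hβ : 0 < β) (hε : 0 < ε) : ∃ B > 0, ∀ (K J : Finset ℤ) (a : ℤ → ℝ),
    ∑ j ∈ J, ∑ m ∈ K, ∑ l ∈ K, (2:ℝ) ^ (-(ε * (|(j:ℝ)/2 + l * β| + |(j:ℝ)/2 + m * β|))) * (a m * a l)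
     ≤ B * ∑ m ∈ K, a m ^ 2 := by
  obtain ⟨B1, hB1, h1⟩ := p2_geom (ε := ε * β) (by positivity)
  obtain ⟨B2, hB2, h2⟩ := p2_geom (ε := ε / 2) (by positivity)
  refine ⟨B1 * B2, by positivity, fun K J a => ?_⟩
  set k : ℤ → ℤ → ℝ := fun j m => (2:ℝ) ^ (-(ε * |(j:ℝ)/2 + m * β|)) with hk
  have hk0 : ∀ j m, 0 ≤ k j m := fun j m => by positivity
  have s1 : ∀ j, ∑ m ∈ K, k j m ≤ B1 := by
    intro j
    refine (le_of_eq ?_).trans (h1 ((j:ℝ) / (2 * β)) K)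
    refine Finset.sum_congr rfl fun m _ => ?_
    simp only [hk]
    congr 2
    rw [mul_assoc]
    congr 1
    rw [← abs_of_pos hβ, ← abs_mul, abs_of_pos hβ]
    congr 1; field_simp; ring
  have s2 : ∀ m, ∑ j ∈ J, k j m ≤ B2 := by
    intro m
    refine (le_of_eq ?_).trans (h2 (2 * m * β) J)
    refine Finset.sum_congr rfl fun j _ => ?_
    simp only [hk]
    congr 2
    have : |(j:ℝ)/2 + m * β| = 1/2 * |(j:ℝ) + 2 * m * β| := by
      have h12 : (1/2:ℝ) = |1/2| := by norm_num
      rw [h12, ← abs_mul]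
      congr 1; ring
    rw [this]; ring
  calc _ = ∑ j ∈ J, (∑ m ∈ K, k j m * a m) ^ 2 := by
        refine Finset.sum_congr rfl fun j _ => ?_
        rw [sq, Finset.sum_mul_sum]
        refine Finset.sum_congr rfl fun m _ => Finset.sum_congr rfl fun l _ => ?_
        have : -(ε * (|(j:ℝ)/2 + l * β| + |(j:ℝ)/2 + m * β|)) =
          -(ε * |(j:ℝ)/2 + m * β|) + -(ε * |(j:ℝ)/2 + l * β|) := by ring
        rw [this, Real.rpow_add (by norm_num)]
        simp only [hk]; ring
    _ ≤ ∑ j ∈ J, (B1 * ∑ m ∈ K, k j m * a m ^ 2) := by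
        refine Finset.sum_le_sum fun j _ => ?_
        have := Finset.sum_sq_le_sum_mul_sum_of_sq_eq_mul K (r := fun m => k j m * a m)
          (f := fun m => k j m) (g := fun m => k j m * a m ^ 2) (fun m _ => hk0 j m)
          (fun m _ => mul_nonneg (hk0 j m) (sq_nonneg _)) (fun m _ => by ring)
        refine this.trans ?_
        gcongr
        exact s1 j
    _ = B1 * ∑ m ∈ K, (∑ j ∈ J, k j m) * a m ^ 2 := by
        rw [← Finset.mul_sum, Finset.sum_comm]
        simp_rw [Finset.sum_mul]
    _ ≤ B1 * ∑ m ∈ K, B2 * a m ^ 2 := by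
        gcongr with m _
        exact s2 m
    _ = _ := by rw [← Finset.mul_sum]; ring

lemma p2_lemB {S β : ℝ} (hS : 1 < S) (hβ : β * (S - 1) = 1) :
    ∃ C > 0, ∀ (K : Finset ℤ) (w : ℤ → ℝ → H) (c : ℤ → ℝ → ℝ) (φ : ℝ → ℝ),
    (∀ m, Integrable (w m)) → (∀ m s, 0 ≤ c m s) → (∀ m, Measurable (c m)) →
    (∀ s, 0 ≤ φ s) → Measurable φ →
    (∫⁻ s, ENNReal.ofReal (φ s) ^ (2:ℝ) ≠ ∞) →
    (∀ s, ∑ m ∈ K, c m s ^ 2 ≤ φ s ^ 2) →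
    (∀ m l s t, s ≠ t → ‖inner ℂ (w m s) (w l t)‖ ≤ p2ker S β (t - s) ((m:ℝ)+l) * c m s * c l t) →
    (∀ m l s t, ‖inner ℂ (w m s) (w l t)‖ ≤ 2 ^ (((m:ℝ)+l) * β) * c m s * c l t) →
    ‖∫ s, ∑ m ∈ K, w m s‖ₑ ^ (2:ℝ) ≤ ENNReal.ofReal C *
      (∫⁻ s, ENNReal.ofReal (φ s) ^ (2:ℝ)) := by
  have hγ : 0 < S - 1 := by linarith
  have hβ0 : 0 < β := by
    by_contra h
    have : β * (S - 1) ≤ 0 := mul_nonpos_of_nonpos_of_nonneg (by linarith) (by linarith)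
    linarith
  set ε := min 1 (S-1) / 3 with hε
  have hε0 : 0 < ε := by have := lt_min one_pos hγ; positivity
  obtain ⟨B, hB, hdy⟩ := p2_dyadic hβ0 hε0
  refine ⟨(4 + 4 * β) * B, by positivity, ?_⟩
  intro K w c φ hw hc hcm hφ hφm hfin hsum hd hd2
  have hn : ∀ m s, ‖w m s‖ ≤ 2 ^ (m * β) * c m s := by
    intro m s
    have := hd2 m m s s
    rw [inner_self_eq_norm_sq_to_K, norm_pow, RCLike.norm_ofReal, abs_norm] at this
    have e : (2:ℝ) ^ (((m:ℝ)+m) * β) * c m s * c m s = (2 ^ (m * β) * c m s) ^ 2 := by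
      rw [add_mul, Real.rpow_add (by norm_num)]; ring
    rw [e] at this
    exact le_of_sq_le_sq this (mul_nonneg (by positivity) (hc m s))
  have hcφ : ∀ m ∈ K, ∫⁻ s, ENNReal.ofReal (c m s) ^ (2:ℝ) ≠ ∞ := by
    intro m hm
    refine ne_top_of_le_ne_top hfin (lintegral_mono fun s => ?_)
    gcongr
    have h1 : c m s ^ 2 ≤ φ s ^ 2 :=
      (Finset.single_le_sum (f := fun m => c m s ^ 2) (fun i _ => sq_nonneg _) hm).trans (hsum s)
    exact le_of_sq_le_sq h1 (hφ s)
  have ha : ∀ m ∈ K, p2a (c m) ≠ ∞ := fun m hm => ENNReal.rpow_ne_top_of_nonneg (by norm_num) (hcφ m hm)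
  set a : ℤ → ℝ := fun m => (p2a (c m)).toReal with had
  have hb : ∀ j, ∀ m ∈ K, ∀ l ∈ K, ‖p2b (p2shell j) (w m) (w l)‖ ≤
      (4 + 4 * β) * ((2:ℝ) ^ (-(ε * (|(j:ℝ)/2 + l * β| + |(j:ℝ)/2 + m * β|))) * (a m * a l)) := by
    intro j m hm l hl
    have := p2_shell_bound hS hβ m l j (hw m) (hw l) (hcm m) (hc m) (hcm l) (hc l) (hd m m) (hd l l)
      (hd m l) (hn m) (hn l)
    rw [← ofReal_norm, ← ENNReal.ofReal_toReal (ha m hm), ← ENNReal.ofReal_toReal (ha l hl),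
      ← ENNReal.ofReal_mul ENNReal.toReal_nonneg, ← ENNReal.ofReal_mul (by positivity)] at this
    have := (ENNReal.ofReal_le_ofReal_iff (by positivity)).1 this
    rwa [mul_assoc] at this
  have hs : HasSum (fun j : ℤ => ∑ m ∈ K, ∑ l ∈ K, p2b (p2shell j) (w m) (w l))
      (∑ m ∈ K, ∑ l ∈ K, inner ℂ (∫ s, w m s) (∫ s, w l s)) :=
    hasSum_sum fun m _ => hasSum_sum fun l _ => p2_hasSum (hw m) (hw l)
  have htot : ‖∑ m ∈ K, ∑ l ∈ K, inner ℂ (∫ s, w m s) (∫ s, w l s)‖ ≤ (4 + 4 * β) * B * ∑ m ∈ K, a m ^ 2 := by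
    refine le_of_tendsto hs.norm (Filter.Eventually.of_forall fun J => ?_)
    calc _ ≤ ∑ j ∈ J, ∑ m ∈ K, ∑ l ∈ K, ‖p2b (p2shell j) (w m) (w l)‖ := by
          refine (norm_sum_le _ _).trans (Finset.sum_le_sum fun j _ => ?_)
          refine (norm_sum_le _ _).trans (Finset.sum_le_sum fun m _ => ?_)
          exact norm_sum_le _ _
      _ ≤ ∑ j ∈ J, ∑ m ∈ K, ∑ l ∈ K, (4 + 4 * β) * ((2:ℝ) ^ (-(ε * (|(j:ℝ)/2 + l * β| + |(j:ℝ)/2 + m * β|))) * (a m * a l)) := by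
          refine Finset.sum_le_sum fun j _ => Finset.sum_le_sum fun m hm => Finset.sum_le_sum fun l hl => hb j m hm l hl
      _ = (4 + 4 * β) * ∑ j ∈ J, ∑ m ∈ K, ∑ l ∈ K, ((2:ℝ) ^ (-(ε * (|(j:ℝ)/2 + l * β| + |(j:ℝ)/2 + m * β|))) * (a m * a l)) := by
          simp_rw [Finset.mul_sum]
      _ ≤ (4 + 4 * β) * (B * ∑ m ∈ K, a m ^ 2) := by gcongr; exact hdy K J a
      _ = _ := by ring
  have e1 : ‖∫ s, ∑ m ∈ K, w m s‖ₑ ^ (2:ℝ)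
      = ENNReal.ofReal ‖∑ m ∈ K, ∑ l ∈ K, inner ℂ (∫ s, w m s) (∫ s, w l s)‖ := by
    have : ∑ m ∈ K, ∑ l ∈ K, inner ℂ (∫ s, w m s) (∫ s, w l s) =
        inner ℂ (∫ s, ∑ m ∈ K, w m s) (∫ s, ∑ m ∈ K, w m s) := by
      rw [integral_finsetSum _ fun m _ => hw m, sum_inner]
      simp_rw [inner_sum]
    rw [this, inner_self_eq_norm_sq_to_K]
    rw [norm_pow, RCLike.norm_ofReal, abs_norm, ENNReal.ofReal_pow (norm_nonneg _),
      ofReal_norm]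
    norm_num
  rw [e1]
  refine (ENNReal.ofReal_le_ofReal htot).trans ?_
  rw [ENNReal.ofReal_mul (by positivity)]
  gcongr
  rw [ENNReal.ofReal_sum_of_nonneg fun _ _ => sq_nonneg _]
  calc ∑ m ∈ K, ENNReal.ofReal (a m ^ 2) = ∑ m ∈ K, ∫⁻ s, ENNReal.ofReal (c m s) ^ (2:ℝ) := by
        refine Finset.sum_congr rfl fun m hm => ?_
        simp only [had]
        rw [ENNReal.ofReal_pow ENNReal.toReal_nonneg, ENNReal.ofReal_toReal (ha m hm), p2a,
          ← ENNReal.rpow_natCast, ← ENNReal.rpow_mul]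
        norm_num
    _ = ∫⁻ s, ∑ m ∈ K, ENNReal.ofReal (c m s) ^ (2:ℝ) := by
        rw [lintegral_finsetSum]
        intro m _
        have := hcm m
        fun_prop
    _ ≤ _ := by
        refine lintegral_mono fun s => ?_
        have e : ∀ x : ℝ, 0 ≤ x → ENNReal.ofReal x ^ (2:ℝ) = ENNReal.ofReal (x ^ 2) := by
          intro x hx
          rw [ENNReal.ofReal_rpow_of_nonneg hx (by norm_num)]; norm_num
        rw [e _ (hφ s)]
        simp_rw [fun m => e _ (hc m s)]
        rw [← ENNReal.ofReal_sum_of_nonneg fun _ _ => sq_nonneg _]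
        exact ENNReal.ofReal_le_ofReal (hsum s)

lemma p2_lemAB {S β : ℝ} (hβ : 0 < β) (hS : 0 < S) (hα : S * β / (1 + β) ≤ 1) :
    ∃ C > 0, ∀ (K : Finset ℤ) (w : ℤ → ℝ → H) (c : ℤ → ℝ → ℝ) (φ : ℝ → ℝ),
    (∀ m, Integrable (w m)) → (∀ m s, 0 ≤ c m s) → (∀ m, Measurable (c m)) →
    (∀ s, 0 ≤ φ s) → Measurable φ →
    (∫⁻ s, ENNReal.ofReal (φ s) ^ (2 / (2 - S * β / (1 + β))) ≠ ∞) →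
    (∀ s, ∑ m ∈ K, c m s ^ 2 ≤ φ s ^ 2) →
    (∀ m l s t, s ≠ t → ‖inner ℂ (w m s) (w l t)‖ ≤ p2ker S β (t - s) ((m:ℝ)+l) * c m s * c l t) →
    (∀ m l s t, ‖inner ℂ (w m s) (w l t)‖ ≤ 2 ^ (((m:ℝ)+l) * β) * c m s * c l t) →
    ‖∫ s, ∑ m ∈ K, w m s‖ₑ ^ (2:ℝ) ≤ ENNReal.ofReal C *
      (∫⁻ s, ENNReal.ofReal (φ s) ^ (2 / (2 - S * β / (1 + β)))) ^ (2 - S * β / (1 + β)) := by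
  rcases hα.lt_or_eq with h | h
  · exact p2_lemA hβ hS h
  · have h1 : S * β = 1 + β := by field_simp at h; linarith
    have h2 : 1 < S := by nlinarith
    have h3 : β * (S - 1) = 1 := by linarith
    obtain ⟨C, hC, hh⟩ := p2_lemB (H := H) h2 h3
    refine ⟨C, hC, ?_⟩
    rw [h]
    have e : (2:ℝ) - 1 = 1 := by norm_num
    simp only [e, div_one, ENNReal.rpow_one]
    exact hh

end P2f

section P2g

variable {H : Type*} [NormedAddCommGroup H] [InnerProductSpace ℂ H] [CompleteSpace H]
variable {X : Type*} [MeasurableSpace X]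

lemma p2_st5 {μ : Measure X} {F F' : X → ℂ} {E E' : X → H} (hF : Measurable F) (hF' : Measurable F')
    (hi : Integrable (fun x => F x • E x) μ) (hi' : Integrable (fun x => F' x • E' x) μ) {D : ℝ}
    (hD : ∀ x x', ‖inner ℂ (E x) (E' x')‖ ≤ D) :
    ‖inner ℂ (∫ x, F x • E x ∂μ) (∫ x, F' x • E' x ∂μ)‖ₑ ≤
      ENNReal.ofReal D * (∫⁻ x, ‖F x‖ₑ ∂μ) * (∫⁻ x, ‖F' x‖ₑ ∂μ) := by
  refine (p2_inner_int hi hi').trans ?_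
  rw [mul_assoc, ← lintegral_mul_const _ hF.enorm, ← lintegral_const_mul _ (hF.enorm.mul_const _)]
  refine lintegral_mono fun x => ?_
  rw [← lintegral_const_mul _ hF'.enorm, ← lintegral_const_mul _ (hF'.enorm.const_mul _)]
  refine lintegral_mono fun x' => ?_
  rw [inner_smul_left, inner_smul_right, enorm_mul, enorm_mul]
  have h1 : ‖(starRingEnd ℂ) (F x)‖ₑ = ‖F x‖ₑ := by
    rw [← ofReal_norm, ← ofReal_norm, RCLike.norm_conj]
  have h2 : ‖inner ℂ (E x) (E' x')‖ₑ ≤ ENNReal.ofReal D := by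
    rw [← ofReal_norm]; exact ENNReal.ofReal_le_ofReal (hD x x')
  rw [h1]
  calc _ = ‖inner ℂ (E x) (E' x')‖ₑ * (‖F x‖ₑ * ‖F' x'‖ₑ) := by ring
    _ ≤ _ := mul_le_mul' h2 le_rfl

lemma p2_st7 {μ : Measure X} {F : X → ℂ} {E : X → H}
    (hi : Integrable (fun x => F x • E x) μ) (k : H) :
    inner ℂ (∫ x, F x • E x ∂μ) k = ∫ x, (starRingEnd ℂ) (F x) * inner ℂ (E x) k ∂μ := by
  rw [← inner_conj_symm, ← integral_inner hi, ← integral_conj]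
  refine integral_congr_ae (Filter.Eventually.of_forall fun x => ?_)
  simp only [inner_conj_symm, inner_smul_left]

lemma p2_st6 {μ : Measure X} {F : X → ℂ} {E : X → H} (hF : Measurable F) (hE : StronglyMeasurable E)
    (hi : Integrable (fun x => F x • E x) μ)
    (hen : ∀ k : H, ∫⁻ x, ‖inner ℂ (E x) k‖ₑ ^ (2:ℝ) ∂μ ≤ ‖k‖ₑ ^ (2:ℝ)) :
    ‖∫ x, F x • E x ∂μ‖ₑ ^ (2:ℝ) ≤ ∫⁻ x, ‖F x‖ₑ ^ (2:ℝ) ∂μ := by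
  set k := ∫ x, F x • E x ∂μ with hk
  have h1 : ‖k‖ₑ * ‖k‖ₑ ≤ (∫⁻ x, ‖F x‖ₑ ^ (2:ℝ) ∂μ) ^ (1/2:ℝ) * ‖k‖ₑ := by
    calc ‖k‖ₑ * ‖k‖ₑ = ‖inner ℂ k k‖ₑ := by
          rw [inner_self_eq_norm_sq_to_K, ← ofReal_norm (_ ^ 2), norm_pow, RCLike.norm_ofReal, abs_norm,
            ENNReal.ofReal_pow (norm_nonneg _), ofReal_norm, sq]
      _ = ‖∫ x, (starRingEnd ℂ) (F x) * inner ℂ (E x) k ∂μ‖ₑ := by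
          rw [← p2_st7 hi]
      _ ≤ ∫⁻ x, ‖F x‖ₑ * ‖inner ℂ (E x) k‖ₑ ∂μ := by
          refine (enorm_integral_le_lintegral_enorm _).trans (lintegral_mono fun x => ?_)
          rw [enorm_mul, ← ofReal_norm ((starRingEnd ℂ) (F x)), RCLike.norm_conj, ofReal_norm]
      _ ≤ (∫⁻ x, ‖F x‖ₑ ^ (2:ℝ) ∂μ) ^ (1/2:ℝ) * (∫⁻ x, ‖inner ℂ (E x) k‖ₑ ^ (2:ℝ) ∂μ) ^ (1/2:ℝ) :=
          ENNReal.lintegral_mul_le_Lp_mul_Lq μ (p := 2) (q := 2)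
            (by rw [Real.holderConjugate_iff]; norm_num) hF.enorm.aemeasurable
            (hE.inner stronglyMeasurable_const).enorm.aemeasurable
      _ ≤ (∫⁻ x, ‖F x‖ₑ ^ (2:ℝ) ∂μ) ^ (1/2:ℝ) * (‖k‖ₑ ^ (2:ℝ)) ^ (1/2:ℝ) := by
          gcongr; exact hen k
      _ = _ := by rw [← ENNReal.rpow_mul]; norm_num
  rcases eq_or_ne ‖k‖ₑ 0 with h0 | h0
  · rw [h0]; simp
  have h2 : ‖k‖ₑ ≤ (∫⁻ x, ‖F x‖ₑ ^ (2:ℝ) ∂μ) ^ (1/2:ℝ) :=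
    (ENNReal.mul_le_mul_iff_left h0 enorm_ne_top).1 h1
  rw [one_div, ENNReal.le_rpow_inv_iff (by norm_num)] at h2
  exact h2

/-- level sets -/
def p2lev (v : X → ℂ) (N : ℝ) (m : ℤ) : Set X := {x | ‖v x‖ ∈ Set.Ioc ((2:ℝ) ^ m * N) (2 ^ (m+1) * N)}

/-- atoms -/
def p2atom (v : X → ℂ) (N q r : ℝ) (m : ℤ) : X → ℂ :=
  (p2lev v N m).indicator (fun x => ((N ^ (q - r) * ‖v x‖ ^ (r - 2) : ℝ) : ℂ) * v x)

def p2d (μ : Measure X) (v : X → ℂ) (N r : ℝ) (m : ℤ) : ℝ≥0∞ := ∫⁻ x in p2lev v N m, ‖v x‖ₑ ^ r ∂μ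

def p2c (μ : Measure X) (v : X → ℂ) (N q r : ℝ) (m : ℤ) : ℝ :=
  N ^ (q - 1) * √((p2d μ v N r m).toReal / N ^ r)

lemma p2_lev_meas {v : X → ℂ} (hv : Measurable v) (N : ℝ) (m : ℤ) : MeasurableSet (p2lev v N m) :=
  hv.norm measurableSet_Ioc

lemma p2_lev_empty {v : X → ℂ} {N : ℝ} (hN : N = 0) (m : ℤ) : p2lev v N m = ∅ := by
  ext x; simp [p2lev, hN]

lemma p2_atom_meas {v : X → ℂ} (hv : Measurable v) (N q r : ℝ) (m : ℤ) : Measurable (p2atom v N q r m) := by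
  refine Measurable.indicator ?_ (p2_lev_meas hv N m)
  fun_prop

lemma p2_lev_disj (v : X → ℂ) {N : ℝ} (hN : 0 ≤ N) :
    Pairwise (Function.onFun Disjoint (p2lev v N)) := by
  intro i j hij
  rw [Function.onFun, Set.disjoint_left]
  intro p hp hq
  simp only [p2lev, Set.mem_ofPred_eq, Set.mem_Ioc] at hp hq
  rcases lt_or_gt_of_ne hij with h | h
  · have : (2:ℝ) ^ (i+1) ≤ 2 ^ j := zpow_le_zpow_right₀ (by norm_num) (by omega)
    nlinarith [hp.2, hq.1]
  · have : (2:ℝ) ^ (j+1) ≤ 2 ^ i := zpow_le_zpow_right₀ (by norm_num) (by omega)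
    nlinarith [hq.2, hp.1]

lemma p2_d_tsum {μ : Measure X} {v : X → ℂ} (hv : Measurable v) {N r : ℝ} (hN : 0 ≤ N) (hr : 2 < r)
    (hI : ∫⁻ x, ‖v x‖ₑ ^ r ∂μ = ENNReal.ofReal (N ^ r)) :
    ∑' m, p2d μ v N r m = ENNReal.ofReal (N ^ r) := by
  rcases hN.eq_or_lt with h0 | h0
  · simp only [p2d, p2_lev_empty h0.symm]
    rw [← h0, Real.zero_rpow (by linarith)]
    simp
  unfold p2d
  rw [← lintegral_iUnion (fun m => p2_lev_meas hv N m) (p2_lev_disj v hN), ← hI,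
    ← lintegral_indicator (MeasurableSet.iUnion fun m => p2_lev_meas hv N m)]
  refine lintegral_congr fun x => ?_
  by_cases hx : v x = 0
  · rw [Set.indicator]
    split_ifs <;> simp [hx, show 0 < r by linarith]
  · have : x ∈ ⋃ m, p2lev v N m := by
      have hpos : 0 < ‖v x‖ / N := div_pos (norm_pos_iff.2 hx) h0
      obtain ⟨m, hm⟩ := exists_mem_Ioc_zpow hpos (one_lt_two)
      refine Set.mem_iUnion.2 ⟨m, ?_⟩
      simp only [p2lev, Set.mem_ofPred_eq, Set.mem_Ioc]
      exact ⟨(lt_div_iff₀ h0).1 hm.1, (div_le_iff₀ h0).1 hm.2⟩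
    simp only [Set.indicator, this, if_true]

lemma p2_d_le {μ : Measure X} {v : X → ℂ} {N r : ℝ}
    (hI : ∫⁻ x, ‖v x‖ₑ ^ r ∂μ = ENNReal.ofReal (N ^ r)) (m : ℤ) :
    p2d μ v N r m ≤ ENNReal.ofReal (N ^ r) := by
  rw [← hI]; exact setLIntegral_le_lintegral _ _

lemma p2_d_sum {μ : Measure X} {v : X → ℂ} (hv : Measurable v) {N r : ℝ} (hN : 0 ≤ N) (hr : 2 < r)
    (hI : ∫⁻ x, ‖v x‖ₑ ^ r ∂μ = ENNReal.ofReal (N ^ r)) (K : Finset ℤ) :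
    ∑ m ∈ K, (p2d μ v N r m).toReal ≤ N ^ r := by
  have h1 : ∑ m ∈ K, p2d μ v N r m ≤ ENNReal.ofReal (N ^ r) := by
    rw [← p2_d_tsum hv hN hr hI]; exact ENNReal.sum_le_tsum K
  rw [← ENNReal.toReal_sum]
  · exact ENNReal.toReal_le_of_le_ofReal (by positivity) h1
  · exact fun m _ => ne_top_of_le_ne_top ENNReal.ofReal_ne_top (p2_d_le hI m)

lemma p2_c_sum {μ : Measure X} {v : X → ℂ} (hv : Measurable v) {N q r : ℝ} (hN : 0 ≤ N) (hr : 2 < r)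
    (hI : ∫⁻ x, ‖v x‖ₑ ^ r ∂μ = ENNReal.ofReal (N ^ r)) (K : Finset ℤ) :
    ∑ m ∈ K, p2c μ v N q r m ^ 2 ≤ (N ^ (q - 1)) ^ 2 := by
  unfold p2c
  have : ∀ m, (N ^ (q - 1) * √((p2d μ v N r m).toReal / N ^ r)) ^ 2 = (N ^ (q-1)) ^ 2 *
      ((p2d μ v N r m).toReal / N ^ r) := by
    intro m
    rw [mul_pow, Real.sq_sqrt (by positivity)]
  simp_rw [this]
  rw [← Finset.mul_sum, ← Finset.sum_div]
  have h2 : (∑ m ∈ K, (p2d μ v N r m).toReal) / N ^ r ≤ 1 :=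
    div_le_one_of_le₀ (p2_d_sum hv hN hr hI K) (by positivity)
  exact mul_le_of_le_one_right (by positivity) h2

lemma p2_atom_L1 {μ : Measure X} {v : X → ℂ} (hv : Measurable v) {N q r : ℝ} (hN : 0 ≤ N) (hr : 2 < r)
    (hI : ∫⁻ x, ‖v x‖ₑ ^ r ∂μ = ENNReal.ofReal (N ^ r)) (m : ℤ) :
    ∫⁻ x, ‖p2atom v N q r m x‖ₑ ∂μ ≤ ENNReal.ofReal (2 ^ (-(m:ℝ)) * p2c μ v N q r m) := by
  rcases hN.eq_or_lt with h0 | h0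
  · have : p2atom v N q r m = 0 := by
      unfold p2atom; rw [p2_lev_empty h0.symm, Set.indicator_empty]; rfl
    rw [this]; simp
  have hfin := ne_top_of_le_ne_top ENNReal.ofReal_ne_top (p2_d_le hI m)
  have hle1 : (p2d μ v N r m).toReal / N ^ r ≤ 1 :=
    div_le_one_of_le₀ (ENNReal.toReal_le_of_le_ofReal (by positivity) (p2_d_le hI m)) (by positivity)
  calc ∫⁻ x, ‖p2atom v N q r m x‖ₑ ∂μ
      ≤ ∫⁻ x in p2lev v N m, ENNReal.ofReal (2 ^ (-(m:ℝ)) * N ^ (q - r - 1)) * ‖v x‖ₑ ^ r ∂μ := by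
        rw [← lintegral_indicator (p2_lev_meas hv N m)]
        refine lintegral_mono fun x => ?_
        unfold p2atom
        by_cases hx : x ∈ p2lev v N m
        · simp only [Set.indicator, hx, if_true]
          rw [← ofReal_norm, ← ofReal_norm, ENNReal.ofReal_rpow_of_nonneg (norm_nonneg _) (by linarith),
            ← ENNReal.ofReal_mul (by positivity)]
          apply ENNReal.ofReal_le_ofReal
          have hm : (2:ℝ) ^ m * N < ‖v x‖ := hx.1
          have hv0 : 0 < ‖v x‖ := lt_trans (by positivity) hm
          rw [norm_mul, Complex.norm_real, Real.norm_of_nonneg (by positivity)]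
          have e1 : ‖v x‖ ^ r = ‖v x‖ ^ (r-2) * ‖v x‖ * ‖v x‖ := by
            conv_rhs => rw [mul_assoc, ← sq, ← Real.rpow_natCast, ← Real.rpow_add hv0]
            congr 1; push_cast; ring
          have e2 : N ^ (q - r) = N ^ (q - r - 1) * N := by
            conv_rhs => rw [← Real.rpow_add_one h0.ne']
            congr 1; ring
          rw [e1, e2, Real.rpow_neg (by norm_num), Real.rpow_intCast]
          have hk : N ≤ ((2:ℝ) ^ m)⁻¹ * ‖v x‖ := by
            rw [inv_mul_eq_div, le_div_iff₀ (by positivity)]; linarith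
          calc _ = N ^ (q - r - 1) * ‖v x‖ ^ (r - 2) * ‖v x‖ * N := by ring
            _ ≤ N ^ (q - r - 1) * ‖v x‖ ^ (r - 2) * ‖v x‖ * (((2:ℝ) ^ m)⁻¹ * ‖v x‖) := by gcongr
            _ = _ := by ring
        · simp [Set.indicator, hx]
    _ = ENNReal.ofReal (2 ^ (-(m:ℝ)) * N ^ (q - r - 1)) * p2d μ v N r m := by
        rw [lintegral_const_mul _ (hv.enorm.pow_const r), p2d]
    _ = ENNReal.ofReal (2 ^ (-(m:ℝ)) * N ^ (q - r - 1) * (p2d μ v N r m).toReal) := by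
        rw [ENNReal.ofReal_mul (by positivity) (q := (p2d μ v N r m).toReal), ENNReal.ofReal_toReal hfin]
    _ ≤ _ := by
        apply ENNReal.ofReal_le_ofReal
        unfold p2c
        set d := (p2d μ v N r m).toReal
        have hd0 : 0 ≤ d := ENNReal.toReal_nonneg
        have h1 : d / N ^ r ≤ √(d / N ^ r) := by
          have h0' : 0 ≤ d / N ^ r := by positivity
          have hs := Real.sq_sqrt h0'
          have hs1 : √(d / N ^ r) ≤ 1 := Real.sqrt_le_one.2 hle1
          nlinarith [Real.sqrt_nonneg (d / N ^ r)]
        have e : N ^ (q - r - 1) * d = N ^ (q-1) * (d / N ^ r) := by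
          have : q - r - 1 = (q - 1) - r := by ring
          rw [this, Real.rpow_sub h0]; ring
        rw [mul_assoc, e]
        gcongr

lemma p2_atom_L2 {μ : Measure X} {v : X → ℂ} (hv : Measurable v) {N q r : ℝ} (hN : 0 ≤ N) (hr : 2 < r)
    (hI : ∫⁻ x, ‖v x‖ₑ ^ r ∂μ = ENNReal.ofReal (N ^ r)) (m : ℤ) :
    ∫⁻ x, ‖p2atom v N q r m x‖ₑ ^ (2:ℝ) ∂μ ≤
      ENNReal.ofReal ((2 ^ (((m:ℝ)+1) * ((r-2)/2)) * p2c μ v N q r m) ^ 2) := by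
  rcases hN.eq_or_lt with h0 | h0
  · have : p2atom v N q r m = 0 := by
      unfold p2atom; rw [p2_lev_empty h0.symm, Set.indicator_empty]; rfl
    rw [this]; simp
  have hfin := ne_top_of_le_ne_top ENNReal.ofReal_ne_top (p2_d_le hI m)
  set M : ℝ := 2 ^ (((m:ℝ)+1) * (r-2)) with hM
  calc ∫⁻ x, ‖p2atom v N q r m x‖ₑ ^ (2:ℝ) ∂μ
      ≤ ∫⁻ x in p2lev v N m, ENNReal.ofReal (M * N ^ (2 * q - r - 2)) * ‖v x‖ₑ ^ r ∂μ := by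
        rw [← lintegral_indicator (p2_lev_meas hv N m)]
        refine lintegral_mono fun x => ?_
        unfold p2atom
        by_cases hx : x ∈ p2lev v N m
        · simp only [Set.indicator, hx, if_true]
          rw [← ofReal_norm, ← ofReal_norm, ENNReal.ofReal_rpow_of_nonneg (norm_nonneg _) (by linarith),
            ENNReal.ofReal_rpow_of_nonneg (norm_nonneg _) (by linarith),
            ← ENNReal.ofReal_mul (by positivity)]
          apply ENNReal.ofReal_le_ofReal
          have hm : (2:ℝ) ^ m * N < ‖v x‖ := hx.1
          have hm2 : ‖v x‖ ≤ (2:ℝ) ^ (m+1) * N := hx.2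
          have hv0 : 0 < ‖v x‖ := lt_trans (by positivity) hm
          rw [norm_mul, Complex.norm_real, Real.norm_of_nonneg (by positivity)]
          have e1 : ‖v x‖ ^ r = ‖v x‖ ^ (r-2) * ‖v x‖ ^ 2 := by
            conv_rhs => rw [← Real.rpow_natCast, ← Real.rpow_add hv0]
            congr 1; push_cast; ring
          have e2 : N ^ (2 * q - r - 2) = (N ^ (q - r)) ^ 2 * N ^ (r - 2) := by
            rw [← Real.rpow_natCast (N ^ (q-r)), ← Real.rpow_mul h0.le, ← Real.rpow_add h0]
            congr 1; push_cast; ring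
          have hk : ‖v x‖ ^ (r-2) ≤ M * N ^ (r-2) := by
            rw [hM, Real.rpow_mul (by norm_num), ← Real.mul_rpow (by positivity) h0.le]
            apply Real.rpow_le_rpow hv0.le _ (by linarith)
            have : (2:ℝ) ^ ((m:ℝ)+1) = 2 ^ (m+1) := by
              rw [← Real.rpow_intCast]; push_cast; rfl
            rw [this]; exact hm2
          rw [e1]
          have : ((2:ℝ)) = ((2:ℕ):ℝ) := by norm_num
          calc (N ^ (q - r) * ‖v x‖ ^ (r-2) * ‖v x‖) ^ (2:ℝ) 
              = (N ^ (q - r)) ^ 2 * (‖v x‖ ^ (r-2) * ‖v x‖^2) * ‖v x‖ ^ (r-2) := by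
                rw [Real.rpow_two]; ring
            _ ≤ (N ^ (q - r)) ^ 2 * (‖v x‖ ^ (r-2) * ‖v x‖^2) * (M * N ^ (r-2)) := by gcongr
            _ = M * (N ^ (q - r)) ^ 2 * N ^ (r-2) * (‖v x‖ ^ (r-2) * ‖v x‖^2) := by ring
            _ = _ := by rw [e2]; ring
        · simp [Set.indicator, hx]
    _ = ENNReal.ofReal (M * N ^ (2 * q - r - 2)) * p2d μ v N r m := by
        rw [lintegral_const_mul _ (hv.enorm.pow_const r), p2d]
    _ = ENNReal.ofReal (M * N ^ (2 * q - r - 2) * (p2d μ v N r m).toReal) := by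
        rw [ENNReal.ofReal_mul (by positivity) (q := (p2d μ v N r m).toReal), ENNReal.ofReal_toReal hfin]
    _ ≤ _ := by
        apply ENNReal.ofReal_le_ofReal
        unfold p2c
        set d := (p2d μ v N r m).toReal
        have hd0 : 0 ≤ d := ENNReal.toReal_nonneg
        rw [mul_pow, mul_pow, Real.sq_sqrt (by positivity)]
        apply le_of_eq
        have e1 : ((2:ℝ) ^ (((m:ℝ)+1) * ((r-2)/2))) ^ 2 = M := by
          rw [hM, ← Real.rpow_natCast, ← Real.rpow_mul (by norm_num)]; congr 1; push_cast; ring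
        have e2 : (N ^ (q - 1)) ^ 2 = N ^ (2 * q - r - 2) * N ^ r := by
          rw [← Real.rpow_natCast, ← Real.rpow_mul h0.le, ← Real.rpow_add h0]; congr 1; push_cast; ring
        rw [e1, e2]
        have : N ^ r ≠ 0 := by positivity
        field_simp

end P2g

section P2h

variable {H : Type*} [NormedAddCommGroup H] [InnerProductSpace ℂ H] [CompleteSpace H]
variable {X : Type*} [MeasurableSpace X]

lemma p2_lev_meas2 {v : ℝ → X → ℂ} (hv : Measurable (Function.uncurry v)) {N : ℝ → ℝ} (hN : Measurable N)
    (m : ℤ) : MeasurableSet {p : ℝ × X | p.2 ∈ p2lev (v p.1) (N p.1) m} := by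
  have : {p : ℝ × X | p.2 ∈ p2lev (v p.1) (N p.1) m} =
    {p : ℝ × X | (2:ℝ) ^ m * N p.1 < ‖Function.uncurry v p‖} ∩
    {p : ℝ × X | ‖Function.uncurry v p‖ ≤ (2:ℝ) ^ (m+1) * N p.1} := by
    ext p; rfl
  rw [this]
  exact (measurableSet_lt (by fun_prop) (by fun_prop)).inter (measurableSet_le (by fun_prop) (by fun_prop))

lemma p2_atom_meas2 {v : ℝ → X → ℂ} (hv : Measurable (Function.uncurry v)) {N : ℝ → ℝ} (hN : Measurable N)
    (q r : ℝ) (m : ℤ) : Measurable (fun p : ℝ × X => p2atom (v p.1) (N p.1) q r m p.2) := by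
  have : (fun p : ℝ × X => p2atom (v p.1) (N p.1) q r m p.2) =
      {p : ℝ × X | p.2 ∈ p2lev (v p.1) (N p.1) m}.indicator
      (fun p => ((N p.1 ^ (q - r) * ‖Function.uncurry v p‖ ^ (r - 2) : ℝ) : ℂ) * Function.uncurry v p) := by
    ext p; rfl
  rw [this]
  refine Measurable.indicator ?_ (p2_lev_meas2 hv hN m)
  fun_prop

lemma p2_d_meas2 {μ : Measure X} [SFinite μ] {v : ℝ → X → ℂ} (hv : Measurable (Function.uncurry v))
    {N : ℝ → ℝ} (hN : Measurable N) (r : ℝ) (m : ℤ) :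
    Measurable (fun t => p2d μ (v t) (N t) r m) := by
  have : (fun t => p2d μ (v t) (N t) r m) = fun t => ∫⁻ x, 
      {p : ℝ × X | p.2 ∈ p2lev (v p.1) (N p.1) m}.indicator
      (fun p => ‖Function.uncurry v p‖ₑ ^ r) (t, x) ∂μ := by
    ext t
    unfold p2d
    have hvt : Measurable (v t) := hv.comp measurable_prodMk_left
    rw [← lintegral_indicator (p2_lev_meas hvt _ m)]
    rfl
  rw [this]
  refine Measurable.lintegral_prod_right' (f := {p : ℝ × X | p.2 ∈ p2lev (v p.1) (N p.1) m}.indicator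
      (fun p => ‖Function.uncurry v p‖ₑ ^ r)) ?_
  exact Measurable.indicator (hv.enorm.pow_const r) (p2_lev_meas2 hv hN m)

lemma p2_c_meas2 {μ : Measure X} [SFinite μ] {v : ℝ → X → ℂ} (hv : Measurable (Function.uncurry v))
    {N : ℝ → ℝ} (hN : Measurable N) (q r : ℝ) (m : ℤ) :
    Measurable (fun t => p2c μ (v t) (N t) q r m) := by
  unfold p2c
  have := p2_d_meas2 (μ := μ) hv hN r m
  fun_prop

lemma p2_c_nonneg (μ : Measure X) (v : X → ℂ) {N : ℝ} (hN : 0 ≤ N) (q r : ℝ) (m : ℤ) :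
    0 ≤ p2c μ v N q r m := by unfold p2c; positivity

theorem p2_strichartz {S q r : ℝ} (hS : 0 < S) (hq : 2 ≤ q) (hr : 2 < r) (hqr : 1/q = S * (1/2 - 1/r)) :
    ∃ C > 0, ∀ (μ : Measure X) [IsFiniteMeasure μ] (E : ℝ → X → H) (A T : ℝ),
    StronglyMeasurable (Function.uncurry E) → (∀ t x, ‖E t x‖ ≤ A) → (∀ t x, T < |t| → E t x = 0) →
    (∀ s t x x', s ≠ t → ‖inner ℂ (E s x) (E t x')‖ ≤ |t - s| ^ (-S)) →
    (∀ t (k : H), ∫⁻ x, ‖inner ℂ (E t x) k‖ₑ ^ (2:ℝ) ∂μ ≤ ‖k‖ₑ ^ (2:ℝ)) →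
    ∀ h : H, (∫⁻ t, (∫⁻ x, ‖inner ℂ (E t x) h‖ₑ ^ r ∂μ) ^ (q/r)) ^ (1/q) ≤ ENNReal.ofReal C * ‖h‖ₑ := by
  set β := (r - 2) / 2 with hβd
  have hβ : 0 < β := by rw [hβd]; linarith
  have hα : S * β / (1 + β) = 2 / q := by
    have : 2 / q = 2 * (1/q) := by ring
    rw [this, hqr, hβd]
    have hr0 : r ≠ 0 := by linarith
    rw [show 1 + (r-2)/2 = r/2 by ring]
    field_simp
  have hα1 : S * β / (1 + β) ≤ 1 := by rw [hα, div_le_one (by linarith)]; exact hq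
  obtain ⟨C, hC, hAB⟩ := p2_lemAB (H := H) hβ hS hα1
  rw [hα] at hAB
  refine ⟨(C * 2 ^ (2 * β)) ^ (1/2:ℝ), by positivity, ?_⟩
  intro μ _ E A T hEm hEA hET hdisp hen h
  set v : ℝ → X → ℂ := fun t x => inner ℂ (E t x) h with hvd
  have hvm : Measurable (Function.uncurry v) :=
    (StronglyMeasurable.inner hEm stronglyMeasurable_const).measurable
  have hvt : ∀ t, Measurable (v t) := fun t => hvm.comp measurable_prodMk_left
  have hEt : ∀ t, StronglyMeasurable (E t) := fun t => hEm.comp_measurable measurable_prodMk_left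
  have hvb : ∀ t x, ‖v t x‖ ≤ A * ‖h‖ := fun t x =>
    (norm_inner_le_norm _ _).trans (by gcongr; exact hEA t x)
  set I : ℝ → ℝ≥0∞ := fun t => ∫⁻ x, ‖v t x‖ₑ ^ r ∂μ with hId
  have hIm : Measurable I := Measurable.lintegral_prod_right' (f := fun p => ‖Function.uncurry v p‖ₑ ^ r)
    (by fun_prop)
  set M0 : ℝ≥0∞ := ENNReal.ofReal (A * ‖h‖) ^ r * μ Set.univ with hM0
  have hM0f : M0 ≠ ∞ := ENNReal.mul_ne_top (ENNReal.rpow_ne_top_of_nonneg (by linarith) ENNReal.ofReal_ne_top)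
    (measure_ne_top _ _)
  have hIb : ∀ t, I t ≤ M0 := by
    intro t
    refine (lintegral_mono (g := fun _ => ENNReal.ofReal (A * ‖h‖) ^ r) fun x => ?_).trans ?_
    · simp only
      gcongr
      rw [← ofReal_norm]; exact ENNReal.ofReal_le_ofReal (hvb t x)
    · rw [lintegral_const]
  have hIf : ∀ t, I t ≠ ∞ := fun t => ne_top_of_le_ne_top hM0f (hIb t)
  set N : ℝ → ℝ := fun t => (I t).toReal ^ (1/r) with hNd
  have hN0 : ∀ t, 0 ≤ N t := fun t => by positivity
  have hNm : Measurable N := by fun_prop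
  have hNr : ∀ t, N t ^ r = (I t).toReal := by
    intro t
    simp only [hNd]
    rw [← Real.rpow_mul ENNReal.toReal_nonneg, one_div_mul_cancel (by linarith), Real.rpow_one]
  have hIN : ∀ t, I t = ENNReal.ofReal (N t ^ r) := fun t => by rw [hNr, ENNReal.ofReal_toReal (hIf t)]
  set M : ℝ := M0.toReal ^ (1/r) with hMd
  have hNM : ∀ t, N t ≤ M := by
    intro t
    exact Real.rpow_le_rpow ENNReal.toReal_nonneg (ENNReal.toReal_mono hM0f (hIb t)) (by positivity)
  have hNT : ∀ t, T < |t| → N t = 0 := by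
    intro t ht
    have : I t = 0 := by
      simp only [hId, hvd, hET t _ ht, inner_zero_left]
      simp [show 0 < r by linarith]
    simp only [hNd, this]
    simp [show r ≠ 0 by linarith]
  -- atoms
  have hat1 := fun t m => p2_atom_L1 (q := q) (hvt t) (hN0 t) hr (hIN t) m
  have hat2 := fun t m => p2_atom_L2 (q := q) (hvt t) (hN0 t) hr (hIN t) m
  have hatm := fun t m => p2_atom_meas (hvt t) (N t) q r m
  have hc0 := fun t m => p2_c_nonneg μ (v t) (hN0 t) q r m
  have hati : ∀ t m, Integrable (fun x => p2atom (v t) (N t) q r m x) μ := fun t m =>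
    ⟨(hatm t m).aestronglyMeasurable, lt_of_le_of_lt (hat1 t m) ENNReal.ofReal_lt_top⟩
  have hatE : ∀ t m, Integrable (fun x => p2atom (v t) (N t) q r m x • E t x) μ := by
    intro t m
    refine ((hati t m).norm.mul_const A).mono'
      ((hatm t m).aestronglyMeasurable.smul (hEt t).aestronglyMeasurable)
      (Filter.Eventually.of_forall fun x => ?_)
    rw [norm_smul]; gcongr; exact hEA t x
  set w : ℤ → ℝ → H := fun m t => ∫ x, p2atom (v t) (N t) q r m x • E t x ∂μ with hwd
  have hwm : ∀ m, StronglyMeasurable (w m) := by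
    intro m
    exact StronglyMeasurable.integral_prod_right' (f := fun p : ℝ × X =>
      p2atom (v p.1) (N p.1) q r m p.2 • Function.uncurry E p)
      ((p2_atom_meas2 hvm hNm q r m).stronglyMeasurable.smul hEm)
  have hwn : ∀ m t, ‖w m t‖ ≤ 2 ^ (((m:ℝ)+1) * β) * p2c μ (v t) (N t) q r m := by
    intro m t
    have h1 := (p2_st6 (hatm t m) (hEt t) (hatE t m) (hen t)).trans (hat2 t m)
    rw [← ofReal_norm, ENNReal.ofReal_rpow_of_nonneg (norm_nonneg _) (by norm_num)] at h1
    have h2 := (ENNReal.ofReal_le_ofReal_iff (sq_nonneg _)).1 h1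
    rw [Real.rpow_two] at h2
    exact le_of_sq_le_sq h2 (mul_nonneg (by positivity) (hc0 t m))
  have hcN : ∀ t m, p2c μ (v t) (N t) q r m ≤ N t ^ (q - 1) := by
    intro t m
    have := p2_c_sum (q := q) (hvt t) (hN0 t) hr (hIN t) {m}
    simp only [Finset.sum_singleton] at this
    exact le_of_sq_le_sq this (Real.rpow_nonneg (hN0 t) _)
  have hwi : ∀ m, Integrable (w m) := by
    intro m
    have h1 : IntegrableOn (w m) (Set.Icc (-T) T) := by
      refine Measure.integrableOn_of_bounded (M := 2 ^ (((m:ℝ)+1) * β) * M ^ (q-1)) (by simp)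
        (hwm m).aestronglyMeasurable (Filter.Eventually.of_forall fun t => ?_)
      refine (hwn m t).trans ?_
      gcongr
      exact (hcN t m).trans (Real.rpow_le_rpow (hN0 t) (hNM t) (by linarith))
    refine h1.integrable_of_forall_notMem_eq_zero fun t ht => ?_
    have : T < |t| := by
      by_contra hc
      exact ht (Set.mem_Icc.2 (abs_le.1 (not_lt.1 hc)))
    simp only [hwd, hET t _ this, smul_zero, integral_zero]
  set c : ℤ → ℝ → ℝ := fun m t => 2 ^ β * p2c μ (v t) (N t) q r m with hcd
  set φ : ℝ → ℝ := fun t => 2 ^ β * N t ^ (q - 1) with hφd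
  have hq1 : 0 < q - 1 := by linarith
  have hpq : (2:ℝ) / (2 - 2 / q) = q / (q - 1) := by
    have : 2 - 2 / q = 2 * (q - 1) / q := by field_simp
    rw [this]; field_simp
  set Q : ℝ≥0∞ := ∫⁻ t, ENNReal.ofReal (N t ^ q) with hQd
  have hQfin : Q ≠ ∞ := by
    have : Q ≤ ∫⁻ t in Set.Icc (-T) T, ENNReal.ofReal (M ^ q) := by
      rw [← lintegral_indicator measurableSet_Icc]
      refine lintegral_mono fun t => ?_
      by_cases ht : t ∈ Set.Icc (-T) T
      · simp only [Set.indicator, ht, if_true]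
        exact ENNReal.ofReal_le_ofReal (Real.rpow_le_rpow (hN0 t) (hNM t) (by linarith))
      · have : T < |t| := by
          by_contra hc
          exact ht (Set.mem_Icc.2 (abs_le.1 (not_lt.1 hc)))
        simp [hNT t this, show q ≠ 0 by linarith]
    refine ne_top_of_le_ne_top ?_ this
    rw [setLIntegral_const, Real.volume_Icc]
    exact ENNReal.mul_ne_top ENNReal.ofReal_ne_top ENNReal.ofReal_ne_top
  have hφQ : ∫⁻ s, ENNReal.ofReal (φ s) ^ (2 / (2 - 2 / q)) = ENNReal.ofReal ((2 ^ β) ^ (q / (q-1))) * Q := by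
    rw [hQd, ← lintegral_const_mul _ (by fun_prop), hpq]
    refine lintegral_congr fun t => ?_
    simp only [hφd]
    have := hN0 t
    rw [ENNReal.ofReal_rpow_of_nonneg (by positivity) (by positivity), ← ENNReal.ofReal_mul (by positivity),
      Real.mul_rpow (by positivity) (by positivity), ← Real.rpow_mul (hN0 t), mul_div_cancel₀ _ hq1.ne']
  have h2β : (1:ℝ) ≤ 2 ^ β := Real.one_le_rpow (by norm_num) hβ.le
  have hwc : ∀ m t, ‖w m t‖ ≤ 2 ^ (m * β) * c m t := by
    intro m t
    refine (hwn m t).trans (le_of_eq ?_)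
    rw [add_mul, one_mul, Real.rpow_add (by norm_num)]; simp only [hcd]; ring
  have hbd2 : ∀ (m l : ℤ) (s t : ℝ), ‖inner ℂ (w m s) (w l t)‖ ≤ 2 ^ (((m:ℝ)+l) * β) * c m s * c l t := by
    intro m l s t
    refine (norm_inner_le_norm _ _).trans ?_
    calc _ ≤ (2 ^ (m * β) * c m s) * (2 ^ (l * β) * c l t) :=
          mul_le_mul (hwc m s) (hwc l t) (norm_nonneg _) (mul_nonneg (by positivity)
            (mul_nonneg (by positivity) (hc0 s m)))
      _ = _ := by rw [add_mul, Real.rpow_add (by norm_num)]; ring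
  have hbd1 : ∀ (m l : ℤ) (s t : ℝ), s ≠ t →
      ‖inner ℂ (w m s) (w l t)‖ ≤ |t - s| ^ (-S) * 2 ^ (-((m:ℝ)+l)) * c m s * c l t := by
    intro m l s t hst
    have h1 := p2_st5 (hatm s m) (hatm t l) (hatE s m) (hatE t l) (fun x x' => hdisp s t x x' hst)
    have h2 := h1.trans (mul_le_mul' (mul_le_mul' le_rfl (hat1 s m)) (hat1 t l))
    have p1 := hc0 s m
    have p2 := hc0 t l
    rw [← ofReal_norm, ← ENNReal.ofReal_mul (by positivity), ← ENNReal.ofReal_mul (by positivity)] at h2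
    have h3 := (ENNReal.ofReal_le_ofReal_iff (by positivity)).1 h2
    refine h3.trans ?_
    simp only [hcd]
    have q1 : p2c μ (v s) (N s) q r m ≤ 2 ^ β * p2c μ (v s) (N s) q r m := le_mul_of_one_le_left p1 h2β
    have q2 : p2c μ (v t) (N t) q r l ≤ 2 ^ β * p2c μ (v t) (N t) q r l := le_mul_of_one_le_left p2 h2β
    have e : (2:ℝ) ^ (-((m:ℝ)+l)) = 2 ^ (-(m:ℝ)) * 2 ^ (-(l:ℝ)) := by
      rw [← Real.rpow_add (by norm_num)]; congr 1; ring
    rw [e]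
    calc _ = |t - s| ^ (-S) * (2 ^ (-(m:ℝ)) * 2 ^ (-(l:ℝ))) * p2c μ (v s) (N s) q r m * p2c μ (v t) (N t) q r l := by ring
      _ ≤ _ := by gcongr
  have hmain : ∀ K : Finset ℤ, ‖∫ s, ∑ m ∈ K, w m s‖ₑ ^ (2:ℝ) ≤ ENNReal.ofReal C *
      (ENNReal.ofReal ((2 ^ β) ^ (q / (q-1))) * Q) ^ (2 - 2/q) := by
    intro K
    rw [← hφQ]
    refine hAB K w c φ hwi ?_ ?_ ?_ ?_ ?_ ?_ ?_ hbd2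
    · exact fun m s => mul_nonneg (by positivity) (hc0 s m)
    · intro m
      have := p2_c_meas2 (μ := μ) hvm hNm q r m
      fun_prop
    · intro s; have := hN0 s; positivity
    · fun_prop
    · rw [hφQ]; exact ENNReal.mul_ne_top ENNReal.ofReal_ne_top hQfin
    · intro s
      simp only [hcd, hφd, mul_pow]
      rw [← Finset.mul_sum]
      gcongr
      exact p2_c_sum (hvt s) (hN0 s) hr (hIN s) K
    · intro m l s t hst
      have p1 : 0 ≤ c m s := mul_nonneg (by positivity) (hc0 s m)
      have p2 : 0 ≤ c l t := mul_nonneg (by positivity) (hc0 t l)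
      unfold p2ker
      have b1 := hbd1 m l s t hst
      have b2 := hbd2 m l s t
      clear_value c
      rw [mul_assoc, min_mul_of_nonneg _ _ (mul_nonneg p1 p2), ← mul_assoc, ← mul_assoc]
      exact le_min b1 b2
  -- pairing
  have hpair : ∀ m t, inner ℂ (w m t) h = ((N t ^ (q - r) * (p2d μ (v t) (N t) r m).toReal : ℝ) : ℂ) := by
    intro m t
    simp only [hwd]
    rw [p2_st7 (hatE t m)]
    have e : ∀ x, (starRingEnd ℂ) (p2atom (v t) (N t) q r m x) * inner ℂ (E t x) h =
        ((N t ^ (q - r) * ((p2lev (v t) (N t) m).indicator (fun x => ‖v t x‖ ^ r) x) : ℝ) : ℂ) := by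
      intro x
      unfold p2atom
      by_cases hx : x ∈ p2lev (v t) (N t) m
      · simp only [Set.indicator, hx, if_true, map_mul, Complex.conj_ofReal]
        have hv0 : 0 < ‖v t x‖ := lt_of_le_of_lt (mul_nonneg (by positivity) (hN0 t)) hx.1
        have e1 : ‖v t x‖ ^ r = ‖v t x‖ ^ (r-2) * ‖v t x‖ ^ 2 := by
          conv_rhs => rw [← Real.rpow_natCast, ← Real.rpow_add hv0]
          congr 1; push_cast; ring
        rw [mul_assoc, show inner ℂ (E t x) h = v t x from rfl, Complex.conj_mul', e1]
        push_cast; ring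
      · simp [Set.indicator, hx]
    simp_rw [e]
    rw [integral_complex_ofReal, integral_const_mul, integral_indicator (p2_lev_meas (hvt t) _ _)]
    congr 3
    unfold p2d
    rw [integral_eq_lintegral_of_nonneg_ae (Filter.Eventually.of_forall fun x => by positivity)
      ((hvt t).norm.pow_const r).aestronglyMeasurable]
    congr 1
    refine lintegral_congr fun x => ?_
    rw [← ofReal_norm, ENNReal.ofReal_rpow_of_nonneg (norm_nonneg _) (by linarith)]
  have hdf : ∀ t m, p2d μ (v t) (N t) r m ≠ ∞ := fun t m =>
    ne_top_of_le_ne_top ENNReal.ofReal_ne_top (p2_d_le (hIN t) m)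
  have hQK : ∀ K : Finset ℤ, ∑ m ∈ K, ∫⁻ t, ENNReal.ofReal (N t ^ (q - r)) * p2d μ (v t) (N t) r m ≤
      ‖∫ s, ∑ m ∈ K, w m s‖ₑ * ‖h‖ₑ := by
    intro K
    have hre : ∀ m, Integrable (fun t => N t ^ (q - r) * (p2d μ (v t) (N t) r m).toReal) := by
      intro m
      have : Integrable (fun t => inner ℂ h (w m t)) := (hwi m).const_inner h
      refine this.re.congr (Filter.Eventually.of_forall fun t => ?_)
      simp only
      rw [← inner_conj_symm, hpair]
      simp
    have e1 : ∑ m ∈ K, ∫⁻ t, ENNReal.ofReal (N t ^ (q - r)) * p2d μ (v t) (N t) r m =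
        ENNReal.ofReal (∑ m ∈ K, ∫ t, N t ^ (q - r) * (p2d μ (v t) (N t) r m).toReal) := by
      have nn : ∀ m t, 0 ≤ N t ^ (q - r) * (p2d μ (v t) (N t) r m).toReal := fun m t => by
        have := hN0 t
        positivity
      rw [ENNReal.ofReal_sum_of_nonneg fun m _ => integral_nonneg (nn m)]
      refine Finset.sum_congr rfl fun m _ => ?_
      rw [ofReal_integral_eq_lintegral_ofReal (hre m) (Filter.Eventually.of_forall (nn m))]
      refine lintegral_congr fun t => ?_
      have := hN0 t
      rw [ENNReal.ofReal_mul (by positivity), ENNReal.ofReal_toReal (hdf t m)]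
    have e2 : inner ℂ h (∫ s, ∑ m ∈ K, w m s) =
        ((∑ m ∈ K, ∫ t, N t ^ (q - r) * (p2d μ (v t) (N t) r m).toReal : ℝ) : ℂ) := by
      rw [integral_finsetSum _ fun m _ => hwi m, inner_sum, Complex.ofReal_sum]
      refine Finset.sum_congr rfl fun m _ => ?_
      rw [← integral_inner (hwi m), ← integral_complex_ofReal]
      refine integral_congr_ae (Filter.Eventually.of_forall fun t => ?_)
      simp only
      rw [← inner_conj_symm, hpair, Complex.conj_ofReal]
    rw [e1, ← ofReal_norm, ← ofReal_norm, ← ENNReal.ofReal_mul (norm_nonneg _)]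
    apply ENNReal.ofReal_le_ofReal
    refine (le_abs_self _).trans ?_
    rw [← Real.norm_eq_abs, ← Complex.norm_real, ← e2, mul_comm]
    exact norm_inner_le_norm _ _
  have hQle : Q ≤ (ENNReal.ofReal C *
      (ENNReal.ofReal ((2 ^ β) ^ (q / (q-1))) * Q) ^ (2 - 2/q)) ^ (1/2:ℝ) * ‖h‖ₑ := by
    have e : Q = ∑' m, ∫⁻ t, ENNReal.ofReal (N t ^ (q - r)) * p2d μ (v t) (N t) r m := by
      rw [← lintegral_tsum]
      · refine lintegral_congr fun t => ?_
        rw [ENNReal.tsum_mul_left, p2_d_tsum (hvt t) (hN0 t) hr (hIN t)]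
        rcases (hN0 t).eq_or_lt with h0 | h0
        · rw [← h0, Real.zero_rpow (show q ≠ 0 by linarith), Real.zero_rpow (show r ≠ 0 by linarith)]; simp
        · rw [← ENNReal.ofReal_mul (by positivity), ← Real.rpow_add h0]; congr 2; ring
      · intro m
        have := p2_d_meas2 (μ := μ) hvm hNm r m
        fun_prop
    refine e.le.trans ?_
    rw [ENNReal.tsum_eq_iSup_sum]
    refine iSup_le fun K => (hQK K).trans ?_
    gcongr
    rw [one_div, ENNReal.le_rpow_inv_iff (by norm_num)]
    exact hmain K
  have hfinal : Q ^ (1/q) ≤ ENNReal.ofReal ((C * 2 ^ (2 * β)) ^ (1/2:ℝ)) * ‖h‖ₑ := by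
    rcases eq_or_ne Q 0 with h0 | h0
    · rw [h0, ENNReal.zero_rpow_of_pos (by positivity)]; simp
    have e : (ENNReal.ofReal C * (ENNReal.ofReal ((2 ^ β) ^ (q / (q-1))) * Q) ^ (2 - 2/q)) ^ (1/2:ℝ)
        = ENNReal.ofReal ((C * 2 ^ (2 * β)) ^ (1/2:ℝ)) * Q ^ (1 - 1/q) := by
      have h22 : 0 ≤ 2 - 2/q := by
        rw [sub_nonneg, div_le_iff₀ (by linarith)]; linarith
      rw [ENNReal.mul_rpow_of_nonneg _ _ h22, ENNReal.mul_rpow_of_nonneg _ _ (by norm_num),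
        ENNReal.mul_rpow_of_nonneg _ _ (by norm_num), ← ENNReal.rpow_mul Q, ← mul_assoc]
      congr 1
      · rw [ENNReal.ofReal_rpow_of_nonneg (by positivity) h22, ENNReal.ofReal_rpow_of_nonneg (by positivity) (by norm_num),
          ENNReal.ofReal_rpow_of_nonneg (by positivity) (by norm_num), ← ENNReal.ofReal_mul (by positivity),
          ← Real.mul_rpow (by positivity) (by positivity)]
        congr 3
        rw [← Real.rpow_mul (by positivity), ← Real.rpow_mul (by positivity)]
        congr 1
        field_simp
      · congr 1; ring
    rw [e] at hQle
    have e3 : Q = Q ^ (1 - 1/q) * Q ^ (1/q) := by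
      rw [← ENNReal.rpow_add _ _ h0 hQfin]; simp
    have hne : Q ^ (1 - 1/q) ≠ 0 := by
      have := ENNReal.rpow_pos (p := 1 - 1/q) (pos_iff_ne_zero.2 h0) hQfin
      exact this.ne'
    have hnt : Q ^ (1 - 1/q) ≠ ∞ := ENNReal.rpow_ne_top_of_nonneg (by
        rw [sub_nonneg, div_le_iff₀ (by linarith)]; linarith) hQfin
    rw [← ENNReal.mul_le_mul_iff_right hne hnt, ← e3]
    refine hQle.trans (le_of_eq ?_)
    ring
  refine le_trans (le_of_eq ?_) hfinal
  congr 1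
  refine lintegral_congr fun t => ?_
  change I t ^ (q/r) = _
  rw [hIN, ENNReal.ofReal_rpow_of_nonneg (Real.rpow_nonneg (hN0 t) _) (by positivity), ← Real.rpow_mul (hN0 t)]
  congr 2; field_simp

end P2h

section P3a

variable {V : Type*} [NormedAddCommGroup V] [InnerProductSpace ℝ V] [FiniteDimensional ℝ V]
  [MeasurableSpace V] [BorelSpace V]

/-- The mixed norm on `ℝ × V`. -/
def p3M (q r : ℝ) (F : ℝ → V → ℂ) : ℝ≥0∞ := (∫⁻ t, (∫⁻ x, ‖F t x‖ₑ ^ r) ^ (q/r)) ^ (1/q)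

lemma p3_mono {f : ℝ → V → ℝ≥0∞} (hf : Measurable (Function.uncurry f)) {a : ℝ} (ha : 0 < a) {B : ℝ≥0∞}
    (h : ∀ k : ℕ, ∫⁻ t in Set.Icc (-(k:ℝ)) k, (∫⁻ x in ball 0 (k:ℝ), f t x) ^ a ≤ B) :
    ∫⁻ t, (∫⁻ x, f t x) ^ a ≤ B := by
  set g : ℕ → ℝ → ℝ≥0∞ := fun k => (Set.Icc (-(k:ℝ)) k).indicator
    (fun t => (∫⁻ x in ball 0 (k:ℝ), f t x) ^ a) with hg
  have hgm : ∀ k, Measurable (g k) := fun k =>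
    Measurable.indicator ((Measurable.lintegral_prod_right' hf).pow_const a) measurableSet_Icc
  have hlim : ∀ t, Filter.Tendsto (fun k => g k t) Filter.atTop (nhds ((∫⁻ x, f t x) ^ a)) := by
    intro t
    have h1 : Filter.Tendsto (fun k : ℕ => ∫⁻ x in ball 0 (k:ℝ), f t x) Filter.atTop (nhds (∫⁻ x, f t x)) :=
      (aecover_ball (μ := volume) (x := (0:V)) tendsto_natCast_atTop_atTop).lintegral_tendsto_of_countably_generated
        (hf.comp measurable_prodMk_left).aemeasurable
    have h2 := ((ENNReal.continuous_rpow_const (y := a)).tendsto (∫⁻ x, f t x)).comp h1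
    refine h2.congr' ?_
    obtain ⟨k0, hk0⟩ := exists_nat_ge |t|
    filter_upwards [Filter.eventually_ge_atTop k0] with k hk
    have : t ∈ Set.Icc (-(k:ℝ)) k := by
      have : |t| ≤ k := hk0.trans (by exact_mod_cast hk)
      exact Set.mem_Icc.2 (abs_le.1 this)
    simp only [hg, Set.indicator, this, if_true, Function.comp]
  calc ∫⁻ t, (∫⁻ x, f t x) ^ a = ∫⁻ t, Filter.liminf (fun k => g k t) Filter.atTop :=
        lintegral_congr fun t => (hlim t).liminf_eq.symm
    _ ≤ Filter.liminf (fun k => ∫⁻ t, g k t) Filter.atTop := lintegral_liminf_le hgm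
    _ ≤ B := by
        refine Filter.liminf_le_of_frequently_le' (Filter.Frequently.of_forall fun k => ?_)
        simp only [hg]
        rw [lintegral_indicator measurableSet_Icc]
        exact h k

/-- The damped half wave plane wave. -/
def p3e (y t : ℝ) (x ξ : V) : ℂ := cexp (-(↑(2 * Real.pi * inner ℝ ξ x) * I)) * cexp (-(y + t * I) * ‖ξ‖)

lemma p3e_cont (y : ℝ) : Continuous (fun p : ℝ × V × V => p3e y p.1 p.2.1 p.2.2) := by
  unfold p3e; fun_prop

lemma p3e_norm (y t : ℝ) (x ξ : V) : ‖p3e y t x ξ‖ = Real.exp (-y * ‖ξ‖) := by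
  unfold p3e
  rw [norm_mul, Complex.norm_exp, Complex.norm_exp]
  simp

lemma p3e_memLp [Nontrivial V] {y : ℝ} (hy : 0 < y) (t : ℝ) (x : V) : MemLp (p3e y t x) 2 := by
  have hm : AEStronglyMeasurable (p3e y t x) volume :=
    (by unfold p3e; fun_prop : Continuous (p3e y t x)).aestronglyMeasurable
  rw [memLp_two_iff_integrable_sq_norm hm]
  refine (p1_exp_integrable (V := V) (b := 2 * y) (by positivity)).congr (Filter.Eventually.of_forall fun ξ => ?_)
  simp only
  rw [p3e_norm, ← Real.exp_nat_mul]; congr 1; push_cast; ring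

lemma p3e_inner (y s t : ℝ) (x x' ξ : V) : inner ℂ (p3e y s x ξ) (p3e y t x' ξ) =
    cexp (↑(2 * Real.pi * inner ℝ ξ (x - x')) * I) * cexp (-((2*y : ℝ) + (t - s : ℝ) * I) * ‖ξ‖) := by
  unfold p3e
  simp only [RCLike.inner_apply, map_mul, ← Complex.exp_conj, ← Complex.exp_add, map_neg, map_add,
    Complex.conj_ofReal, Complex.conj_I]
  congr 1
  rw [inner_sub_right]
  push_cast; ring

/-- as an element of `L²`. -/
def p3E [Nontrivial V] {y : ℝ} (hy : 0 < y) (t : ℝ) (x : V) : Lp ℂ 2 (volume : Measure V) :=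
  (p3e_memLp hy t x).toLp _

lemma p3E_inner [Nontrivial V] {y : ℝ} (hy : 0 < y) (s t : ℝ) (x x' : V) :
    inner ℂ (p3E hy s x) (p3E hy t x') =
    ∫ ξ : V, cexp (↑(2 * Real.pi * inner ℝ ξ (x - x')) * I) * cexp (-((2*y : ℝ) + (t - s : ℝ) * I) * ‖ξ‖) := by
  rw [L2.inner_def]
  refine integral_congr_ae ?_
  filter_upwards [(p3e_memLp hy s x).coeFn_toLp, (p3e_memLp hy t x').coeFn_toLp] with ξ h1 h2
  rw [p3E, p3E, h1, h2, p3e_inner]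

lemma p3E_inner' [Nontrivial V] {y : ℝ} (hy : 0 < y) (t : ℝ) (x : V) (k : Lp ℂ 2 (volume : Measure V)) :
    inner ℂ (p3E hy t x) k = 𝓕⁻ (fun ξ : V => cexp (-(y - t * I) * ‖ξ‖) * k ξ) x := by
  rw [L2.inner_def, Real.fourierInv_eq']
  refine integral_congr_ae ?_
  filter_upwards [(p3e_memLp hy t x).coeFn_toLp] with ξ h1
  rw [p3E, h1, p3e]
  simp only [RCLike.inner_apply, map_mul, ← Complex.exp_conj, map_neg, map_add,
    Complex.conj_ofReal, Complex.conj_I, smul_eq_mul]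
  rw [neg_mul_eq_mul_neg, neg_neg, mul_neg, mul_comm, ← sub_eq_add_neg, mul_assoc]

lemma p3E_norm [Nontrivial V] {y : ℝ} (hy : 0 < y) (t : ℝ) (x : V) :
    ‖p3E hy t x‖ ^ 2 = (∫ ξ : V, cexp (-((2*y : ℝ)) * ‖ξ‖)).re := by
  have h := p3E_inner hy t t x x
  rw [@norm_sq_eq_re_inner ℂ, h]
  simp

lemma p3E_cont [Nontrivial V] {y : ℝ} (hy : 0 < y) : Continuous (fun p : ℝ × V => p3E hy p.1 p.2) := by
  rw [continuous_iff_continuousAt]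
  intro p0
  rw [ContinuousAt, tendsto_iff_norm_sub_tendsto_zero]
  have hc : Continuous (fun p : ℝ × V => inner ℂ (p3E hy p.1 p.2) (p3E hy p0.1 p0.2)) := by
    simp only [p3E_inner]
    refine continuous_of_dominated (bound := fun ξ : V => Real.exp (-(2*y) * ‖ξ‖)) ?_ ?_ ?_ ?_
    · intro p; exact Continuous.aestronglyMeasurable (by fun_prop)
    · intro p; refine Filter.Eventually.of_forall fun ξ => ?_
      rw [norm_mul, Complex.norm_exp, Complex.norm_exp]
      simp
    · exact p1_exp_integrable (by positivity)
    · refine Filter.Eventually.of_forall fun ξ => ?_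
      fun_prop
  have hsq : Filter.Tendsto (fun p : ℝ × V => ‖p3E hy p.1 p.2 - p3E hy p0.1 p0.2‖ ^ 2) (nhds p0) (nhds 0) := by
    have e : ∀ p : ℝ × V, ‖p3E hy p.1 p.2 - p3E hy p0.1 p0.2‖ ^ 2 =
        2 * ‖p3E hy p0.1 p0.2‖ ^ 2 - 2 * (inner ℂ (p3E hy p.1 p.2) (p3E hy p0.1 p0.2)).re := by
      intro p
      rw [@norm_sub_sq ℂ, p3E_norm hy p.1 p.2, ← p3E_norm hy p0.1 p0.2]
      simp only [RCLike.re_to_complex]; ring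
    simp_rw [e]
    have : Continuous (fun p : ℝ × V => 2 * ‖p3E hy p0.1 p0.2‖ ^ 2 - 2 * (inner ℂ (p3E hy p.1 p.2) (p3E hy p0.1 p0.2)).re) := by
      fun_prop
    have h2 := this.tendsto p0
    convert h2 using 2
    have h3 := e p0
    rw [sub_self, norm_zero] at h3
    rw [← h3]; simp
  have := (Real.continuous_sqrt.tendsto 0).comp hsq
  rw [Real.sqrt_zero] at this
  refine this.congr fun p => ?_
  simp [Function.comp, Real.sqrt_sq]

lemma p3_prod_int [Nontrivial V] {y : ℝ} (hy : 0 < y) (t : ℝ) {k : V → ℂ} (hk : MemLp k 2) :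
    Integrable (fun ξ : V => cexp (-(y - t * I) * ‖ξ‖) * k ξ) := by
  have h1 : MemLp (fun ξ : V => cexp (-(y - t * I) * ‖ξ‖)) 2 := by
    refine (p3e_memLp hy (-t) (0:V)).congr_norm (Continuous.aestronglyMeasurable (by fun_prop))
      (Filter.Eventually.of_forall fun ξ => ?_)
    rw [p3e_norm, Complex.norm_exp]; simp
  exact h1.integrable_mul hk

lemma p3_prod_L2 {y : ℝ} (hy : 0 < y) (t : ℝ) {k : V → ℂ} (hk : MemLp k 2) :
    MemLp (fun ξ : V => cexp (-(y - t * I) * ‖ξ‖) * k ξ) 2 ∧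
    eLpNorm (fun ξ : V => cexp (-(y - t * I) * ‖ξ‖) * k ξ) 2 ≤ eLpNorm k 2 := by
  have hm : AEStronglyMeasurable (fun ξ : V => cexp (-(y - t * I) * ‖ξ‖) * k ξ) volume :=
    (Continuous.aestronglyMeasurable (by fun_prop)).mul hk.1
  have hb : ∀ ξ : V, ‖cexp (-(y - t * I) * ‖ξ‖) * k ξ‖ ≤ ‖k ξ‖ := by
    intro ξ
    rw [norm_mul, Complex.norm_exp]
    refine mul_le_of_le_one_left (norm_nonneg _) ?_
    simp
    positivity
  exact ⟨hk.mono hm (Filter.Eventually.of_forall hb), eLpNorm_mono hb⟩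

end P3a

section P3b

variable {V : Type*} [NormedAddCommGroup V] [InnerProductSpace ℝ V] [FiniteDimensional ℝ V]
  [MeasurableSpace V] [BorelSpace V]

lemma p3_finv_congr {f g : V → ℂ} (h : f =ᵐ[volume] g) : 𝓕⁻ f = 𝓕⁻ g := by
  ext x
  rw [Real.fourierInv_eq', Real.fourierInv_eq']
  refine integral_congr_ae ?_
  filter_upwards [h] with ξ hξ
  rw [hξ]

lemma p3E_inner'' [Nontrivial V] {y : ℝ} (hy : 0 < y) (t : ℝ) (x : V) {k : V → ℂ} (hk : MemLp k 2) :
    inner ℂ (p3E hy t x) (hk.toLp k) = 𝓕⁻ (fun ξ : V => cexp (-(y - t * I) * ‖ξ‖) * k ξ) x := by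
  rw [p3E_inner']
  refine congrFun (p3_finv_congr ?_) x
  filter_upwards [hk.coeFn_toLp] with ξ h
  rw [h]

lemma p3_energy [Nontrivial V] {y : ℝ} (hy : 0 < y) (t : ℝ) (k : Lp ℂ 2 (volume : Measure V)) :
    ∫⁻ x, ‖inner ℂ (p3E hy t x) k‖ₑ ^ (2:ℝ) ≤ ‖k‖ₑ ^ (2:ℝ) := by
  have hk := Lp.memLp k
  have h1 := p0_plancherel (p3_prod_int hy t hk) (p3_prod_L2 hy t hk).1
  have h2 := (p3_prod_L2 hy t hk).2
  rw [← h1, eLpNorm_eq_lintegral_rpow_enorm_toReal (by norm_num) (by norm_num)] at h2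
  simp only [ENNReal.toReal_ofNat] at h2
  rw [one_div, ENNReal.rpow_inv_le_iff (by norm_num)] at h2
  simp_rw [p3E_inner']
  refine h2.trans (le_of_eq ?_)
  rw [Lp.enorm_def]

set_option maxHeartbeats 800000 in
theorem p3_poisson [Nontrivial V] {q r : ℝ} (hd : 2 ≤ Module.finrank ℝ V) (hq : 2 ≤ q) (hr : 2 < r)
    (hqr : 1/q = (((Module.finrank ℝ V : ℝ) - 1)/2) * (1/2 - 1/r)) :
    ∃ C > (0:ℝ), ∀ y > (0:ℝ), ∀ k : V → ℂ, MemLp k 2 →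
      p3M q r (fun t x => 𝓕⁻ (fun ξ : V => cexp (-(y - t * I) * ‖ξ‖) * k ξ) x) ≤
      ENNReal.ofReal (C * y ^ (-(((Module.finrank ℝ V : ℝ)+1)/2) * (1/2 - 1/r))) * eLpNorm k 2 := by
  have hd' : (2:ℝ) ≤ Module.finrank ℝ V := by exact_mod_cast hd
  set d : ℝ := (Module.finrank ℝ V : ℝ) with hdd
  obtain ⟨C1, hC1, hdisp⟩ := p1_disp V
  obtain ⟨C2, hC2, hst⟩ := p2_strichartz (H := Lp ℂ 2 (volume : Measure V)) (X := V)
    (S := (d - 1)/2) (by linarith) hq hr hqr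
  have hθ : 0 < 1/2 - 1/r := by
    rw [sub_pos]; exact one_div_lt_one_div_of_lt (by norm_num) hr
  set θ := 1/2 - 1/r with hθd
  have hr0 : 0 < r := by linarith
  have hq0 : 0 < q := by linarith
  refine ⟨(C1 * 2 ^ (-((d+1)/2))) ^ θ * C2, by positivity, ?_⟩
  intro y hy k hk
  set D : ℝ := C1 * (2*y) ^ (-((d+1)/2)) with hD
  have hD0 : 0 < D := by positivity
  set a : ℝ := D ^ (-(1/2) : ℝ) with had
  have ha0 : 0 < a := by positivity
  have haD : a * a * D = 1 := by
    rw [had, ← Real.rpow_add hD0]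
    norm_num
    rw [Real.rpow_neg_one]; field_simp
  set F : ℝ → V → ℂ := fun t x => 𝓕⁻ (fun ξ : V => cexp (-(y - t * I) * ‖ξ‖) * k ξ) x with hF
  have hFE : ∀ t x, F t x = inner ℂ (p3E hy t x) (hk.toLp k) := fun t x => (p3E_inner'' hy t x hk).symm
  have hFc : Continuous (Function.uncurry F) := by
    have : Function.uncurry F = fun p : ℝ × V => inner ℂ (p3E hy p.1 p.2) (hk.toLp k) := by
      ext p; exact hFE p.1 p.2
    rw [this]
    exact (p3E_cont hy).inner continuous_const
  have hkn : ‖hk.toLp k‖ₑ = eLpNorm k 2 := by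
    rw [Lp.enorm_toLp]
  have hmain : ∫⁻ t, (∫⁻ x, ‖F t x‖ₑ ^ r) ^ (q/r) ≤
      ENNReal.ofReal (D ^ (q * θ)) * (ENNReal.ofReal C2 * eLpNorm k 2) ^ q := by
    refine p3_mono (f := fun t x => ‖F t x‖ₑ ^ r) (hFc.measurable.enorm.pow_const r) (by positivity) fun T => ?_
    set μ : Measure V := ENNReal.ofReal D • (volume.restrict (ball (0:V) (T:ℝ))) with hμ
    have : IsFiniteMeasure μ := by
      refine ⟨?_⟩
      rw [hμ, Measure.smul_apply, smul_eq_mul, Measure.restrict_apply_univ]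
      exact ENNReal.mul_lt_top ENNReal.ofReal_lt_top measure_ball_lt_top
    set E : ℝ → V → Lp ℂ 2 (volume : Measure V) := fun t x => if |t| ≤ T then (a:ℂ) • p3E hy t x else 0 with hE
    have hstr := hst μ E (a * ‖p3E hy 0 (0:V)‖) T ?_ ?_ ?_ ?_ ?_ (hk.toLp k)
    · rw [hkn] at hstr
      have h2 : ENNReal.ofReal (D ^ (-(q * θ))) * ∫⁻ t in Set.Icc (-(T:ℝ)) T, (∫⁻ x in ball 0 (T:ℝ), ‖F t x‖ₑ ^ r) ^ (q/r)
          ≤ ∫⁻ t, (∫⁻ x, ‖inner ℂ (E t x) (hk.toLp k)‖ₑ ^ r ∂μ) ^ (q/r) := by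
        refine le_trans ?_ (setLIntegral_le_lintegral (Set.Icc (-(T:ℝ)) T) _)
        rw [← lintegral_const_mul' _ _ ENNReal.ofReal_ne_top]
        refine setLIntegral_mono' measurableSet_Icc fun t ht => ?_
        have htT : |t| ≤ T := abs_le.2 (Set.mem_Icc.1 ht)
        simp only [hE, htT, if_true, hμ]
        rw [lintegral_smul_measure, smul_eq_mul]
        have e : ∀ x, ‖inner ℂ ((a:ℂ) • p3E hy t x) (hk.toLp k)‖ₑ ^ r = ENNReal.ofReal (a ^ r) * ‖F t x‖ₑ ^ r := by
          intro x
          rw [inner_smul_left, Complex.conj_ofReal, enorm_mul, ENNReal.mul_rpow_of_nonneg _ _ hr0.le, ← hFE,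
            ← ofReal_norm (a:ℂ), Complex.norm_real, Real.norm_of_nonneg ha0.le,
            ENNReal.ofReal_rpow_of_nonneg ha0.le hr0.le]
        simp_rw [e]
        rw [lintegral_const_mul' _ _ ENNReal.ofReal_ne_top, ← mul_assoc, ← ENNReal.ofReal_mul hD0.le,
          ENNReal.mul_rpow_of_nonneg _ _ (by positivity), ENNReal.ofReal_rpow_of_nonneg (by positivity) (by positivity)]
        refine le_of_eq ?_
        congr 2
        rw [had, ← Real.rpow_mul hD0.le]
        nth_rewrite 2 [← Real.rpow_one D]
        rw [← Real.rpow_add hD0, ← Real.rpow_mul hD0.le]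
        congr 1
        rw [hθd]; field_simp; ring
      have h3 := (ENNReal.rpow_le_rpow hstr hq0.le)
      rw [← ENNReal.rpow_mul, one_div_mul_cancel hq0.ne', ENNReal.rpow_one] at h3
      have h4 := h2.trans h3
      have h5 := mul_le_mul' (le_refl (ENNReal.ofReal (D ^ (q * θ)))) h4
      rw [← mul_assoc, ← ENNReal.ofReal_mul (by positivity), ← Real.rpow_add hD0] at h5
      simpa using h5
    · have e : Function.uncurry E = {p : ℝ × V | |p.1| ≤ T}.indicator (fun p => (a:ℂ) • p3E hy p.1 p.2) := by
        ext1 p; rfl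
      rw [e]
      have hc : Continuous (fun p : ℝ × V => (a:ℂ) • p3E hy p.1 p.2) := by
        have := p3E_cont (V := V) hy
        fun_prop
      have hsc : SecondCountableTopologyEither (ℝ × V) (Lp ℂ 2 (volume : Measure V)) := ⟨Or.inl inferInstance⟩
      exact hc.stronglyMeasurable.indicator (measurableSet_le (by fun_prop) (by fun_prop))
    · intro t x
      simp only [hE]
      split_ifs
      · rw [norm_smul, Complex.norm_real, Real.norm_of_nonneg ha0.le]
        have : ‖p3E hy t x‖ = ‖p3E hy 0 (0:V)‖ := by
          rw [← sq_eq_sq₀ (norm_nonneg _) (norm_nonneg _), p3E_norm, p3E_norm]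
        rw [this]
      · rw [norm_zero]; positivity
    · intro t x ht
      simp only [hE, not_le.2 ht, if_false]
    · intro s t x x' hst
      have hpos : 0 ≤ |t - s| ^ (-((d - 1)/2)) := by positivity
      simp only [hE]
      split_ifs
      · rw [inner_smul_left, inner_smul_right, Complex.conj_ofReal, norm_mul, norm_mul, Complex.norm_real,
          Real.norm_of_nonneg ha0.le, p3E_inner]
        have := hdisp (x - x') (2*y) (t - s) (by positivity) (sub_ne_zero.2 hst.symm)
        calc _ ≤ a * (a * (C1 * (2*y) ^ (-((d+1)/2)) * |t - s| ^ (-((d-1)/2)))) := by gcongr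
          _ = (a * a * D) * |t - s| ^ (-((d-1)/2)) := by rw [hD]; ring
          _ = _ := by rw [haD, one_mul]
      all_goals simpa using hpos
    · intro t k'
      simp only [hE]
      split_ifs
      · rw [hμ, lintegral_smul_measure, smul_eq_mul]
        have e : ∀ x, ‖inner ℂ ((a:ℂ) • p3E hy t x) k'‖ₑ ^ (2:ℝ) = ENNReal.ofReal (a * a) * ‖inner ℂ (p3E hy t x) k'‖ₑ ^ (2:ℝ) := by
          intro x
          rw [inner_smul_left, Complex.conj_ofReal, enorm_mul, ENNReal.mul_rpow_of_nonneg _ _ (by norm_num),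
            ← ofReal_norm (a:ℂ), Complex.norm_real, Real.norm_of_nonneg ha0.le,
            ENNReal.ofReal_rpow_of_nonneg ha0.le (by norm_num), Real.rpow_two, sq]
        simp_rw [e]
        rw [lintegral_const_mul' _ _ ENNReal.ofReal_ne_top, ← mul_assoc, ← ENNReal.ofReal_mul hD0.le,
          mul_comm D, haD, ENNReal.ofReal_one, one_mul]
        exact (setLIntegral_le_lintegral _ _).trans (p3_energy hy t k')
      · simp
  unfold p3M
  refine (ENNReal.rpow_le_rpow hmain (by positivity)).trans (le_of_eq ?_)
  rw [ENNReal.mul_rpow_of_nonneg _ _ (by positivity), ← ENNReal.rpow_mul (ENNReal.ofReal C2 * _),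
    mul_one_div_cancel hq0.ne', ENNReal.rpow_one, ENNReal.ofReal_rpow_of_nonneg (by positivity) (by positivity),
    ← mul_assoc, ← ENNReal.ofReal_mul (by positivity)]
  congr 2
  rw [← Real.rpow_mul hD0.le, show q * θ * (1/q) = θ by field_simp, hD, Real.mul_rpow (by norm_num) hy.le,
    ← mul_assoc, Real.mul_rpow (by positivity) (by positivity), ← Real.rpow_mul hy.le]
  ring

end P3b

section P3c

variable {V : Type*} [NormedAddCommGroup V] [InnerProductSpace ℝ V] [FiniteDimensional ℝ V]
  [MeasurableSpace V] [BorelSpace V]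

lemma p3_young {G v w : V → ℝ≥0∞} (hG : Measurable G) (hv : Measurable v) (hG1 : ∫⁻ z, G z = 1) {M : ℝ≥0∞}
    (hGM : ∀ z, G z ≤ M) (hw : ∀ x, w x ≤ ∫⁻ z, G z * v (x + z)) {p r : ℝ} (hp : 1 < p) (hpr : p ≤ r) :
    (∫⁻ x, w x ^ r) ^ (1/r) ≤ M ^ (1/p - 1/r) * (∫⁻ x, v x ^ p) ^ (1/p) := by
  have hp0 : 0 < p := by linarith
  have hr0 : 0 < r := by linarith
  set J := ∫⁻ x, v x ^ p with hJ
  set b : V → ℝ≥0∞ := fun x => ∫⁻ z, G z * v (x + z) ^ p with hb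
  have hjen : ∀ x, w x ^ p ≤ b x := by
    intro x
    have hpq : p.HolderConjugate (Real.conjExponent p) := Real.HolderConjugate.conjExponent hp
    have h := ENNReal.lintegral_mul_le_Lp_mul_Lq (volume.withDensity G) hpq (f := fun z => v (x + z))
      (g := fun _ => 1) (by fun_prop) (by fun_prop)
    simp only [Pi.mul_apply, mul_one, ENNReal.one_rpow, lintegral_one, withDensity_apply _ MeasurableSet.univ,
      Measure.restrict_univ, hG1] at h
    rw [lintegral_withDensity_eq_lintegral_mul _ hG (by fun_prop),
      lintegral_withDensity_eq_lintegral_mul _ hG (by fun_prop)] at h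
    have h2 := (hw x).trans h
    rw [one_div, ENNReal.le_rpow_inv_iff hp0] at h2
    exact h2
  have hbM : ∀ x, b x ≤ M * J := by
    intro x
    calc b x ≤ ∫⁻ z, M * v (x + z) ^ p := lintegral_mono fun z => mul_le_mul' (hGM z) le_rfl
      _ = M * J := by
        rw [lintegral_const_mul _ (by fun_prop), hJ, lintegral_add_left_eq_self (fun z => v z ^ p) x]
  have hbint : ∫⁻ x, b x = J := by
    simp only [hb]
    rw [lintegral_lintegral_swap (by fun_prop)]
    calc _ = ∫⁻ z, G z * J := by
          refine lintegral_congr fun z => ?_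
          rw [lintegral_const_mul _ (by fun_prop), lintegral_add_right_eq_self (fun x => v x ^ p) z]
      _ = J := by rw [lintegral_mul_const _ hG, hG1, one_mul]
  have hrp : 0 ≤ r/p - 1 := by rw [sub_nonneg, one_le_div hp0]; exact hpr
  have hbm : Measurable b := by
    exact Measurable.lintegral_prod_right' (f := fun q : V × V => G q.2 * v (q.1 + q.2) ^ p) (by fun_prop)
  have hmain : ∫⁻ x, w x ^ r ≤ M ^ (r/p - 1) * J ^ (r/p) := by
    calc ∫⁻ x, w x ^ r ≤ ∫⁻ x, (M * J) ^ (r/p - 1) * b x := by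
          refine lintegral_mono fun x => ?_
          have e : w x ^ r = (w x ^ p) ^ (r/p) := by
            rw [← ENNReal.rpow_mul]; congr 1; field_simp
          have e2 : b x ^ (r/p) = b x ^ (r/p - 1) * b x := by
            nth_rewrite 3 [← ENNReal.rpow_one (b x)]
            rw [← ENNReal.rpow_add_of_nonneg _ _ hrp (by norm_num)]; congr 1; ring
          simp only
          rw [e]
          refine (ENNReal.rpow_le_rpow (hjen x) (by positivity)).trans ?_
          rw [e2]
          gcongr
          exact hbM x
      _ = (M * J) ^ (r/p - 1) * J := by rw [lintegral_const_mul _ hbm, hbint]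
      _ = M ^ (r/p - 1) * J ^ (r/p) := by
          rw [ENNReal.mul_rpow_of_nonneg _ _ hrp, mul_assoc]
          congr 1
          nth_rewrite 2 [← ENNReal.rpow_one J]
          rw [← ENNReal.rpow_add_of_nonneg _ _ hrp (by norm_num)]; congr 1; ring
  refine (ENNReal.rpow_le_rpow hmain (by positivity)).trans (le_of_eq ?_)
  rw [ENNReal.mul_rpow_of_nonneg _ _ (by positivity), ← ENNReal.rpow_mul, ← ENNReal.rpow_mul]
  congr 2 <;> field_simp

/-- heat kernel. -/
def p3G (V : Type*) [NormedAddCommGroup V] [InnerProductSpace ℝ V] (τ : ℝ) (z : V) : ℝ :=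
  (τ / Real.pi) ^ (-((Module.finrank ℝ V : ℝ)/2)) * Real.exp (-(Real.pi^2/τ) * ‖z‖^2)

lemma p3G_pos {τ : ℝ} (hτ : 0 < τ) (z : V) : 0 < p3G V τ z := by
  unfold p3G; have := Real.pi_pos; positivity

lemma p3G_cont (τ : ℝ) : Continuous (p3G V τ) := by
  unfold p3G; fun_prop

lemma p3G_int {τ : ℝ} (hτ : 0 < τ) : Integrable (p3G V τ) := by
  unfold p3G
  exact (p1_gauss_integrable (by positivity)).const_mul _

lemma p3G_fourier {τ : ℝ} (hτ : 0 < τ) (ξ : V) :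
    ∫ z : V, cexp (↑(2 * Real.pi * inner ℝ z ξ) * I) * (p3G V τ z : ℂ) = (Real.exp (-τ * ‖ξ‖^2) : ℝ) := by
  have hpi := Real.pi_pos
  have h := p1_gauss (V := V) ξ (w := τ / Real.pi^2) (by positivity)
  have e1 : Real.pi * (τ / Real.pi^2) = τ / Real.pi := by field_simp
  have e2 : -(Real.pi^2 * ‖ξ‖^2) * (τ / Real.pi^2) = -τ * ‖ξ‖^2 := by field_simp
  have e3 : -(1 / (τ / Real.pi^2)) = -(Real.pi^2/τ) := by field_simp
  rw [e1, e2] at h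
  simp_rw [e3] at h
  have e4 : ∀ z : V, cexp (↑(2 * Real.pi * inner ℝ z ξ) * I) * (p3G V τ z : ℂ) =
      (((τ / Real.pi) ^ (-((Module.finrank ℝ V : ℝ)/2)) : ℝ) : ℂ) *
      (cexp (↑(2 * Real.pi * inner ℝ z ξ) * I) * ((Real.exp (-(Real.pi^2/τ) * ‖z‖^2) : ℝ) : ℂ)) := by
    intro z; unfold p3G; rw [Complex.ofReal_mul ((τ / Real.pi) ^ _)]; ring
  simp_rw [e4]
  rw [integral_const_mul, h, ← Complex.ofReal_mul, ← mul_assoc, ← Real.rpow_add (by positivity)]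
  simp

lemma p3G_lint {τ : ℝ} (hτ : 0 < τ) : ∫⁻ z : V, ENNReal.ofReal (p3G V τ z) = 1 := by
  have h := p3G_fourier hτ (0:V)
  simp only [inner_zero_right, mul_zero, Complex.ofReal_zero, zero_mul, Complex.exp_zero, one_mul] at h
  rw [integral_complex_ofReal] at h
  have h2 := Complex.ofReal_injective h
  rw [← ofReal_integral_eq_lintegral_ofReal (p3G_int hτ) (Filter.Eventually.of_forall fun z => (p3G_pos hτ z).le), h2]
  simp

lemma p3_heat {τ : ℝ} (hτ : 0 < τ) {g : V → ℂ} (hg : Integrable g) (x : V) :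
    𝓕⁻ (fun ξ : V => ((Real.exp (-τ * ‖ξ‖^2) : ℝ) : ℂ) * g ξ) x = ∫ z, (p3G V τ z : ℂ) * 𝓕⁻ g (x + z) := by
  simp only [Real.fourierInv_eq', smul_eq_mul]
  simp_rw [← p3G_fourier hτ, ← integral_mul_const, ← integral_const_mul]
  rw [integral_integral_swap]
  · refine integral_congr_ae (Filter.Eventually.of_forall fun z => ?_)
    refine integral_congr_ae (Filter.Eventually.of_forall fun ξ => ?_)
    simp only
    rw [inner_add_right, real_inner_comm ξ z]
    have : cexp (↑(2 * Real.pi * (inner ℝ ξ x + inner ℝ ξ z)) * I) =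
      cexp (↑(2 * Real.pi * inner ℝ ξ x) * I) * cexp (↑(2 * Real.pi * inner ℝ ξ z) * I) := by
      rw [← Complex.exp_add]; congr 1; push_cast; ring
    rw [this, real_inner_comm z ξ]; ring
  · have h1 : Integrable (fun p : V × V => g p.1 * (p3G V τ p.2 : ℂ)) :=
      hg.mul_prod (p3G_int hτ).ofReal
    refine (h1.bdd_mul (c := 1) (f := fun p : V × V => cexp (↑(2 * Real.pi * inner ℝ p.1 x) * I) *
      cexp (↑(2 * Real.pi * inner ℝ p.2 p.1) * I)) ?_ ?_).congr ?_
    · exact Continuous.aestronglyMeasurable (by fun_prop)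
    · refine Filter.Eventually.of_forall fun p => ?_
      rw [norm_mul, Complex.norm_exp_ofReal_mul_I, Complex.norm_exp_ofReal_mul_I, one_mul]
    · refine Filter.Eventually.of_forall fun p => ?_
      simp only [Function.uncurry]
      ring

lemma p3_bernstein {τ : ℝ} (hτ : 0 < τ) {g : V → ℂ} (hg : Integrable g) {p r : ℝ} (hp : 1 < p) (hpr : p ≤ r) :
    (∫⁻ x, ‖𝓕⁻ (fun ξ : V => ((Real.exp (-τ * ‖ξ‖^2) : ℝ) : ℂ) * g ξ) x‖ₑ ^ r) ^ (1/r) ≤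
    ENNReal.ofReal ((τ / Real.pi) ^ (-((Module.finrank ℝ V : ℝ)/2) * (1/p - 1/r))) *
      (∫⁻ x, ‖𝓕⁻ g x‖ₑ ^ p) ^ (1/p) := by
  have hpi := Real.pi_pos
  have h := p3_young (G := fun z : V => ENNReal.ofReal (p3G V τ z)) (v := fun x => ‖𝓕⁻ g x‖ₑ)
    (w := fun x => ‖𝓕⁻ (fun ξ : V => ((Real.exp (-τ * ‖ξ‖^2) : ℝ) : ℂ) * g ξ) x‖ₑ)
    (M := ENNReal.ofReal ((τ / Real.pi) ^ (-((Module.finrank ℝ V : ℝ)/2))))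
    (p3G_cont τ).measurable.ennreal_ofReal (p0_fourierInv_continuous hg).measurable.enorm (p3G_lint hτ)
    ?_ ?_ hp hpr
  · rw [ENNReal.ofReal_rpow_of_nonneg (by positivity), ← Real.rpow_mul (by positivity)] at h
    · exact h
    · rw [sub_nonneg]; exact one_div_le_one_div_of_le (by linarith) hpr
  · intro z
    apply ENNReal.ofReal_le_ofReal
    unfold p3G
    refine mul_le_of_le_one_right (by positivity) ?_
    rw [Real.exp_le_one_iff]
    have : 0 ≤ Real.pi^2/τ * ‖z‖^2 := by positivity
    linarith
  · intro x
    rw [p3_heat hτ hg x]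
    refine (enorm_integral_le_lintegral_enorm _).trans (le_of_eq ?_)
    refine lintegral_congr fun z => ?_
    rw [enorm_mul, ← ofReal_norm ((p3G V τ z : ℝ) : ℂ), Complex.norm_real, Real.norm_of_nonneg (p3G_pos hτ z).le]

lemma p3M_le {q r r0 : ℝ} (hq : 0 < q) {F G : ℝ → V → ℂ} {c : ℝ}
    (h : ∀ t, (∫⁻ x, ‖F t x‖ₑ ^ r) ^ (1/r) ≤ ENNReal.ofReal c * (∫⁻ x, ‖G t x‖ₑ ^ r0) ^ (1/r0)) :
    p3M q r F ≤ ENNReal.ofReal c * p3M q r0 G := by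
  have hq0 : 0 ≤ 1/q := by positivity
  unfold p3M
  have e : ENNReal.ofReal c * (∫⁻ t, (∫⁻ x, ‖G t x‖ₑ ^ r0) ^ (q/r0)) ^ (1/q) =
      (∫⁻ t, (ENNReal.ofReal c * (∫⁻ x, ‖G t x‖ₑ ^ r0) ^ (1/r0)) ^ q) ^ (1/q) := by
    have : ∀ t, (ENNReal.ofReal c * (∫⁻ x, ‖G t x‖ₑ ^ r0) ^ (1/r0)) ^ q =
        ENNReal.ofReal c ^ q * (∫⁻ x, ‖G t x‖ₑ ^ r0) ^ (q/r0) := by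
      intro t
      rw [ENNReal.mul_rpow_of_nonneg _ _ hq.le, ← ENNReal.rpow_mul]; congr 2; ring
    simp_rw [this]
    rw [lintegral_const_mul' _ _ (ENNReal.rpow_ne_top_of_nonneg hq.le ENNReal.ofReal_ne_top),
      ENNReal.mul_rpow_of_nonneg _ _ hq0, ← ENNReal.rpow_mul, mul_one_div_cancel hq.ne', ENNReal.rpow_one]
  rw [e]
  refine ENNReal.rpow_le_rpow (lintegral_mono fun t => ?_) hq0
  refine le_trans (le_of_eq ?_) (ENNReal.rpow_le_rpow (h t) hq.le)
  rw [← ENNReal.rpow_mul]; congr 1; ring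

end P3c

section P3d

variable {V : Type*} [NormedAddCommGroup V] [InnerProductSpace ℝ V] [FiniteDimensional ℝ V]
  [MeasurableSpace V] [BorelSpace V]

theorem p3_FS [Nontrivial V] {q r : ℝ} (hd : 2 ≤ Module.finrank ℝ V) (hq : 2 ≤ q) (hr : 2 ≤ r)
    (hadm : 2 / q + ((Module.finrank ℝ V : ℝ) - 1) / r ≤ ((Module.finrank ℝ V : ℝ) - 1) / 2) :
    ∃ C > (0:ℝ), ∀ s > (0:ℝ), ∀ h : V → ℂ, MemLp h 2 →
      p3M q r (fun t x => 𝓕⁻ (fun ξ : V => cexp (t * I * ‖ξ‖) * (((Real.exp (-s * ‖ξ‖^2) : ℝ) : ℂ) * h ξ)) x) ≤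
      ENNReal.ofReal (C * s ^ ((1/q + (Module.finrank ℝ V : ℝ)/r - (Module.finrank ℝ V : ℝ)/2) / 2)) * eLpNorm h 2 := by
  have hd' : (2:ℝ) ≤ Module.finrank ℝ V := by exact_mod_cast hd
  set d : ℝ := (Module.finrank ℝ V : ℝ) with hdd
  have hpi := Real.pi_pos
  have hr00 : 0 < r := by linarith
  have hq0 : 0 < q := by linarith
  have hd1 : 0 < d - 1 := by linarith
  set ρ : ℝ := 1/2 - 2/((d-1)*q) with hρ
  have hρr : 1/r ≤ ρ := by
    have h1 : (2 / q + (d - 1) / r) / (d-1) ≤ ((d - 1) / 2) / (d-1) := by gcongr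
    have e1 : (2 / q + (d - 1) / r) / (d-1) = 2/((d-1)*q) + 1/r := by field_simp
    have e2 : ((d - 1) / 2) / (d-1) = 1/2 := by field_simp
    rw [e1, e2] at h1
    rw [hρ]; linarith
  have hρ0 : 0 < ρ := lt_of_lt_of_le (by positivity) hρr
  have hρ2 : ρ < 1/2 := by
    rw [hρ]; have : 0 < 2/((d-1)*q) := by positivity
    linarith
  have hr0 : 2 < 1/ρ := by rw [lt_div_iff₀ hρ0]; linarith
  have hr0r : 1/ρ ≤ r := by rw [div_le_iff₀ hρ0]; rw [div_le_iff₀ hr00] at hρr; linarith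
  obtain ⟨C, hC, hpo⟩ := p3_poisson (V := V) (q := q) (r := 1/ρ) hd hq hr0 (by
    rw [one_div_one_div, hρ, ← hdd]; field_simp; ring)
  rw [one_div_one_div, ← hdd] at hpo
  refine ⟨(1/(2*Real.pi)) ^ (-(d/2) * (ρ - 1/r)) * C * Real.exp (1/2), by positivity, ?_⟩
  intro s hs h hh
  set y : ℝ := Real.sqrt s with hy
  have hy0 : 0 < y := Real.sqrt_pos.2 hs
  have hys : y ^ 2 = s := Real.sq_sqrt hs.le
  set k : V → ℂ := fun ξ => ((Real.exp (y * ‖ξ‖ - s/2 * ‖ξ‖^2) : ℝ) : ℂ) * h ξ with hk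
  have hkb : ∀ ξ, ‖k ξ‖ ≤ Real.exp (1/2) * ‖h ξ‖ := by
    intro ξ
    simp only [hk]
    rw [norm_mul, Complex.norm_real, Real.norm_of_nonneg (Real.exp_pos _).le]
    gcongr
    rw [← hys]; nlinarith [sq_nonneg (y * ‖ξ‖ - 1)]
  have hkm : MemLp k 2 := by
    refine hh.of_le_mul (c := Real.exp (1/2)) ?_ (Filter.Eventually.of_forall hkb)
    exact (Continuous.aestronglyMeasurable (by fun_prop)).mul hh.1
  have hkn : eLpNorm k 2 ≤ ENNReal.ofReal (Real.exp (1/2)) * eLpNorm h 2 :=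
    eLpNorm_le_mul_eLpNorm_of_ae_le_mul (Filter.Eventually.of_forall hkb) 2
  have h1 := p3M_le (q := q) (r := r) (r0 := 1/ρ) (c := (s / 2 / Real.pi) ^ (-(d/2) * (ρ - 1/r))) hq0
    (F := fun t x => 𝓕⁻ (fun ξ : V => cexp (t * I * ‖ξ‖) * (((Real.exp (-s * ‖ξ‖^2) : ℝ) : ℂ) * h ξ)) x)
    (G := fun t x => 𝓕⁻ (fun ξ : V => cexp (-(y - t * I) * ‖ξ‖) * k ξ) x) (by
      intro t
      have hb := p3_bernstein (V := V) (τ := s/2) (by positivity) (p3_prod_int hy0 t hkm) (p := 1/ρ) (r := r) (by linarith) hr0r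
      rw [one_div_one_div, ← hdd] at hb
      rw [one_div_one_div]
      have efun : (fun ξ : V => cexp (t * I * ‖ξ‖) * (((Real.exp (-s * ‖ξ‖^2) : ℝ) : ℂ) * h ξ)) =
          fun ξ : V => ((Real.exp (-(s/2) * ‖ξ‖^2) : ℝ) : ℂ) * (cexp (-(y - t * I) * ‖ξ‖) * k ξ) := by
        ext ξ
        simp only [hk]
        push_cast
        rw [← mul_assoc, ← mul_assoc, ← mul_assoc, ← Complex.exp_add, ← Complex.exp_add, ← Complex.exp_add]
        congr 2
        ring
      simp only [efun]
      exact hb)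
  refine h1.trans ?_
  have h2 := hpo y hy0 k hkm
  calc _ ≤ ENNReal.ofReal ((s / 2 / Real.pi) ^ (-(d/2) * (ρ - 1/r))) *
        (ENNReal.ofReal (C * y ^ (-((d+1)/2) * (1/2 - ρ))) * (ENNReal.ofReal (Real.exp (1/2)) * eLpNorm h 2)) := by
        gcongr
        exact h2.trans (by gcongr)
    _ = _ := by
        rw [← mul_assoc, ← mul_assoc, ← ENNReal.ofReal_mul (by positivity), ← ENNReal.ofReal_mul (by positivity)]
        congr 2
        have e1 : s / 2 / Real.pi = (1 / (2 * Real.pi)) * s := by field_simp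
        have e2 : y ^ (-((d+1)/2) * (1/2 - ρ)) = s ^ ((-((d+1)/2) * (1/2 - ρ))/2) := by
          rw [hy, Real.sqrt_eq_rpow, ← Real.rpow_mul hs.le]; congr 1; ring
        have e3 : s ^ ((1/q + d/r - d/2) / 2) = s ^ (-(d/2) * (ρ - 1/r)) * s ^ ((-((d+1)/2) * (1/2 - ρ))/2) := by
          rw [← Real.rpow_add hs]; congr 1; rw [hρ]; field_simp; ring
        rw [e1, e2, e3, Real.mul_rpow (by positivity) hs.le]; ring

end P3d

section P4a

variable {V : Type*} [NormedAddCommGroup V] [InnerProductSpace ℝ V] [FiniteDimensional ℝ V]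
  [MeasurableSpace V] [BorelSpace V]

lemma p4_mink {α : Type*} [MeasurableSpace α] (μ : Measure α) [SFinite μ] {q r : ℝ} (hq : 1 ≤ q) (hr : 1 ≤ r)
    {Φ : α → ℝ → V → ℝ≥0∞} (hΦ : Measurable (fun p : α × ℝ × V => Φ p.1 p.2.1 p.2.2)) :
    (∫⁻ t, (∫⁻ x, (∫⁻ τ, Φ τ t x ∂μ) ^ r) ^ (q/r)) ^ (1/q) ≤
      ∫⁻ τ, (∫⁻ t, (∫⁻ x, Φ τ t x ^ r) ^ (q/r)) ^ (1/q) ∂μ := by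
  have hq0 : 0 < q := by linarith
  have hr0 : 0 < r := by linarith
  have h1 : ∀ t, (∫⁻ x, (∫⁻ τ, Φ τ t x ∂μ) ^ r) ^ (1/r) ≤ ∫⁻ τ, (∫⁻ x, Φ τ t x ^ r) ^ (1/r) ∂μ := by
    intro t
    refine p0_minkowski hr μ volume (f := fun τ x => Φ τ t x) ?_
    exact hΦ.comp (f := fun p : α × V => (p.1, t, p.2)) (by fun_prop)
  have hm : Measurable (Function.uncurry fun (τ : α) (t : ℝ) => (∫⁻ x, Φ τ t x ^ r) ^ (1/r)) := by
    refine Measurable.pow_const ?_ _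
    refine Measurable.lintegral_prod_right' (f := fun p : (α × ℝ) × V => Φ p.1.1 p.1.2 p.2 ^ r) ?_
    exact (hΦ.comp (f := fun p : (α × ℝ) × V => (p.1.1, p.1.2, p.2)) (by fun_prop)).pow_const r
  have h2 := p0_minkowski hq μ volume hm
  have e : ∀ A : ℝ≥0∞, A ^ (q/r) = (A ^ (1/r)) ^ q := by
    intro A; rw [← ENNReal.rpow_mul]; congr 1; ring
  simp_rw [e]
  refine le_trans (ENNReal.rpow_le_rpow (lintegral_mono fun t => ENNReal.rpow_le_rpow (h1 t) hq0.le) (by positivity)) h2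

lemma p4_rpow_gauss [Nontrivial V] {a s : ℝ} (ha : -(Module.finrank ℝ V : ℝ) < a) (hs : 0 < s) :
    Integrable (fun ξ : V => ‖ξ‖ ^ a * Real.exp (-s * ‖ξ‖^2)) := by
  refine ((p1_norm_rpow_exp_integrable (V := V) ha (b := 1) one_pos).const_mul (Real.exp (1/(4*s)))).mono'
    (Measurable.aestronglyMeasurable (by fun_prop)) (Filter.Eventually.of_forall fun ξ => ?_)
  rw [Real.norm_of_nonneg (by positivity)]
  calc ‖ξ‖ ^ a * Real.exp (-s * ‖ξ‖^2) ≤ ‖ξ‖ ^ a * (Real.exp (1/(4*s)) * Real.exp (-1 * ‖ξ‖)) := by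
        gcongr
        rw [← Real.exp_add]
        gcongr
        have : 1/(4*s) + -1 * ‖ξ‖ - (-s * ‖ξ‖^2) = (2 * s * ‖ξ‖ - 1)^2/(4*s) := by field_simp; ring
        have h2 : 0 ≤ (2 * s * ‖ξ‖ - 1)^2/(4*s) := by positivity
        linarith
    _ = _ := by ring

lemma p4_rpow_gauss_L2 [Nontrivial V] {a s : ℝ} (ha : -(Module.finrank ℝ V : ℝ) < 2 * a) (hs : 0 < s) :
    MemLp (fun ξ : V => ((‖ξ‖ ^ a * Real.exp (-s * ‖ξ‖^2) : ℝ) : ℂ)) 2 := by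
  rw [memLp_two_iff_integrable_sq_norm (Measurable.aestronglyMeasurable (by fun_prop))]
  refine (p4_rpow_gauss (V := V) ha (s := 2 * s) (by positivity)).congr (Filter.Eventually.of_forall fun ξ => ?_)
  simp only
  rw [Complex.norm_real, Real.norm_of_nonneg (by positivity), mul_pow, ← Real.rpow_natCast (‖ξ‖ ^ a), ← Real.rpow_mul (norm_nonneg _),
    ← Real.exp_nat_mul]
  congr 2 <;> push_cast <;> ring

lemma p4_kap_int [Nontrivial V] {κ s : ℝ} (hκ : 4 * κ < (Module.finrank ℝ V : ℝ)) (hs : 0 < s) {h : V → ℂ}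
    (hh : MemLp h 2) :
    Integrable (fun ξ : V => ((‖ξ‖ ^ (-(2*κ)) * Real.exp (-s * ‖ξ‖^2) : ℝ) : ℂ) * h ξ) :=
  (p4_rpow_gauss_L2 (V := V) (a := -(2*κ)) (by linarith) hs).integrable_mul hh

lemma p4_gamma {κ ρ : ℝ} (hκ : 0 < κ) (hρ : 0 < ρ) :
    ∫ τ in Set.Ioi (0:ℝ), τ ^ (κ - 1) * Real.exp (-(ρ^2) * τ) = Real.Gamma κ * ρ ^ (-(2*κ)) := by
  have := Real.integral_rpow_mul_exp_neg_mul_Ioi hκ (r := ρ^2) (by positivity)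
  simp_rw [neg_mul]
  rw [this, mul_comm]
  congr 1
  rw [one_div, Real.inv_rpow (by positivity), ← Real.rpow_natCast, ← Real.rpow_mul hρ.le, ← Real.rpow_neg hρ.le]
  congr 1

lemma p4_sub [Nontrivial V] {κ s : ℝ} (hκ0 : 0 < κ) (hκ : 4 * κ < (Module.finrank ℝ V : ℝ)) (hs : 0 < s) {h : V → ℂ}
    (hh : MemLp h 2) (t : ℝ) (x : V) :
    ‖𝓕⁻ (fun ξ : V => cexp (t * I * ‖ξ‖) * (((‖ξ‖ ^ (-(2*κ)) * Real.exp (-s * ‖ξ‖^2) : ℝ) : ℂ) * h ξ)) x‖ₑ ≤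
    ENNReal.ofReal (1 / Real.Gamma κ) * ∫⁻ τ in Set.Ioi (0:ℝ), ENNReal.ofReal (τ ^ (κ - 1)) *
      ‖𝓕⁻ (fun ξ : V => cexp (t * I * ‖ξ‖) * (((Real.exp (-(s + |τ|) * ‖ξ‖^2) : ℝ) : ℂ) * h ξ)) x‖ₑ := by
  have hΓ := Real.Gamma_pos_of_pos hκ0
  set f : V → ℝ → ℂ := fun ξ τ => (cexp (↑(2 * Real.pi * inner ℝ ξ x) * I) * cexp (t * I * ‖ξ‖)) *
    ((((Real.exp (-s * ‖ξ‖^2) : ℝ) : ℂ) * h ξ) * ((τ ^ (κ - 1) * Real.exp (-(‖ξ‖^2) * τ) : ℝ) : ℂ)) with hf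
  have hae : ∀ᵐ ξ : V, ξ ≠ 0 := by
    rw [ae_iff]; simp
  have hnc : ∀ ξ : V, ‖cexp (↑(2 * Real.pi * inner ℝ ξ x) * I) * cexp (t * I * ‖ξ‖)‖ = 1 := by
    intro ξ
    rw [norm_mul, Complex.norm_exp_ofReal_mul_I, Complex.norm_exp]; simp
  have hintg : Integrable (Function.uncurry f) ((volume : Measure V).prod (volume.restrict (Set.Ioi (0:ℝ)))) := by
    have hm : AEStronglyMeasurable (Function.uncurry f) ((volume : Measure V).prod (volume.restrict (Set.Ioi (0:ℝ)))) := by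
      refine AEStronglyMeasurable.mul (Continuous.aestronglyMeasurable (by fun_prop)) ?_
      refine AEStronglyMeasurable.mul (AEStronglyMeasurable.mul (Continuous.aestronglyMeasurable (by fun_prop)) hh.1.comp_fst) ?_
      exact Measurable.aestronglyMeasurable (by fun_prop)
    rw [integrable_prod_iff hm]
    constructor
    · filter_upwards [hae] with ξ hξ
      have h1 := p1_rpow_exp_integrableOn (a := κ - 1) (b := ‖ξ‖^2) (by linarith) (by positivity)
      have h2 : Integrable (fun τ : ℝ => ((τ ^ (κ - 1) * Real.exp (-(‖ξ‖^2) * τ) : ℝ) : ℂ)) (volume.restrict (Set.Ioi 0)) :=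
        Integrable.ofReal h1
      exact (h2.const_mul (((Real.exp (-s * ‖ξ‖^2) : ℝ) : ℂ) * h ξ)).const_mul
        (cexp (↑(2 * Real.pi * inner ℝ ξ x) * I) * cexp (t * I * ‖ξ‖))
    · have h2 := ((p4_kap_int hκ hs hh).norm.const_mul (Real.Gamma κ))
      refine h2.congr ?_
      filter_upwards [hae] with ξ hξ
      have e : ∀ τ, τ ∈ Set.Ioi (0:ℝ) → ‖Function.uncurry f (ξ, τ)‖ = Real.exp (-s * ‖ξ‖^2) * ‖h ξ‖ * (τ ^ (κ - 1) * Real.exp (-(‖ξ‖^2) * τ)) := by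
        intro τ hτ
        have : 0 < τ := hτ
        simp only [Function.uncurry, hf]
        rw [norm_mul, hnc, one_mul, norm_mul, norm_mul, Complex.norm_real, Complex.norm_real,
          Real.norm_of_nonneg (by positivity), Real.norm_of_nonneg (by positivity)]
      rw [setIntegral_congr_fun measurableSet_Ioi e, integral_const_mul, p4_gamma hκ0 (norm_pos_iff.2 hξ), norm_mul,
        Complex.norm_real, Real.norm_of_nonneg (by positivity)]
      ring
  have hkey : 𝓕⁻ (fun ξ : V => cexp (t * I * ‖ξ‖) * (((‖ξ‖ ^ (-(2*κ)) * Real.exp (-s * ‖ξ‖^2) : ℝ) : ℂ) * h ξ)) x =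
      ((1 / Real.Gamma κ : ℝ) : ℂ) * ∫ τ in Set.Ioi (0:ℝ), ((τ ^ (κ - 1) : ℝ) : ℂ) *
      𝓕⁻ (fun ξ : V => cexp (t * I * ‖ξ‖) * (((Real.exp (-(s + |τ|) * ‖ξ‖^2) : ℝ) : ℂ) * h ξ)) x := by
    have h1 : ∫ τ in Set.Ioi (0:ℝ), ((τ ^ (κ - 1) : ℝ) : ℂ) *
      𝓕⁻ (fun ξ : V => cexp (t * I * ‖ξ‖) * (((Real.exp (-(s + |τ|) * ‖ξ‖^2) : ℝ) : ℂ) * h ξ)) x =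
        ∫ τ in Set.Ioi (0:ℝ), ∫ ξ, f ξ τ := by
      refine setIntegral_congr_fun measurableSet_Ioi fun τ hτ => ?_
      have hτ0 : 0 < τ := hτ
      simp only [Real.fourierInv_eq', smul_eq_mul]
      rw [← integral_const_mul]
      refine integral_congr_ae (Filter.Eventually.of_forall fun ξ => ?_)
      simp only [hf]
      have : Real.exp (-(s + |τ|) * ‖ξ‖^2) = Real.exp (-s * ‖ξ‖^2) * Real.exp (-(‖ξ‖^2) * τ) := by
        rw [← Real.exp_add, abs_of_pos hτ0]; congr 1; ring
      rw [this, Complex.ofReal_mul (Real.exp _), Complex.ofReal_mul (τ ^ (κ - 1))]; ring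
    rw [h1, ← integral_integral_swap hintg, Real.fourierInv_eq', ← integral_const_mul]
    refine integral_congr_ae ?_
    filter_upwards [hae] with ξ hξ
    simp only [hf, smul_eq_mul]
    rw [integral_const_mul, integral_const_mul, integral_complex_ofReal, p4_gamma hκ0 (norm_pos_iff.2 hξ),
      Complex.ofReal_mul (Real.Gamma κ), Complex.ofReal_mul (‖ξ‖ ^ (-(2*κ)))]
    have : ((1 / Real.Gamma κ : ℝ) : ℂ) * (Real.Gamma κ : ℂ) = 1 := by
      rw [← Complex.ofReal_mul, one_div_mul_cancel hΓ.ne', Complex.ofReal_one]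
    linear_combination (-(cexp (↑(2 * Real.pi * inner ℝ ξ x) * I) * (cexp (t * I * ‖ξ‖) * ((((‖ξ‖ ^ (-(2*κ)) : ℝ) : ℂ) * ((Real.exp (-s * ‖ξ‖^2) : ℝ) : ℂ)) * h ξ)))) * this
  rw [hkey, enorm_mul, ← ofReal_norm ((1 / Real.Gamma κ : ℝ) : ℂ), Complex.norm_real, Real.norm_of_nonneg (by positivity)]
  gcongr
  refine (enorm_integral_le_lintegral_enorm _).trans (le_of_eq ?_)
  refine setLIntegral_congr_fun measurableSet_Ioi fun τ hτ => ?_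
  have hτ0 : 0 < τ := hτ
  rw [enorm_mul, ← ofReal_norm ((τ ^ (κ - 1) : ℝ) : ℂ), Complex.norm_real, Real.norm_of_nonneg (by positivity)]

end P4a

section P4b

variable {V : Type*} [NormedAddCommGroup V] [InnerProductSpace ℝ V] [FiniteDimensional ℝ V]
  [MeasurableSpace V] [BorelSpace V]

lemma p4M_smul {q r c : ℝ} (hq : 0 < q) (hr : 0 < r) (hc : 0 ≤ c) (F : ℝ → V → ℂ) :
    p3M q r (fun t x => (c:ℂ) * F t x) ≤ ENNReal.ofReal c * p3M q r F := by
  refine p3M_le hq fun t => le_of_eq ?_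
  have e : ∀ x, ‖(c:ℂ) * F t x‖ₑ ^ r = ENNReal.ofReal c ^ r * ‖F t x‖ₑ ^ r := by
    intro x
    rw [enorm_mul, ← ofReal_norm (c:ℂ), Complex.norm_real, Real.norm_of_nonneg hc, ENNReal.mul_rpow_of_nonneg _ _ hr.le]
  simp_rw [e]
  rw [lintegral_const_mul' _ _ (ENNReal.rpow_ne_top_of_nonneg hr.le ENNReal.ofReal_ne_top),
    ENNReal.mul_rpow_of_nonneg _ _ (by positivity), ← ENNReal.rpow_mul, mul_one_div_cancel hr.ne', ENNReal.rpow_one]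

lemma p4_scalar {κ b s : ℝ} (hκ : 0 < κ) (hb : κ + b < 0) (hs : 0 < s) :
    ∫⁻ τ in Set.Ioi (0:ℝ), ENNReal.ofReal (τ ^ (κ - 1) * (s + |τ|) ^ b) ≤
      ENNReal.ofReal ((1/κ + 1/(-(κ + b))) * s ^ (κ + b)) := by
  have hb0 : b < 0 := by linarith
  rw [← Set.Ioc_union_Ioi_eq_Ioi hs.le, lintegral_union measurableSet_Ioi (Set.Ioc_disjoint_Ioi le_rfl), add_mul,
    ENNReal.ofReal_add (by positivity) (mul_nonneg (by rw [one_div_nonneg]; linarith) (by positivity))]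
  gcongr
  · have h1 : IntegrableOn (fun τ : ℝ => τ ^ (κ - 1) * s ^ b) (Set.Ioc 0 s) := by
      have := (intervalIntegral.intervalIntegrable_rpow' (a := 0) (b := s) (r := κ - 1) (by linarith))
      rw [intervalIntegrable_iff_integrableOn_Ioc_of_le hs.le] at this
      exact this.mul_const _
    calc _ ≤ ∫⁻ τ in Set.Ioc 0 s, ENNReal.ofReal (τ ^ (κ - 1) * s ^ b) := by
          refine setLIntegral_mono' measurableSet_Ioc fun τ hτ => ENNReal.ofReal_le_ofReal ?_
          have := hτ.1
          gcongr ?_ * ?_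
          exact Real.rpow_le_rpow_of_nonpos hs (by linarith [abs_nonneg τ]) hb0.le
      _ = ENNReal.ofReal (∫ τ in Set.Ioc 0 s, τ ^ (κ - 1) * s ^ b) := by
          rw [ofReal_integral_eq_lintegral_ofReal h1]
          filter_upwards [self_mem_ae_restrict measurableSet_Ioc] with τ hτ
          have : 0 < τ := hτ.1
          simp only [Pi.zero_apply]; positivity
      _ ≤ _ := by
          refine ENNReal.ofReal_le_ofReal (le_of_eq ?_)
          rw [integral_mul_const, ← intervalIntegral.integral_of_le hs.le, integral_rpow (Or.inl (by linarith))]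
          rw [sub_add_cancel, Real.zero_rpow hκ.ne', Real.rpow_add hs]; ring
  · have h1 : IntegrableOn (fun τ : ℝ => τ ^ (κ - 1 + b)) (Set.Ioi s) :=
      integrableOn_Ioi_rpow_of_lt (by linarith) hs
    calc _ ≤ ∫⁻ τ in Set.Ioi s, ENNReal.ofReal (τ ^ (κ - 1 + b)) := by
          refine setLIntegral_mono' measurableSet_Ioi fun τ hτ => ENNReal.ofReal_le_ofReal ?_
          have hτ0 : 0 < τ := lt_trans hs hτ
          rw [Real.rpow_add hτ0]
          gcongr ?_ * ?_
          exact Real.rpow_le_rpow_of_nonpos hτ0 (by linarith [le_abs_self τ]) hb0.le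
      _ = ENNReal.ofReal (∫ τ in Set.Ioi s, τ ^ (κ - 1 + b)) := by
          rw [ofReal_integral_eq_lintegral_ofReal h1]
          filter_upwards [self_mem_ae_restrict measurableSet_Ioi] with τ hτ
          have : 0 < τ := lt_trans hs hτ
          simp only [Pi.zero_apply]; positivity
      _ ≤ _ := by
          refine ENNReal.ofReal_le_ofReal (le_of_eq ?_)
          rw [integral_Ioi_rpow_of_lt (by linarith) hs]
          have e : κ - 1 + b + 1 = κ + b := by ring
          rw [e, one_div, inv_neg]; ring

lemma p4_cont [Nontrivial V] {s : ℝ} (hs : 0 < s) {h : V → ℂ} (hh : MemLp h 2) :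
    Continuous (fun p : ℝ × ℝ × V => 𝓕⁻ (fun ξ : V => cexp (p.2.1 * I * ‖ξ‖) *
      (((Real.exp (-(s + |p.1|) * ‖ξ‖^2) : ℝ) : ℂ) * h ξ)) p.2.2) := by
  simp only [Real.fourierInv_eq', smul_eq_mul]
  have hd : (0:ℝ) < Module.finrank ℝ V := by exact_mod_cast Module.finrank_pos
  have hi := (p4_kap_int (V := V) (κ := 0) (by linarith) hs hh).norm
  refine continuous_of_dominated (bound := fun ξ : V => ‖((‖ξ‖ ^ (-(2*(0:ℝ))) * Real.exp (-s * ‖ξ‖^2) : ℝ) : ℂ) * h ξ‖) ?_ ?_ hi ?_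
  · intro p
    refine AEStronglyMeasurable.mul (Continuous.aestronglyMeasurable (by fun_prop)) ?_
    refine AEStronglyMeasurable.mul (Continuous.aestronglyMeasurable (by fun_prop)) ?_
    exact AEStronglyMeasurable.mul (Continuous.aestronglyMeasurable (by fun_prop)) hh.1
  · intro p
    refine Filter.Eventually.of_forall fun ξ => ?_
    rw [norm_mul, norm_mul, Complex.norm_exp_ofReal_mul_I, Complex.norm_exp, norm_mul, norm_mul, Complex.norm_real,
      Complex.norm_real, Real.norm_of_nonneg (by positivity), Real.norm_of_nonneg (by positivity)]
    simp only [mul_zero, neg_zero, Real.rpow_zero, one_mul]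
    have e : (↑p.2.1 * I * (‖ξ‖:ℂ)).re = 0 := by simp
    rw [e, Real.exp_zero, one_mul]
    gcongr
    linarith [abs_nonneg p.1]
  · refine Filter.Eventually.of_forall fun ξ => ?_
    fun_prop

theorem p4_FS [Nontrivial V] {q r κ : ℝ} (hd : 2 ≤ Module.finrank ℝ V) (hq : 2 ≤ q) (hr : 2 ≤ r)
    (hadm : 2 / q + ((Module.finrank ℝ V : ℝ) - 1) / r ≤ ((Module.finrank ℝ V : ℝ) - 1) / 2)
    (hκ : 0 < κ) (hκ2 : 2 * κ < -(1/q + (Module.finrank ℝ V : ℝ)/r - (Module.finrank ℝ V : ℝ)/2)) :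
    ∃ C > (0:ℝ), ∀ s > (0:ℝ), ∀ h : V → ℂ, MemLp h 2 →
      p3M q r (fun t x => 𝓕⁻ (fun ξ : V => cexp (t * I * ‖ξ‖) *
        (((‖ξ‖ ^ (-(2*κ)) * Real.exp (-s * ‖ξ‖^2) : ℝ) : ℂ) * h ξ)) x) ≤
      ENNReal.ofReal (C * s ^ (κ + (1/q + (Module.finrank ℝ V : ℝ)/r - (Module.finrank ℝ V : ℝ)/2) / 2)) * eLpNorm h 2 := by
  obtain ⟨C, hC, hFS⟩ := p3_FS (V := V) hd hq hr hadm
  set d : ℝ := (Module.finrank ℝ V : ℝ) with hdd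
  have hd' : (2:ℝ) ≤ d := by rw [hdd]; exact_mod_cast hd
  have hr0 : 0 < r := by linarith
  have hq0 : 0 < q := by linarith
  have hκ4 : 4 * κ < d := by
    have h1 : 0 < 1/q := by positivity
    have h2 : 0 < d/r := by positivity
    linarith
  set b : ℝ := (1/q + d/r - d/2)/2 with hb
  have hκb : κ + b < 0 := by rw [hb]; linarith
  have hΓ := Real.Gamma_pos_of_pos hκ
  have hB : 0 < 1/κ + 1/(-(κ+b)) := by
    have : 0 < 1/(-(κ+b)) := by rw [one_div_pos]; linarith
    positivity
  refine ⟨1 / Real.Gamma κ * C * (1/κ + 1/(-(κ+b))), by positivity, ?_⟩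
  intro s hs h hh
  set F : ℝ → ℝ → V → ℂ := fun τ t x => 𝓕⁻ (fun ξ : V => cexp (t * I * ‖ξ‖) *
    (((Real.exp (-(s + |τ|) * ‖ξ‖^2) : ℝ) : ℂ) * h ξ)) x with hF
  have hFm : Measurable (fun p : ℝ × ℝ × V => F p.1 p.2.1 p.2.2) := (p4_cont hs hh).measurable
  set Φ : ℝ → ℝ → V → ℝ≥0∞ := fun τ t x => ‖((1 / Real.Gamma κ * |τ| ^ (κ - 1) : ℝ) : ℂ) * F τ t x‖ₑ with hΦ
  have hΦm : Measurable (fun p : ℝ × ℝ × V => Φ p.1 p.2.1 p.2.2) := by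
    simp only [hΦ]; fun_prop
  have h1 : ∀ (t : ℝ) (x : V), ‖𝓕⁻ (fun ξ : V => cexp (t * I * ‖ξ‖) *
        (((‖ξ‖ ^ (-(2*κ)) * Real.exp (-s * ‖ξ‖^2) : ℝ) : ℂ) * h ξ)) x‖ₑ ≤ ∫⁻ τ in Set.Ioi (0:ℝ), Φ τ t x := by
    intro t x
    refine (p4_sub hκ hκ4 hs hh t x).trans (le_of_eq ?_)
    rw [← lintegral_const_mul' _ _ ENNReal.ofReal_ne_top]
    refine setLIntegral_congr_fun measurableSet_Ioi fun τ hτ => ?_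
    have hτ0 : 0 < τ := hτ
    simp only [hΦ, hF]
    rw [enorm_mul, ← ofReal_norm ((1 / Real.Gamma κ * |τ| ^ (κ - 1) : ℝ) : ℂ), Complex.norm_real,
      Real.norm_of_nonneg (by positivity), ← mul_assoc, ← ENNReal.ofReal_mul (by positivity), abs_of_pos hτ0]
  have h2 := p4_mink (volume.restrict (Set.Ioi (0:ℝ))) (q := q) (r := r) (by linarith) (by linarith) hΦm
  have h3 : ∀ τ, (∫⁻ t, (∫⁻ x, Φ τ t x ^ r) ^ (q/r)) ^ (1/q) ≤
      ENNReal.ofReal (1 / Real.Gamma κ * |τ| ^ (κ - 1)) * (ENNReal.ofReal (C * (s + |τ|) ^ b) * eLpNorm h 2) := by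
    intro τ
    refine (p4M_smul hq0 hr0 (by positivity) (F τ)).trans ?_
    gcongr
    exact hFS (s + |τ|) (by positivity) h hh
  calc _ ≤ (∫⁻ t, (∫⁻ x, (∫⁻ τ in Set.Ioi (0:ℝ), Φ τ t x) ^ r) ^ (q/r)) ^ (1/q) := by
        unfold p3M
        gcongr with t x
        exact h1 t x
    _ ≤ _ := h2
    _ ≤ ∫⁻ τ in Set.Ioi (0:ℝ), ENNReal.ofReal (1 / Real.Gamma κ * C) * (ENNReal.ofReal (τ ^ (κ - 1) * (s + |τ|) ^ b) * eLpNorm h 2) := by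
        refine setLIntegral_mono' measurableSet_Ioi fun τ hτ => (h3 τ).trans (le_of_eq ?_)
        have hτ0 : 0 < τ := hτ
        rw [← mul_assoc, ← mul_assoc, ← ENNReal.ofReal_mul (by positivity), ← ENNReal.ofReal_mul (by positivity), abs_of_pos hτ0]
        congr 2; ring
    _ = ENNReal.ofReal (1 / Real.Gamma κ * C) * ((∫⁻ τ in Set.Ioi (0:ℝ), ENNReal.ofReal (τ ^ (κ - 1) * (s + |τ|) ^ b)) * eLpNorm h 2) := by
        rw [lintegral_const_mul' _ _ ENNReal.ofReal_ne_top, lintegral_mul_const _ (by fun_prop)]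
    _ ≤ ENNReal.ofReal (1 / Real.Gamma κ * C) * (ENNReal.ofReal ((1/κ + 1/(-(κ + b))) * s ^ (κ + b)) * eLpNorm h 2) := by
        gcongr
        exact p4_scalar hκ hκb hs
    _ = _ := by
        rw [← mul_assoc, ← ENNReal.ofReal_mul (by positivity)]
        congr 2; ring

end P4b

section P5a

variable {V : Type*} [NormedAddCommGroup V] [InnerProductSpace ℝ V] [FiniteDimensional ℝ V]
  [MeasurableSpace V] [BorelSpace V]

/-- heat flow on the Fourier side -/
def p5U (w : V → ℂ) (s : ℝ) (x : V) : ℂ :=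
  𝓕⁻ (fun ξ : V => ((Real.exp (-|s| * ‖ξ‖^2) : ℝ) : ℂ) * w ξ) x

lemma p5_exp_le (s : ℝ) (ξ : V) : Real.exp (-|s| * ‖ξ‖^2) ≤ 1 := by
  rw [Real.exp_le_one_iff]
  have := mul_nonneg (abs_nonneg s) (sq_nonneg ‖ξ‖)
  linarith

lemma p5_norm_le (w : V → ℂ) (s : ℝ) (ξ : V) :
    ‖((Real.exp (-|s| * ‖ξ‖^2) : ℝ) : ℂ) * w ξ‖ ≤ ‖w ξ‖ := by
  rw [norm_mul, Complex.norm_real, Real.norm_of_nonneg (by positivity)]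
  exact mul_le_of_le_one_left (norm_nonneg _) (p5_exp_le s ξ)

lemma p5_aesm {w : V → ℂ} (hw : AEStronglyMeasurable w volume) (s : ℝ) :
    AEStronglyMeasurable (fun ξ : V => ((Real.exp (-|s| * ‖ξ‖^2) : ℝ) : ℂ) * w ξ) volume :=
  AEStronglyMeasurable.mul (Continuous.aestronglyMeasurable (by fun_prop)) hw

lemma p5_int {w : V → ℂ} (hw : Integrable w) (s : ℝ) :
    Integrable (fun ξ : V => ((Real.exp (-|s| * ‖ξ‖^2) : ℝ) : ℂ) * w ξ) :=
  hw.mono (p5_aesm hw.1 s) (Filter.Eventually.of_forall (p5_norm_le w s))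

lemma p5_memLp {w : V → ℂ} (hw : MemLp w 2) (s : ℝ) :
    MemLp (fun ξ : V => ((Real.exp (-|s| * ‖ξ‖^2) : ℝ) : ℂ) * w ξ) 2 :=
  hw.mono (p5_aesm hw.1 s) (Filter.Eventually.of_forall (p5_norm_le w s))

lemma p5U_cont {w : V → ℂ} (hw : Integrable w) : Continuous (fun p : ℝ × V => p5U w p.1 p.2) := by
  simp only [p5U, Real.fourierInv_eq', smul_eq_mul]
  refine continuous_of_dominated (bound := fun ξ : V => ‖w ξ‖) ?_ ?_ hw.norm ?_
  · intro p
    exact AEStronglyMeasurable.mul (Continuous.aestronglyMeasurable (by fun_prop)) (p5_aesm hw.1 _)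
  · intro p
    refine Filter.Eventually.of_forall fun ξ => ?_
    rw [norm_mul, Complex.norm_exp_ofReal_mul_I, one_mul]
    exact p5_norm_le w _ ξ
  · refine Filter.Eventually.of_forall fun ξ => ?_
    fun_prop

lemma p5U_contx {w : V → ℂ} (hw : Integrable w) (s : ℝ) : Continuous (p5U w s) := by
  have h : Continuous (fun x : V => (s, x)) := by fun_prop
  have h2 := (p5U_cont hw).comp h
  have e : p5U w s = fun x => p5U w s x := rfl
  rw [e]
  exact h2

lemma p5U_bound' {w : V → ℂ} (s : ℝ) (x : V) :
    ‖p5U w s x‖ ≤ ∫ ξ, Real.exp (-|s| * ‖ξ‖^2) * ‖w ξ‖ := by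
  rw [p5U, Real.fourierInv_eq']
  refine (norm_integral_le_integral_norm _).trans (le_of_eq ?_)
  congr 1; ext ξ
  rw [norm_smul, Complex.norm_exp_ofReal_mul_I, one_mul, norm_mul, Complex.norm_real, Real.norm_of_nonneg (by positivity)]

lemma p5_int' {w : V → ℂ} (hw : Integrable w) (s : ℝ) :
    Integrable (fun ξ : V => Real.exp (-|s| * ‖ξ‖^2) * ‖w ξ‖) := by
  have := (p5_int hw s).norm
  refine this.congr (Filter.Eventually.of_forall fun ξ => ?_)
  simp only
  rw [norm_mul, Complex.norm_real, Real.norm_of_nonneg (by positivity)]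

lemma p5U_bound {w : V → ℂ} (hw : Integrable w) (s : ℝ) (x : V) :
    ‖p5U w s x‖ ≤ ∫ ξ, ‖w ξ‖ := by
  refine (p5U_bound' s x).trans (integral_mono (p5_int' hw s) hw.norm fun ξ => ?_)
  exact mul_le_of_le_one_left (norm_nonneg _) (p5_exp_le s ξ)

lemma p5U_L2 {w : V → ℂ} (hw : Integrable w) (hw2 : MemLp w 2) (s : ℝ) :
    eLpNorm (p5U w s) 2 volume ≤ eLpNorm w 2 volume := by
  have e : p5U w s = 𝓕⁻ (fun ξ : V => ((Real.exp (-|s| * ‖ξ‖^2) : ℝ) : ℂ) * w ξ) := rfl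
  rw [e, p0_plancherel (p5_int hw s) (p5_memLp hw2 s)]
  exact eLpNorm_mono (p5_norm_le w s)

lemma p5U_memLp {w : V → ℂ} (hw : Integrable w) (hw2 : MemLp w 2) (s : ℝ) :
    MemLp (p5U w s) 2 :=
  ⟨(p5U_contx hw s).aestronglyMeasurable, (p5U_L2 hw hw2 s).trans_lt hw2.2⟩

lemma p5U_line {w : V → ℂ} (hw : Integrable w) (hvw : Integrable (fun ξ => ‖ξ‖ * ‖w ξ‖)) (s : ℝ) (x v : V) :
    HasLineDerivAt ℝ (p5U w s) (p5U (fun ξ => ((2 * Real.pi * inner ℝ ξ v : ℝ) : ℂ) * I * w ξ) s x) x v := by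
  unfold HasLineDerivAt
  simp only [p5U, Real.fourierInv_eq', smul_eq_mul]
  have key := hasDerivAt_integral_of_dominated_loc_of_deriv_le (μ := (volume : Measure V)) (𝕜 := ℝ)
    (F := fun (t : ℝ) (ξ : V) => cexp (↑(2 * Real.pi * inner ℝ ξ (x + t • v)) * I) * (((Real.exp (-|s| * ‖ξ‖^2) : ℝ) : ℂ) * w ξ))
    (F' := fun (t : ℝ) (ξ : V) => cexp (↑(2 * Real.pi * inner ℝ ξ (x + t • v)) * I) * (((Real.exp (-|s| * ‖ξ‖^2) : ℝ) : ℂ) *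
      (((2 * Real.pi * inner ℝ ξ v : ℝ) : ℂ) * I * w ξ)))
    (bound := fun ξ => (2 * Real.pi * ‖v‖) * (‖ξ‖ * ‖w ξ‖)) (s := Set.univ) (x₀ := (0:ℝ)) Filter.univ_mem ?_ ?_ ?_ ?_ ?_ ?_
  · simpa using key.2
  · refine Filter.Eventually.of_forall fun t => ?_
    exact AEStronglyMeasurable.mul (Continuous.aestronglyMeasurable (by fun_prop)) (p5_aesm hw.1 _)
  · refine (p5_int hw s).mono (AEStronglyMeasurable.mul (Continuous.aestronglyMeasurable (by fun_prop)) (p5_aesm hw.1 _))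
      (Filter.Eventually.of_forall fun ξ => ?_)
    rw [norm_mul, Complex.norm_exp_ofReal_mul_I, one_mul]
  · refine AEStronglyMeasurable.mul (Continuous.aestronglyMeasurable (by fun_prop)) (p5_aesm ?_ _)
    exact AEStronglyMeasurable.mul (Continuous.aestronglyMeasurable (by fun_prop)) hw.1
  · refine Filter.Eventually.of_forall fun ξ t _ => ?_
    rw [norm_mul, Complex.norm_exp_ofReal_mul_I, one_mul]
    refine (p5_norm_le (fun ξ => ((2 * Real.pi * inner ℝ ξ v : ℝ) : ℂ) * I * w ξ) s ξ).trans ?_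
    rw [norm_mul, norm_mul, Complex.norm_I, mul_one, Complex.norm_real, norm_mul, Real.norm_of_nonneg (by positivity)]
    have := norm_inner_le_norm (𝕜 := ℝ) ξ v
    calc 2 * Real.pi * ‖inner ℝ ξ v‖ * ‖w ξ‖ ≤ 2 * Real.pi * (‖ξ‖ * ‖v‖) * ‖w ξ‖ := by gcongr
      _ = _ := by ring
  · exact hvw.const_mul _
  · refine Filter.Eventually.of_forall fun ξ t _ => ?_
    have h1 : HasDerivAt (fun t : ℝ => (2 * Real.pi * inner ℝ ξ (x + t • v) : ℝ)) (2 * Real.pi * inner ℝ ξ v) t := by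
      have : (fun t : ℝ => (2 * Real.pi * inner ℝ ξ (x + t • v) : ℝ)) = fun t => 2 * Real.pi * inner ℝ ξ x + (2 * Real.pi * inner ℝ ξ v) * t := by
        ext t; rw [inner_add_right, inner_smul_right]; ring
      rw [this]
      simpa using ((hasDerivAt_id t).const_mul (2 * Real.pi * inner ℝ ξ v)).const_add (2 * Real.pi * inner ℝ ξ x)
    have h2 := ((h1.ofReal_comp.mul_const I).cexp).mul_const (((Real.exp (-|s| * ‖ξ‖^2) : ℝ) : ℂ) * w ξ)
    refine h2.congr_deriv ?_
    ring

lemma p5U_deriv {w : V → ℂ} (hw : Integrable w) (hvw : Integrable (fun ξ => ‖ξ‖^2 * ‖w ξ‖)) {s : ℝ} (hs : 0 < s) (x : V) :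
    HasDerivAt (fun s => p5U w s x) (p5U (fun ξ => ((-‖ξ‖^2 : ℝ) : ℂ) * w ξ) s x) s := by
  simp only [p5U, Real.fourierInv_eq', smul_eq_mul]
  have key := hasDerivAt_integral_of_dominated_loc_of_deriv_le (μ := (volume : Measure V)) (𝕜 := ℝ)
    (F := fun (t : ℝ) (ξ : V) => cexp (↑(2 * Real.pi * inner ℝ ξ x) * I) * (((Real.exp (-|t| * ‖ξ‖^2) : ℝ) : ℂ) * w ξ))
    (F' := fun (t : ℝ) (ξ : V) => cexp (↑(2 * Real.pi * inner ℝ ξ x) * I) * (((Real.exp (-|t| * ‖ξ‖^2) : ℝ) : ℂ) *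
      (((-‖ξ‖^2 : ℝ) : ℂ) * w ξ)))
    (bound := fun ξ => ‖ξ‖^2 * ‖w ξ‖) (s := Set.Ioi 0) (x₀ := s) (Ioi_mem_nhds hs) ?_ ?_ ?_ ?_ ?_ ?_
  · exact key.2
  · refine Filter.Eventually.of_forall fun t => ?_
    exact AEStronglyMeasurable.mul (Continuous.aestronglyMeasurable (by fun_prop)) (p5_aesm hw.1 _)
  · refine (p5_int hw s).mono (AEStronglyMeasurable.mul (Continuous.aestronglyMeasurable (by fun_prop)) (p5_aesm hw.1 _))
      (Filter.Eventually.of_forall fun ξ => ?_)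
    rw [norm_mul, Complex.norm_exp_ofReal_mul_I, one_mul]
  · refine AEStronglyMeasurable.mul (Continuous.aestronglyMeasurable (by fun_prop)) (p5_aesm ?_ _)
    exact AEStronglyMeasurable.mul (Continuous.aestronglyMeasurable (by fun_prop)) hw.1
  · refine Filter.Eventually.of_forall fun ξ t _ => ?_
    rw [norm_mul, Complex.norm_exp_ofReal_mul_I, one_mul]
    refine (p5_norm_le (fun ξ => ((-‖ξ‖^2 : ℝ) : ℂ) * w ξ) t ξ).trans (le_of_eq ?_)
    rw [norm_mul, Complex.norm_real, norm_neg, Real.norm_of_nonneg (by positivity)]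
  · exact hvw
  · refine Filter.Eventually.of_forall fun ξ t ht => ?_
    have h0 : HasDerivAt (fun t : ℝ => -|t| * ‖ξ‖^2) (-‖ξ‖^2) t := by
      have : HasDerivAt (fun t : ℝ => -t * ‖ξ‖^2) (-‖ξ‖^2) t := by
        simpa using ((hasDerivAt_id t).neg.mul_const (‖ξ‖^2))
      refine this.congr_of_eventuallyEq ?_
      filter_upwards [Ioi_mem_nhds ht] with u hu
      rw [abs_of_pos hu]
    have h2 := (h0.exp.ofReal_comp.mul_const (w ξ)).const_mul (cexp (↑(2 * Real.pi * inner ℝ ξ x) * I))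
    refine h2.congr_deriv ?_
    push_cast
    ring

lemma p5_G {r : ℝ} (hr : 2 < r) (z : ℂ) : ∃ G' : ℂ →L[ℝ] ℂ,
    HasFDerivAt (fun z : ℂ => ‖z‖^(r-2) • z) G' z ∧ ‖G'‖ ≤ (r - 1) * ‖z‖^(r-2) := by
  by_cases hz : z = 0
  · refine ⟨0, ?_, by rw [norm_zero]; have : 0 ≤ r - 1 := by linarith
                      positivity⟩
    subst hz
    rw [hasFDerivAt_iff_isLittleO_nhds_zero]
    simp only [zero_add, smul_zero, sub_zero, zero_apply]
    rw [Asymptotics.isLittleO_iff]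
    intro c hc
    have h : Filter.Tendsto (fun h : ℂ => ‖h‖^(r-2)) (nhds 0) (nhds 0) := by
      have : Continuous (fun h : ℂ => ‖h‖^(r-2)) := continuous_norm.rpow_const (fun _ => Or.inr (by linarith))
      simpa [Real.zero_rpow (by linarith : r - 2 ≠ 0)] using this.tendsto 0
    filter_upwards [h.eventually_lt_const hc] with y hy
    rw [norm_smul, Real.norm_of_nonneg (by positivity)]
    gcongr
  · have hz0 : 0 < ‖z‖ := norm_pos_iff.mpr hz
    have h1 : HasFDerivAt (fun z : ℂ => ‖z‖^2) ((2:ℝ) • innerSL ℝ z) z := by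
      simpa [ofNat_smul_eq_nsmul] using (hasStrictFDerivAt_norm_sq z).hasFDerivAt
    have h2 := h1.rpow_const (p := (r-2)/2) (Or.inl (by positivity))
    have e : (fun z : ℂ => (‖z‖^2)^((r-2)/2)) = fun z => ‖z‖^(r-2) := by
      ext y
      rw [← Real.rpow_natCast, ← Real.rpow_mul (norm_nonneg _)]; congr 1; push_cast; ring
    rw [e] at h2
    refine ⟨_, h2.smul (hasFDerivAt_id z), ?_⟩
    refine (norm_add_le _ _).trans ?_
    have b1 : ‖‖z‖^(r-2) • ContinuousLinearMap.id ℝ ℂ‖ ≤ ‖z‖^(r-2) := by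
      rw [norm_smul, Real.norm_of_nonneg (by positivity)]
      exact mul_le_of_le_one_right (by positivity) ContinuousLinearMap.norm_id_le
    have e2 : (‖z‖^2)^((r-2)/2 - 1) = ‖z‖^(r-4) := by
      rw [← Real.rpow_natCast, ← Real.rpow_mul (norm_nonneg _)]; congr 1; push_cast; ring
    refine (add_le_add b1 (b := ‖z‖^(r-2)) (d := (r-2) * ‖z‖^(r-2)) ?_).trans (le_of_eq (by ring))
    refine (ContinuousLinearMap.opNorm_le_bound _ (by have : 0 ≤ r - 2 := by linarith
                                                      positivity) fun y => ?_)
    simp only [ContinuousLinearMap.smulRight_apply, smul_apply, e2]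
    rw [norm_smul, norm_smul, norm_smul, Real.norm_of_nonneg (by have : 0 ≤ r - 2 := by linarith
                                                                 positivity : 0 ≤ (r-2)/2 * ‖z‖^(r-4))]
    have := norm_inner_le_norm (𝕜 := ℝ) z y
    have e3 : ‖z‖^(r-2) = ‖z‖^(r-4) * ‖z‖ * ‖z‖ := by
      rw [← Real.rpow_add_one hz0.ne', ← Real.rpow_add_one hz0.ne']; congr 1; ring
    have : 0 ≤ r - 2 := by linarith
    rw [e3]
    simp only [innerSL_apply_apply]
    calc _ ≤ (r-2)/2 * ‖z‖^(r-4) * (‖(2:ℝ)‖ * (‖z‖ * ‖y‖)) * ‖z‖ := by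
            gcongr
      _ = _ := by rw [Real.norm_of_nonneg (by norm_num)]; ring

end P5a

section P5b

variable {V : Type*} [NormedAddCommGroup V] [InnerProductSpace ℝ V] [FiniteDimensional ℝ V]
  [MeasurableSpace V] [BorelSpace V]

lemma p5_parts {r M : ℝ} (hr : 2 < r) {U D DD : V → ℂ} {v : V} (hU : Continuous U) (hM : ∀ x, ‖U x‖ ≤ M)
    (hU2 : MemLp U 2) (hD2 : MemLp D 2) (hDD2 : MemLp DD 2)
    (hUD : ∀ x, HasLineDerivAt ℝ U (D x) x v) (hDDD : ∀ x, HasLineDerivAt ℝ D (DD x) x v) :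
    ‖∫ x, inner ℝ (‖U x‖^(r-2) • U x) (DD x)‖ₑ ≤ ENNReal.ofReal (r-1) *
      ∫⁻ x, ‖U x‖ₑ^(r-2) * ‖D x‖ₑ^(2:ℝ) := by
  choose G' hG hG'b using fun z => p5_G hr z
  have hr2 : 0 < r - 2 := by linarith
  have hG'eq : ∀ z, G' z = fderiv ℝ (fun z : ℂ => ‖z‖^(r-2) • z) z := fun z => (hG z).fderiv.symm
  have hM0 : 0 ≤ M := (norm_nonneg _).trans (hM 0)
  have hUr : Continuous fun x => ‖U x‖^(r-2) := hU.norm.rpow_const fun _ => Or.inr hr2.le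
  have hUrM : ∀ x, ‖U x‖^(r-2) ≤ M^(r-2) := fun x => by gcongr; exact hM x
  have hGU : MemLp (fun x => ‖U x‖^(r-2) • U x) 2 := by
    refine MemLp.of_le_mul (c := M^(r-2)) hU2 (hUr.smul hU).aestronglyMeasurable (Filter.Eventually.of_forall fun x => ?_)
    rw [norm_smul, Real.norm_of_nonneg (by positivity)]
    gcongr; exact hM x
  have hGm : AEStronglyMeasurable (fun x => G' (U x) (D x)) volume := by
    refine isBoundedBilinearMap_apply.continuous.comp_aestronglyMeasurable (AEStronglyMeasurable.prodMk (f := fun x => G' (U x)) ?_ hD2.1)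
    simp_rw [hG'eq]
    exact ((measurable_fderiv ℝ _).comp hU.measurable).aestronglyMeasurable
  have hGD : MemLp (fun x => G' (U x) (D x)) 2 := by
    refine MemLp.of_le_mul (c := (r-1) * M^(r-2)) hD2 hGm (Filter.Eventually.of_forall fun x => ?_)
    refine (ContinuousLinearMap.le_opNorm _ _).trans ?_
    gcongr
    refine (hG'b _).trans ?_
    have : 0 ≤ r - 1 := by linarith
    gcongr; exact hM x
  have hin : ∀ {f g : V → ℂ}, MemLp f 2 → MemLp g 2 → Integrable (fun x => innerSL ℝ (f x) (g x)) := by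
    intro f g hf hg
    have := hf.norm.integrable_mul hg.norm
    refine this.mono ?_ (Filter.Eventually.of_forall fun x => ?_)
    · simp only [innerSL_apply_apply]
      exact hf.1.inner hg.1
    · simp only [innerSL_apply_apply, Pi.mul_apply]
      rw [norm_mul, norm_norm, norm_norm]
      exact norm_inner_le_norm _ _
  have key := integral_bilinear_hasLineDerivAt_right_eq_neg_left_of_integrable (μ := (volume : Measure V))
    (f := fun x => ‖U x‖^(r-2) • U x) (f' := fun x => G' (U x) (D x)) (g := D) (g' := DD) (v := v)
    (B := innerSL ℝ) (hin hGD hD2) (hin hGU hDD2) (hin hGU hD2) ?_ (fun x _ => hDDD x)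
  · change ∫ x, inner ℝ (‖U x‖^(r-2) • U x) (DD x) = - ∫ x, inner ℝ (G' (U x) (D x)) (D x) at key
    rw [key, enorm_neg]
    refine (enorm_integral_le_lintegral_enorm _).trans ?_
    rw [← lintegral_const_mul' _ _ ENNReal.ofReal_ne_top]
    refine lintegral_mono fun x => ?_
    have : 0 ≤ r - 1 := by linarith
    rw [← ofReal_norm, ← ofReal_norm, ← ofReal_norm, ENNReal.ofReal_rpow_of_nonneg (norm_nonneg _) hr2.le,
      ENNReal.ofReal_rpow_of_nonneg (norm_nonneg _) (by norm_num), ← ENNReal.ofReal_mul (by positivity), ← ENNReal.ofReal_mul this]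
    refine ENNReal.ofReal_le_ofReal ?_
    calc _ ≤ ‖G' (U x) (D x)‖ * ‖D x‖ := norm_inner_le_norm _ _
      _ ≤ ((r - 1) * ‖U x‖^(r-2) * ‖D x‖) * ‖D x‖ := by
        gcongr
        refine (ContinuousLinearMap.le_opNorm _ _).trans ?_
        gcongr
        exact hG'b _
      _ = _ := by rw [Real.rpow_two]; ring
  · intro x _
    have h1 := hUD x
    unfold HasLineDerivAt at h1 ⊢
    have h2 : HasFDerivAt (fun z : ℂ => ‖z‖^(r-2) • z) (G' (U x)) (U (x + (0:ℝ) • v)) := by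
      simpa using hG (U x)
    exact h2.comp_hasDerivAt (0:ℝ) h1

lemma p5_holder {r : ℝ} (hr : 2 < r) {U D : V → ℂ} (hU : Continuous U) (hD : Continuous D) :
    ∫⁻ x, ‖U x‖ₑ^(r-2) * ‖D x‖ₑ^(2:ℝ) ≤ (∫⁻ x, ‖U x‖ₑ^r)^(1-2/r) * (∫⁻ x, ‖D x‖ₑ^r)^(2/r) := by
  have hr2 : 0 < r - 2 := by linarith
  have hr0 : 0 < r := by linarith
  have hc : (r/(r-2)).HolderConjugate (r/2) := by
    rw [Real.holderConjugate_iff]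
    refine ⟨by rw [lt_div_iff₀ hr2]; linarith, by field_simp; ring⟩
  have := ENNReal.lintegral_mul_le_Lp_mul_Lq volume hc (f := fun x => ‖U x‖ₑ^(r-2)) (g := fun x => ‖D x‖ₑ^(2:ℝ))
    (hU.measurable.enorm.pow_const _).aemeasurable (hD.measurable.enorm.pow_const _).aemeasurable
  simp only [Pi.mul_apply, ← ENNReal.rpow_mul] at this
  have e1 : (r-2) * (r/(r-2)) = r := by field_simp
  have e2 : 2 * (r/2) = r := by ring
  have e3 : 1/(r/(r-2)) = 1 - 2/r := by field_simp
  have e4 : 1/(r/2) = 2/r := by field_simp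
  rwa [e1, e2, e3, e4] at this

end P5b

section P5c

variable {V : Type*} [NormedAddCommGroup V] [InnerProductSpace ℝ V] [FiniteDimensional ℝ V]
  [MeasurableSpace V] [BorelSpace V]

lemma p5_mult_int {w m : V → ℂ} {c : ℝ} (hm : Continuous m) (hb : ∀ ξ, ‖m ξ‖ ≤ c * (1 + ‖ξ‖^2))
    (hw : Integrable w) (hv : Integrable (fun ξ => ‖ξ‖^2 * ‖w ξ‖)) : Integrable (fun ξ => m ξ * w ξ) := by
  refine ((hw.norm.add hv).const_mul c).mono (hm.aestronglyMeasurable.mul hw.1) (Filter.Eventually.of_forall fun ξ => ?_)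
  rw [norm_mul]
  refine le_trans ?_ (Real.le_norm_self _)
  calc _ ≤ (c * (1 + ‖ξ‖^2)) * ‖w ξ‖ := by gcongr; exact hb ξ
    _ = _ := by simp only [Pi.add_apply]; ring

lemma p5_mult_L2 {w m : V → ℂ} {c : ℝ} (hm : Continuous m) (hb : ∀ ξ, ‖m ξ‖ ≤ c * (1 + ‖ξ‖^2))
    (hw : MemLp w 2) (hv : MemLp (fun ξ => ‖ξ‖^2 * ‖w ξ‖) 2) : MemLp (fun ξ => m ξ * w ξ) 2 := by
  refine MemLp.of_le_mul (c := c) (hw.norm.add hv) (hm.aestronglyMeasurable.mul hw.1) (Filter.Eventually.of_forall fun ξ => ?_)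
  rw [norm_mul]
  have : 0 ≤ c * (1 + ‖ξ‖^2) := (norm_nonneg _).trans (hb ξ)
  have hc : 0 ≤ c := nonneg_of_mul_nonneg_left this (by positivity)
  calc _ ≤ (c * (1 + ‖ξ‖^2)) * ‖w ξ‖ := by gcongr; exact hb ξ
    _ = c * ((‖w ξ‖ + ‖ξ‖^2 * ‖w ξ‖)) := by ring
    _ ≤ _ := by gcongr; simp only [Pi.add_apply]; exact Real.le_norm_self _

lemma p5_hold2 {U L : V → ℂ} (hU : AEStronglyMeasurable U volume) (hL : AEStronglyMeasurable L volume) :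
    ∫⁻ x, ‖U x‖ₑ * ‖L x‖ₑ ≤ eLpNorm U 2 volume * eLpNorm L 2 volume := by
  have := ENNReal.lintegral_mul_le_Lp_mul_Lq volume Real.HolderConjugate.two_two hU.enorm hL.enorm
  simp only [Pi.mul_apply] at this
  refine this.trans (le_of_eq ?_)
  rw [eLpNorm_eq_lintegral_rpow_enorm_toReal (by norm_num) (by norm_num),
    eLpNorm_eq_lintegral_rpow_enorm_toReal (by norm_num) (by norm_num)]
  simp

/-- the gradient symbol -/
def p5D (v : V) (w : V → ℂ) : V → ℂ := fun ξ => ((2 * Real.pi * inner ℝ ξ v : ℝ) : ℂ) * I * w ξ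

lemma p5D_bd (v ξ : V) : ‖((2 * Real.pi * inner ℝ ξ v : ℝ) : ℂ) * I‖ ≤ 2 * Real.pi * ‖v‖ * ‖ξ‖ := by
  rw [norm_mul, Complex.norm_I, mul_one, Complex.norm_real, norm_mul, Real.norm_of_nonneg (by positivity), mul_assoc _ ‖v‖, mul_comm ‖v‖]
  gcongr
  exact norm_inner_le_norm _ _

lemma p5D_bd2 (v ξ : V) : ‖((2 * Real.pi * inner ℝ ξ v : ℝ) : ℂ) * I‖ ≤ 2 * Real.pi * ‖v‖ * (1 + ‖ξ‖^2) := by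
  refine (p5D_bd v ξ).trans ?_
  gcongr
  nlinarith [sq_nonneg (‖ξ‖ - 1)]

lemma p5_sum (w : V → ℂ) (s : ℝ) (x : V) (hw : Integrable w) (hv : Integrable (fun ξ => ‖ξ‖^2 * ‖w ξ‖)) :
    ∑ j, p5U (p5D (stdOrthonormalBasis ℝ V j) (p5D (stdOrthonormalBasis ℝ V j) w)) s x =
      ((4 * Real.pi^2 : ℝ) : ℂ) * p5U (fun ξ => ((-‖ξ‖^2 : ℝ) : ℂ) * w ξ) s x := by
  simp only [p5U, Real.fourierInv_eq', smul_eq_mul]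
  rw [← integral_finset_sum, ← integral_const_mul]
  · congr 1; ext ξ
    rw [← Finset.mul_sum, ← Finset.mul_sum]
    have e : ∑ j, p5D (stdOrthonormalBasis ℝ V j) (p5D (stdOrthonormalBasis ℝ V j) w) ξ =
        ((4 * Real.pi^2 : ℝ) : ℂ) * (((-‖ξ‖^2 : ℝ) : ℂ) * w ξ) := by
      have h1 : ∀ j, p5D (stdOrthonormalBasis ℝ V j) (p5D (stdOrthonormalBasis ℝ V j) w) ξ =
        (((4 * Real.pi^2 * -((inner ℝ ξ (stdOrthonormalBasis ℝ V j))^2) : ℝ) : ℂ)) * w ξ := by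
        intro j
        simp only [p5D]
        push_cast
        linear_combination (4 * (Real.pi:ℂ)^2 * ((inner ℝ ξ (stdOrthonormalBasis ℝ V j) : ℝ):ℂ)^2 * w ξ) * Complex.I_sq
      simp_rw [h1]
      rw [← Finset.sum_mul, ← Complex.ofReal_sum, ← mul_assoc, ← Complex.ofReal_mul, ← Finset.mul_sum, Finset.sum_neg_distrib]
      have h2 := (stdOrthonormalBasis ℝ V).sum_sq_norm_inner_left ξ
      simp only [Real.norm_eq_abs, sq_abs] at h2
      rw [h2]
    rw [e]; ring
  · intro j _
    have hi : Integrable (p5D (stdOrthonormalBasis ℝ V j) (p5D (stdOrthonormalBasis ℝ V j) w)) := by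
      have : Integrable (fun ξ => (((2 * Real.pi * inner ℝ ξ (stdOrthonormalBasis ℝ V j) : ℝ) : ℂ) * I *
        (((2 * Real.pi * inner ℝ ξ (stdOrthonormalBasis ℝ V j) : ℝ) : ℂ) * I)) * w ξ) := by
        refine p5_mult_int (c := 4 * Real.pi^2 * ‖stdOrthonormalBasis ℝ V j‖^2) (by fun_prop) (fun ξ => ?_) hw hv
        rw [norm_mul]
        have := p5D_bd (stdOrthonormalBasis ℝ V j) ξ
        calc _ ≤ (2 * Real.pi * ‖stdOrthonormalBasis ℝ V j‖ * ‖ξ‖) * (2 * Real.pi * ‖stdOrthonormalBasis ℝ V j‖ * ‖ξ‖) := by gcongr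
          _ = 4 * Real.pi^2 * ‖stdOrthonormalBasis ℝ V j‖^2 * ‖ξ‖^2 := by ring
          _ ≤ _ := by gcongr; linarith
      refine this.congr (Filter.Eventually.of_forall fun ξ => ?_)
      simp only [p5D]; ring
    refine (p5_int hi s).mono (AEStronglyMeasurable.mul (Continuous.aestronglyMeasurable (by fun_prop)) (p5_aesm hi.1 _))
      (Filter.Eventually.of_forall fun ξ => ?_)
    rw [norm_mul, Complex.norm_exp_ofReal_mul_I, one_mul]

lemma p5_slice {r : ℝ} (hr : 2 < r) {w : V → ℂ} (hw : Integrable w) (hv : Integrable (fun ξ => ‖ξ‖^2 * ‖w ξ‖))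
    (hw2 : MemLp w 2) (hv2 : MemLp (fun ξ => ‖ξ‖^2 * ‖w ξ‖) 2) (s : ℝ) :
    ‖∫ x, inner ℝ (‖p5U w s x‖^(r-2) • p5U w s x) (p5U (fun ξ => ((-‖ξ‖^2 : ℝ) : ℂ) * w ξ) s x)‖ₑ ≤
      ENNReal.ofReal (r-1) * ((∫⁻ x, ‖p5U w s x‖ₑ^r)^(1-2/r) *
        ∑ j, (∫⁻ x, ‖p5U (p5D (stdOrthonormalBasis ℝ V j) w) s x‖ₑ^r)^(2/r)) := by
  have hr2 : 0 < r - 2 := by linarith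
  set b := stdOrthonormalBasis ℝ V with hb
  have hDi : ∀ v, Integrable (p5D v w) := fun v => p5_mult_int (by fun_prop) (p5D_bd2 v) hw hv
  have hD2 : ∀ v, MemLp (p5D v w) 2 := fun v => p5_mult_L2 (by fun_prop) (p5D_bd2 v) hw2 hv2
  have hbd : ∀ v ξ : V, ‖((2 * Real.pi * inner ℝ ξ v : ℝ) : ℂ) * I * (((2 * Real.pi * inner ℝ ξ v : ℝ) : ℂ) * I)‖ ≤
      4 * Real.pi^2 * ‖v‖^2 * (1 + ‖ξ‖^2) := by
    intro v ξ
    rw [norm_mul]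
    have := p5D_bd v ξ
    calc _ ≤ (2 * Real.pi * ‖v‖ * ‖ξ‖) * (2 * Real.pi * ‖v‖ * ‖ξ‖) := by gcongr
      _ = 4 * Real.pi^2 * ‖v‖^2 * ‖ξ‖^2 := by ring
      _ ≤ _ := by gcongr; linarith
  have eDD : ∀ v, p5D v (p5D v w) = fun ξ => (((2 * Real.pi * inner ℝ ξ v : ℝ) : ℂ) * I * (((2 * Real.pi * inner ℝ ξ v : ℝ) : ℂ) * I)) * w ξ := by
    intro v; ext ξ; simp only [p5D]; ring
  have hDDi : ∀ v, Integrable (p5D v (p5D v w)) := by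
    intro v; rw [eDD]; exact p5_mult_int (by fun_prop) (hbd v) hw hv
  have hDD2 : ∀ v, MemLp (p5D v (p5D v w)) 2 := by
    intro v; rw [eDD]; exact p5_mult_L2 (by fun_prop) (hbd v) hw2 hv2
  have hv1 : Integrable (fun ξ => ‖ξ‖ * ‖w ξ‖) := by
    refine (hw.norm.add hv).mono (continuous_norm.aestronglyMeasurable.mul hw.1.norm) (Filter.Eventually.of_forall fun ξ => ?_)
    refine le_trans ?_ (Real.le_norm_self _)
    rw [Real.norm_of_nonneg (by positivity)]
    simp only [Pi.add_apply]
    nlinarith [sq_nonneg (‖ξ‖ - 1), norm_nonneg (w ξ), mul_nonneg (sq_nonneg (‖ξ‖ - 1)) (norm_nonneg (w ξ)), mul_nonneg (sq_nonneg (‖ξ‖)) (norm_nonneg (w ξ))]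
  have hvD : ∀ v, Integrable (fun ξ => ‖ξ‖ * ‖p5D v w ξ‖) := by
    intro v
    refine (hv.const_mul (2 * Real.pi * ‖v‖)).mono (continuous_norm.aestronglyMeasurable.mul (hDi v).1.norm) (Filter.Eventually.of_forall fun ξ => ?_)
    refine le_trans ?_ (Real.le_norm_self _)
    rw [Real.norm_of_nonneg (by positivity)]
    simp only [p5D]
    rw [norm_mul]
    have := p5D_bd v ξ
    calc _ ≤ ‖ξ‖ * ((2 * Real.pi * ‖v‖ * ‖ξ‖) * ‖w ξ‖) := by gcongr
      _ = _ := by ring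
  have hj : ∀ v, ‖∫ x, inner ℝ (‖p5U w s x‖^(r-2) • p5U w s x) (p5U (p5D v (p5D v w)) s x)‖ₑ ≤
      ENNReal.ofReal (r-1) * ((∫⁻ x, ‖p5U w s x‖ₑ^r)^(1-2/r) * (∫⁻ x, ‖p5U (p5D v w) s x‖ₑ^r)^(2/r)) := by
    intro v
    refine (p5_parts (v := v) hr (p5U_contx hw s) (p5U_bound hw s) (p5U_memLp hw hw2 s) (p5U_memLp (hDi v) (hD2 v) s)
      (p5U_memLp (hDDi v) (hDD2 v) s) (fun x => p5U_line hw hv1 s x v) (fun x => p5U_line (hDi v) (hvD v) s x v)).trans ?_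
    gcongr
    exact p5_holder hr (p5U_contx hw s) (p5U_contx (hDi v) s)
  have hUr : Continuous fun x => ‖p5U w s x‖^(r-2) := (p5U_contx hw s).norm.rpow_const fun _ => Or.inr hr2.le
  have hGU : MemLp (fun x => ‖p5U w s x‖^(r-2) • p5U w s x) 2 := by
    refine MemLp.of_le_mul (c := (∫ ξ, ‖w ξ‖)^(r-2)) (p5U_memLp hw hw2 s) (hUr.smul (p5U_contx hw s)).aestronglyMeasurable (Filter.Eventually.of_forall fun x => ?_)
    rw [norm_smul, Real.norm_of_nonneg (by positivity)]
    gcongr; exact p5U_bound hw s x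
  have hsum : ∑ j, ∫ x, inner ℝ (‖p5U w s x‖^(r-2) • p5U w s x) (p5U (p5D (b j) (p5D (b j) w)) s x) =
      (4 * Real.pi^2) * ∫ x, inner ℝ (‖p5U w s x‖^(r-2) • p5U w s x) (p5U (fun ξ => ((-‖ξ‖^2 : ℝ) : ℂ) * w ξ) s x) := by
    rw [← integral_finset_sum, ← integral_const_mul]
    · congr 1; ext x
      rw [← inner_sum, p5_sum w s x hw hv, ← Complex.real_smul, inner_smul_right]
    · intro j _
      have h2 := p5U_memLp (hDDi (b j)) (hDD2 (b j)) s
      refine (hGU.norm.integrable_mul h2.norm).mono (hGU.1.inner h2.1) (Filter.Eventually.of_forall fun x => ?_)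
      simp only [Pi.mul_apply]
      rw [norm_mul, norm_norm, norm_norm]
      exact norm_inner_le_norm _ _
  rw [Finset.mul_sum, Finset.mul_sum]
  refine le_trans ?_ (Finset.sum_le_sum fun j _ => hj (b j))
  refine le_trans ?_ (enorm_sum_le _ _)
  rw [hsum, enorm_mul]
  refine le_mul_of_one_le_left zero_le ?_
  rw [← ofReal_norm, ENNReal.one_le_ofReal, Real.norm_of_nonneg (by positivity)]
  nlinarith [Real.pi_gt_three]

end P5c

section P5d

variable {V : Type*} [NormedAddCommGroup V] [InnerProductSpace ℝ V] [FiniteDimensional ℝ V]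
  [MeasurableSpace V] [BorelSpace V]

lemma p5_rint {r : ℝ} (hr : 2 < r) {w : V → ℂ} (hw : Integrable w) (hw2 : MemLp w 2) (s : ℝ) :
    Integrable (fun x => ‖p5U w s x‖^r) := by
  have h := ((memLp_two_iff_integrable_sq_norm (p5U_memLp hw hw2 s).1).1 (p5U_memLp hw hw2 s)).const_mul ((∫ ξ, ‖w ξ‖)^(r-2))
  have hr0 : 0 ≤ r := by linarith
  refine h.mono ((p5U_contx hw s).norm.rpow_const fun _ => Or.inr hr0).aestronglyMeasurable (Filter.Eventually.of_forall fun x => ?_)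
  refine le_trans ?_ (Real.le_norm_self _)
  rw [Real.norm_of_nonneg (by positivity)]
  have e : ‖p5U w s x‖^r = ‖p5U w s x‖^(r-2) * ‖p5U w s x‖^2 := by
    rw [← Real.rpow_natCast, ← Real.rpow_add' (norm_nonneg _) (by push_cast; linarith)]; congr 1; push_cast; ring
  rw [e]
  gcongr
  · exact p5U_bound hw s x

lemma p5_lint {r : ℝ} (hr : 2 < r) {w : V → ℂ} (hw : Integrable w) (hw2 : MemLp w 2) (s : ℝ) :
    ∫⁻ x, ‖p5U w s x‖ₑ^r = ENNReal.ofReal (∫ x, ‖p5U w s x‖^r) := by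
  rw [ofReal_integral_eq_lintegral_ofReal (p5_rint hr hw hw2 s) (Filter.Eventually.of_forall fun x => by
    simp only [Pi.zero_apply]; positivity)]
  refine lintegral_congr fun x => ?_
  rw [← ofReal_norm, ENNReal.ofReal_rpow_of_nonneg (norm_nonneg _) (by linarith)]

lemma p5_decay {r : ℝ} (hr : 2 < r) {w : V → ℂ} (hw : Integrable w) (hw2 : MemLp w 2) [Nontrivial V] :
    Filter.Tendsto (fun s => ∫⁻ x, ‖p5U w s x‖ₑ^r) Filter.atTop (nhds 0) := by
  have h1 : Filter.Tendsto (fun s : ℝ => ∫ ξ, Real.exp (-|s| * ‖ξ‖^2) * ‖w ξ‖) Filter.atTop (nhds 0) := by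
    have e0 : (0:ℝ) = ∫ ξ : V, (0:ℝ) := by simp
    rw [e0]
    refine tendsto_integral_filter_of_dominated_convergence (fun ξ => ‖w ξ‖) ?_ ?_ hw.norm ?_
    · exact Filter.Eventually.of_forall fun s => (p5_int' hw s).1
    · refine Filter.Eventually.of_forall fun s => Filter.Eventually.of_forall fun ξ => ?_
      rw [Real.norm_of_nonneg (by positivity)]
      exact mul_le_of_le_one_left (norm_nonneg _) (p5_exp_le s ξ)
    · have : ∀ᵐ ξ : V, ξ ≠ 0 := by
        simp [ae_iff, measure_singleton]
      filter_upwards [this] with ξ hξ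
      rw [← zero_mul ‖w ξ‖]
      refine Filter.Tendsto.mul_const _ (Real.tendsto_exp_atBot.comp ?_)
      have hp : 0 < ‖ξ‖^2 := by positivity
      exact (Filter.tendsto_neg_atTop_atBot.comp Filter.tendsto_abs_atTop_atTop).atBot_mul_const hp
  have h2 : Filter.Tendsto (fun s : ℝ => ENNReal.ofReal ((∫ ξ, Real.exp (-|s| * ‖ξ‖^2) * ‖w ξ‖)^(r-2)) * eLpNorm w 2 volume ^ (2:ℝ))
      Filter.atTop (nhds 0) := by
    have h3 := (ENNReal.tendsto_ofReal (h1.rpow_const (p := r-2) (Or.inr (by linarith))))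
    rw [Real.zero_rpow (by linarith), ENNReal.ofReal_zero] at h3
    have := ENNReal.Tendsto.mul_const (b := eLpNorm w 2 volume ^ (2:ℝ)) h3 (Or.inr (ENNReal.rpow_ne_top_of_nonneg (by norm_num) hw2.2.ne))
    rwa [zero_mul] at this
  refine tendsto_of_tendsto_of_tendsto_of_le_of_le tendsto_const_nhds h2 (fun _ => zero_le) fun s => ?_
  simp only
  have h4 : ∫⁻ x, ‖p5U w s x‖ₑ^(2:ℝ) ≤ eLpNorm w 2 volume ^ (2:ℝ) := by
    refine le_trans (le_of_eq ?_) (ENNReal.rpow_le_rpow (p5U_L2 hw hw2 s) (by norm_num))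
    rw [eLpNorm_eq_lintegral_rpow_enorm_toReal (by norm_num) (by norm_num), ← ENNReal.rpow_mul]
    simp
  refine le_trans ?_ (mul_le_mul_right h4 _)
  rw [← lintegral_const_mul' _ _ ENNReal.ofReal_ne_top]
  refine lintegral_mono fun x => ?_
  have e : ‖p5U w s x‖ₑ^r = ‖p5U w s x‖ₑ^(r-2) * ‖p5U w s x‖ₑ^(2:ℝ) := by
    rw [← ENNReal.rpow_add_of_nonneg _ _ (by linarith) (by norm_num)]; congr 1; ring
  rw [e]
  gcongr
  rw [← ofReal_norm, ENNReal.ofReal_rpow_of_nonneg (norm_nonneg _) (by linarith)]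
  refine ENNReal.ofReal_le_ofReal ?_
  gcongr
  exact p5U_bound' s x

lemma p5_contr {r : ℝ} (hr : 2 < r) {w : V → ℂ} (hw : Integrable w) {s : ℝ} (hs : 0 ≤ s) :
    ∫⁻ x, ‖p5U w s x‖ₑ^r ≤ ∫⁻ x, ‖p5U w 0 x‖ₑ^r := by
  rcases hs.eq_or_lt with rfl | hs
  · rfl
  have h := p3_bernstein hs hw (p := r) (r := r) (by linarith) le_rfl
  rw [sub_self, mul_zero, Real.rpow_zero, ENNReal.ofReal_one, one_mul, one_div,
    ENNReal.rpow_inv_le_iff (by linarith), ENNReal.rpow_inv_rpow (by linarith)] at h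
  simpa [p5U, abs_of_pos hs] using h

lemma p5_ftc {r : ℝ} (hr : 2 < r) {w : V → ℂ} (hw : Integrable w) (hv : Integrable (fun ξ => ‖ξ‖^2 * ‖w ξ‖))
    (hw2 : MemLp w 2) (hv2 : MemLp (fun ξ => ‖ξ‖^2 * ‖w ξ‖) 2) {S : ℝ} (hS : 0 ≤ S) :
    ∫⁻ x, ‖p5U w 0 x‖ₑ^r ≤ (∫⁻ x, ‖p5U w S x‖ₑ^r) + ENNReal.ofReal r * ∫⁻ s in Set.Ioc 0 S,
      ‖∫ x, inner ℝ (‖p5U w s x‖^(r-2) • p5U w s x) (p5U (fun ξ => ((-‖ξ‖^2 : ℝ) : ℂ) * w ξ) s x)‖ₑ := by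
  have hr0 : 0 < r := by linarith
  have hr2 : 0 < r - 2 := by linarith
  set L := p5U (fun ξ => ((-‖ξ‖^2 : ℝ) : ℂ) * w ξ) with hL
  have hLi : Integrable (fun ξ => ((-‖ξ‖^2 : ℝ) : ℂ) * w ξ) := by
    refine p5_mult_int (c := 1) (by fun_prop) (fun ξ => ?_) hw hv
    rw [Complex.norm_real, norm_neg, Real.norm_of_nonneg (by positivity)]; linarith
  have hL2 : MemLp (fun ξ => ((-‖ξ‖^2 : ℝ) : ℂ) * w ξ) 2 := by
    refine p5_mult_L2 (c := 1) (by fun_prop) (fun ξ => ?_) hw2 hv2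
    rw [Complex.norm_real, norm_neg, Real.norm_of_nonneg (by positivity)]; linarith
  set K : ℝ → V → ℝ := fun s x => r * inner ℝ (‖p5U w s x‖^(r-2) • p5U w s x) (L s x) with hK
  have hUc := p5U_cont hw
  have hLc := p5U_cont hLi
  have hKc : Continuous (fun p : ℝ × V => K p.1 p.2) := by
    refine continuous_const.mul (Continuous.inner ?_ hLc)
    exact (hUc.norm.rpow_const fun _ => Or.inr hr2.le).smul hUc
  have hpt : ∀ x, ∫ s in Set.Ioc 0 S, K s x = ‖p5U w S x‖^r - ‖p5U w 0 x‖^r := by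
    intro x
    have hx : Continuous (fun s : ℝ => (s, x)) := by fun_prop
    rw [← intervalIntegral.integral_of_le hS]
    refine intervalIntegral.integral_eq_sub_of_hasDerivAt_of_le (f := fun s => ‖p5U w s x‖^r) hS ?_ ?_ ?_
    · exact ((hUc.comp hx).norm.rpow_const fun _ => Or.inr hr0.le).continuousOn
    · intro s hs
      have h1 := p5U_deriv hw hv hs.1 x
      have h2 := (hasFDerivAt_norm_rpow (p5U w s x) (p := r) (by linarith)).comp_hasDerivAt s h1
      refine h2.congr_deriv ?_
      simp only [hK, hL, smul_apply, innerSL_apply_apply, real_inner_smul_left, smul_eq_mul]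
      ring
    · exact (hKc.comp hx).intervalIntegrable _ _
  have hKi : Integrable (Function.uncurry K) ((volume.restrict (Set.Ioc 0 S)).prod volume) := by
    refine ⟨hKc.aestronglyMeasurable, ?_⟩
    change ∫⁻ p : ℝ × V, ‖K p.1 p.2‖ₑ ∂((volume.restrict (Set.Ioc 0 S)).prod volume) < ⊤
    rw [lintegral_prod _ (hKc.measurable.enorm.aemeasurable)]
    set c := ENNReal.ofReal (r * (∫ ξ, ‖w ξ‖)^(r-2)) * (eLpNorm w 2 volume * eLpNorm (fun ξ => ((-‖ξ‖^2 : ℝ) : ℂ) * w ξ) 2 volume) with hc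
    have hcf : c < ⊤ := ENNReal.mul_lt_top ENNReal.ofReal_lt_top (ENNReal.mul_lt_top hw2.2 hL2.2)
    have hb : ∀ s, ∫⁻ x, ‖K s x‖ₑ ≤ c := by
      intro s
      calc ∫⁻ x, ‖K s x‖ₑ ≤ ∫⁻ x, ENNReal.ofReal (r * (∫ ξ, ‖w ξ‖)^(r-2)) * (‖p5U w s x‖ₑ * ‖L s x‖ₑ) := by
            refine lintegral_mono fun x => ?_
            rw [← ofReal_norm, ← ofReal_norm, ← ofReal_norm, ← ENNReal.ofReal_mul (norm_nonneg _),
              ← ENNReal.ofReal_mul (by positivity)]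
            refine ENNReal.ofReal_le_ofReal ?_
            simp only [hK]
            rw [norm_mul, Real.norm_of_nonneg hr0.le, mul_assoc]
            gcongr
            refine (norm_inner_le_norm _ _).trans ?_
            rw [norm_smul, Real.norm_of_nonneg (by positivity), mul_assoc]
            gcongr
            exact p5U_bound hw s x
        _ = ENNReal.ofReal (r * (∫ ξ, ‖w ξ‖)^(r-2)) * ∫⁻ x, (‖p5U w s x‖ₑ * ‖L s x‖ₑ) :=
            lintegral_const_mul' _ _ ENNReal.ofReal_ne_top
        _ ≤ c := by
            rw [hc]
            gcongr
            refine (p5_hold2 (p5U_contx hw s).aestronglyMeasurable (p5U_contx hLi s).aestronglyMeasurable).trans ?_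
            gcongr
            · exact p5U_L2 hw hw2 s
            · exact p5U_L2 hLi hL2 s
    refine (lintegral_mono hb).trans_lt ?_
    rw [setLIntegral_const]
    exact ENNReal.mul_lt_top hcf (by simp)
  have hswap := integral_integral_swap hKi
  simp_rw [hpt] at hswap
  rw [integral_sub (p5_rint hr hw hw2 S) (p5_rint hr hw hw2 0)] at hswap
  rw [p5_lint hr hw hw2, p5_lint hr hw hw2]
  have hfin : ‖∫ s in Set.Ioc 0 S, ∫ x, K s x‖ₑ ≤ ENNReal.ofReal r * ∫⁻ s in Set.Ioc 0 S,
      ‖∫ x, inner ℝ (‖p5U w s x‖^(r-2) • p5U w s x) (L s x)‖ₑ := by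
    refine (enorm_integral_le_lintegral_enorm _).trans (le_of_eq ?_)
    rw [← lintegral_const_mul' _ _ ENNReal.ofReal_ne_top]
    refine lintegral_congr fun s => ?_
    simp only [hK]
    rw [integral_const_mul, enorm_mul, ← ofReal_norm r, Real.norm_of_nonneg hr0.le]
  refine le_trans ?_ (add_le_add_right hfin _)
  rw [hswap, ← ofReal_norm, ← ENNReal.ofReal_add (integral_nonneg fun x => by positivity) (norm_nonneg _)]
  refine ENNReal.ofReal_le_ofReal ?_
  rw [Real.norm_eq_abs]
  linarith [neg_abs_le ((∫ x, ‖p5U w S x‖^r) - ∫ x, ‖p5U w 0 x‖^r)]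

theorem p5_LP [Nontrivial V] {r : ℝ} (hr : 2 < r) {w : V → ℂ} (hw : Integrable w) (hv : Integrable (fun ξ => ‖ξ‖^2 * ‖w ξ‖))
    (hw2 : MemLp w 2) (hv2 : MemLp (fun ξ => ‖ξ‖^2 * ‖w ξ‖) 2) :
    (∫⁻ x, ‖𝓕⁻ w x‖ₑ^r)^(2/r) ≤ ENNReal.ofReal (r * (r-1)) * ∫⁻ s in Set.Ioi (0:ℝ),
        ∑ j, (∫⁻ x, ‖p5U (p5D (stdOrthonormalBasis ℝ V j) w) s x‖ₑ^r)^(2/r) := by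
  have hr0 : 0 < r := by linarith
  have h2r : 0 < 1 - 2/r := by rw [sub_pos, div_lt_one hr0]; exact hr
  have e0 : ∀ x, 𝓕⁻ w x = p5U w 0 x := fun x => by simp [p5U]
  simp_rw [e0]
  set N := fun s : ℝ => ∑ j, (∫⁻ x, ‖p5U (p5D (stdOrthonormalBasis ℝ V j) w) s x‖ₑ^r)^(2/r) with hN
  set φ := ∫⁻ x, ‖p5U w 0 x‖ₑ^r with hφ
  have hφf : φ ≠ ⊤ := by rw [hφ, p5_lint hr hw hw2]; exact ENNReal.ofReal_ne_top
  have hφp : φ^(1-2/r) ≠ ⊤ := ENNReal.rpow_ne_top_of_nonneg h2r.le hφf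
  set J := ENNReal.ofReal (r * (r-1)) * (φ^(1-2/r) * ∫⁻ s in Set.Ioi (0:ℝ), N s) with hJ
  have h1 : ∀ S : ℝ, 0 ≤ S → φ ≤ (∫⁻ x, ‖p5U w S x‖ₑ^r) + J := by
    intro S hS
    refine (p5_ftc hr hw hv hw2 hv2 hS).trans ?_
    gcongr
    rw [hJ, ENNReal.ofReal_mul hr0.le, mul_assoc]
    gcongr
    rw [← lintegral_const_mul' _ _ hφp, ← lintegral_const_mul' _ _ ENNReal.ofReal_ne_top]
    refine le_trans ?_ (lintegral_mono_set (Set.Ioc_subset_Ioi_self (a := S) (b := (0:ℝ))))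
    refine setLIntegral_mono' measurableSet_Ioc fun s hs => ?_
    refine (p5_slice hr hw hv hw2 hv2 s).trans ?_
    gcongr
    exact p5_contr hr hw hs.1.le
  have h2 : φ ≤ J := by
    have ht := (p5_decay hr hw hw2).add_const J
    rw [zero_add] at ht
    refine ge_of_tendsto ht ?_
    filter_upwards [Filter.eventually_ge_atTop 0] with S hS using h1 S hS
  by_cases h0 : φ = 0
  · rw [h0, ENNReal.zero_rpow_of_pos (by positivity)]; exact zero_le
  have e1 : φ = φ^(1-2/r) * φ^(2/r) := by
    rw [← ENNReal.rpow_add _ _ h0 hφf, sub_add_cancel, ENNReal.rpow_one]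
  have h3 : φ^(1-2/r) * φ^(2/r) ≤ φ^(1-2/r) * (ENNReal.ofReal (r * (r-1)) * ∫⁻ s in Set.Ioi (0:ℝ), N s) := by
    rw [← e1]
    refine h2.trans (le_of_eq ?_)
    rw [hJ]; ring
  rwa [ENNReal.mul_le_mul_iff_right (by simp [ENNReal.rpow_eq_zero_iff, h0, hφf]) hφp] at h3

end P5d

section P6a

variable {V : Type*} [NormedAddCommGroup V] [InnerProductSpace ℝ V] [FiniteDimensional ℝ V]
  [MeasurableSpace V] [BorelSpace V]

lemma p6_int [Nontrivial V] (F : 𝓢(V, ℂ)) {a : ℝ} (ha : -(Module.finrank ℝ V : ℝ) < a) :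
    Integrable (fun ξ : V => ‖ξ‖ ^ a * ‖F ξ‖) := by
  obtain ⟨m, hm⟩ := exists_nat_ge a
  obtain ⟨C, hC⟩ := F.decay 0 0
  have hC' : ∀ ξ, ‖F ξ‖ ≤ C := by intro ξ; simpa using hC.2 ξ
  have hC0 : 0 ≤ C := (norm_nonneg _).trans (hC' 0)
  have h1 := (p4_rpow_gauss (V := V) ha one_pos).const_mul (C * Real.exp 1)
  have h2 := F.integrable_pow_mul volume m
  refine (h1.add h2).mono (Measurable.aestronglyMeasurable ?_) (Filter.Eventually.of_forall fun ξ => ?_)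
  · have := F.continuous.measurable
    fun_prop
  refine le_trans ?_ (Real.le_norm_self _)
  rw [Real.norm_of_nonneg (by positivity)]
  simp only [Pi.add_apply]
  rcases le_total ‖ξ‖ 1 with h | h
  · have e : 1 ≤ Real.exp 1 * Real.exp (-1 * ‖ξ‖^2) := by
      rw [← Real.exp_add]
      apply Real.one_le_exp
      nlinarith [norm_nonneg ξ]
    have h3 : ‖ξ‖ ^ a * ‖F ξ‖ ≤ ‖ξ‖^a * C := by gcongr; exact hC' ξ
    have h4 : ‖ξ‖^a * C * 1 ≤ ‖ξ‖^a * C * (Real.exp 1 * Real.exp (-1 * ‖ξ‖^2)) := by gcongr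
    have h5 : 0 ≤ ‖ξ‖ ^ m * ‖F ξ‖ := by positivity
    linarith
  · have h3 : ‖ξ‖ ^ a * ‖F ξ‖ ≤ ‖ξ‖^m * ‖F ξ‖ := by
      gcongr
      rw [← Real.rpow_natCast]
      exact Real.rpow_le_rpow_of_exponent_le h hm
    have h5 : 0 ≤ C * Real.exp 1 * (‖ξ‖ ^ a * Real.exp (-1 * ‖ξ‖^2)) := by positivity
    linarith

lemma p6_L2 [Nontrivial V] (F : 𝓢(V, ℂ)) {a : ℝ} (ha : -(Module.finrank ℝ V : ℝ) < 2 * a) :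
    MemLp (fun ξ : V => ‖ξ‖ ^ a * ‖F ξ‖) 2 := by
  obtain ⟨C, hC⟩ := F.decay 0 0
  have hC' : ∀ ξ, ‖F ξ‖ ≤ C := by intro ξ; simpa using hC.2 ξ
  have hm : Measurable (fun ξ : V => ‖ξ‖ ^ a * ‖F ξ‖) := by
    have := F.continuous.measurable
    fun_prop
  rw [memLp_two_iff_integrable_sq_norm hm.aestronglyMeasurable]
  refine ((p6_int F ha).const_mul C).mono (hm.norm.pow_const 2).aestronglyMeasurable (Filter.Eventually.of_forall fun ξ => ?_)
  refine le_trans ?_ (Real.le_norm_self _)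
  rw [Real.norm_of_nonneg (by positivity), Real.norm_of_nonneg (by positivity), mul_pow, ← Real.rpow_natCast (‖ξ‖ ^ a), ← Real.rpow_mul (norm_nonneg _)]
  have e : a * ((2:ℕ):ℝ) = 2 * a := by push_cast; ring
  rw [e, pow_two]
  calc _ ≤ ‖ξ‖^(2*a) * (C * ‖F ξ‖) := by gcongr; exact hC' ξ
    _ = _ := by ring

lemma p6_ton [Nontrivial V] {α : ℝ} (hα : -1 < α) {B : V → ℝ≥0∞} (hB : Measurable B) :
    ∫⁻ s in Set.Ioi (0:ℝ), ENNReal.ofReal (s^α) * ∫⁻ ξ, ENNReal.ofReal (Real.exp (-s * ‖ξ‖^2) * ‖ξ‖^(2*(1+α))) * B ξ ≤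
      ENNReal.ofReal (Real.Gamma (1+α)) * ∫⁻ ξ, B ξ := by
  have hm : Measurable (fun p : ℝ × V => ENNReal.ofReal (p.1^α) * (ENNReal.ofReal (Real.exp (-p.1 * ‖p.2‖^2) * ‖p.2‖^(2*(1+α))) * B p.2)) := by
    have : Measurable (fun p : ℝ × V => B p.2) := hB.comp measurable_snd
    fun_prop
  simp_rw [← lintegral_const_mul' _ _ ENNReal.ofReal_ne_top]
  rw [lintegral_lintegral_swap hm.aemeasurable]
  refine lintegral_mono_ae ?_
  have : ∀ᵐ ξ : V, ξ ≠ 0 := by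
    simp [ae_iff, measure_singleton]
  filter_upwards [this] with ξ hξ
  have hρ : 0 < ‖ξ‖ := norm_pos_iff.mpr hξ
  have e : ∀ s : ℝ, ENNReal.ofReal (s^α) * (ENNReal.ofReal (Real.exp (-s * ‖ξ‖^2) * ‖ξ‖^(2*(1+α))) * B ξ) =
      ENNReal.ofReal (s^α) * ENNReal.ofReal (Real.exp (-s * ‖ξ‖^2) * ‖ξ‖^(2*(1+α))) * B ξ := fun s => by ring
  simp_rw [e]
  rw [lintegral_mul_const _ (by fun_prop)]
  gcongr
  have hi := (p1_rpow_exp_integrableOn hα (b := ‖ξ‖^2) (by positivity)).mul_const (‖ξ‖^(2*(1+α)))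
  calc _ = ∫⁻ s in Set.Ioi (0:ℝ), ENNReal.ofReal (s^α * Real.exp (-(‖ξ‖^2) * s) * ‖ξ‖^(2*(1+α))) := by
        refine setLIntegral_congr_fun measurableSet_Ioi fun s hs => ?_
        have : (0:ℝ) < s := hs
        rw [← ENNReal.ofReal_mul (by positivity), mul_assoc, neg_mul, neg_mul, mul_comm s (‖ξ‖^2)]
    _ = ENNReal.ofReal (∫ s in Set.Ioi (0:ℝ), (s^α * Real.exp (-(‖ξ‖^2) * s)) * ‖ξ‖^(2*(1+α))) := by
        rw [ofReal_integral_eq_lintegral_ofReal hi]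
        filter_upwards [self_mem_ae_restrict measurableSet_Ioi] with s hs
        have : (0:ℝ) < s := hs
        simp only [Pi.zero_apply]; positivity
    _ ≤ _ := by
        refine ENNReal.ofReal_le_ofReal (le_of_eq ?_)
        have h := p4_gamma (κ := 1 + α) (by linarith) hρ
        rw [add_sub_cancel_left] at h
        rw [integral_mul_const, h, mul_assoc, ← Real.rpow_add hρ, neg_add_cancel, Real.rpow_zero, mul_one]

lemma p6_mink {ι : Type*} [Fintype ι] [MeasurableSpace ι] [MeasurableSingletonClass ι] {q r : ℝ} (hq : 2 ≤ q) (hr : 0 < r) {D : ι → ℝ → ℝ → V → ℂ}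
    (hD : ∀ j, Continuous (fun p : (ℝ × ℝ) × V => D j p.1.1 p.1.2 p.2)) :
    (∫⁻ t, (∫⁻ s in Set.Ioi (0:ℝ), ∑ j, (∫⁻ x, ‖D j s t x‖ₑ^r)^(2/r))^(q/2))^(2/q) ≤
      ∫⁻ s in Set.Ioi (0:ℝ), ∑ j, (p3M q r (D j s))^(2:ℝ) := by
  have hq2 : 1 ≤ q/2 := by linarith
  have hN : ∀ j, Measurable (fun p : ℝ × ℝ => (∫⁻ x, ‖D j p.1 p.2 x‖ₑ^r)^(2/r)) := by
    intro j
    have : Measurable (fun p : (ℝ × ℝ) × V => ‖D j p.1.1 p.1.2 p.2‖ₑ^r) := (hD j).measurable.enorm.pow_const _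
    exact (this.lintegral_prod_right').pow_const _
  have h1 := p0_minkowski hq2 (volume.restrict (Set.Ioi (0:ℝ))) (volume : Measure ℝ)
    (f := fun s t => ∑ j, (∫⁻ x, ‖D j s t x‖ₑ^r)^(2/r)) (Finset.measurable_sum _ fun j _ => hN j)
  have e1 : 1/(q/2) = 2/q := by field_simp
  rw [e1] at h1
  refine h1.trans (lintegral_mono fun s => ?_)
  have h2 := p0_minkowski hq2 (Measure.count : Measure ι) (volume : Measure ℝ)
    (f := fun j t => (∫⁻ x, ‖D j s t x‖ₑ^r)^(2/r)) (measurable_from_prod_countable_right fun j =>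
      (hN j).comp (by fun_prop : Measurable fun t : ℝ => (s, t)))
  simp only [lintegral_fintype, Measure.count_singleton, mul_one, e1] at h2
  refine h2.trans (le_of_eq (Finset.sum_congr rfl fun j _ => ?_))
  simp only [p3M, ← ENNReal.rpow_mul]
  have e2 : 2/r * (q/2) = q/r := by field_simp
  have e3 : 1/q*2 = 2/q := by ring
  rw [e2, e3]

end P6a

section P6b

variable {V : Type*} [NormedAddCommGroup V] [InnerProductSpace ℝ V] [FiniteDimensional ℝ V]
  [MeasurableSpace V] [BorelSpace V]

/-- the symbol of the solution -/
def p6w (σ : ℝ) (F : V → ℂ) (t : ℝ) : V → ℂ := fun ξ => ((‖ξ‖^σ : ℝ) : ℂ) * (cexp (I * t * ‖ξ‖) * F ξ)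

lemma p6w_norm (σ : ℝ) (F : V → ℂ) (t : ℝ) (ξ : V) : ‖p6w σ F t ξ‖ = ‖ξ‖^σ * ‖F ξ‖ := by
  rw [p6w, norm_mul, norm_mul, Complex.norm_real, Real.norm_of_nonneg (by positivity)]
  have e : I * t * ‖ξ‖ = ((t * ‖ξ‖ : ℝ) : ℂ) * I := by push_cast; ring
  rw [e, Complex.norm_exp_ofReal_mul_I, one_mul]

lemma p6w_meas (σ : ℝ) (F : 𝓢(V, ℂ)) (t : ℝ) : Measurable (p6w σ F t) := by
  have := F.continuous.measurable
  unfold p6w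
  fun_prop

lemma p6_sq_le (σ : ℝ) (ξ : V) : ‖ξ‖^2 * ‖ξ‖^σ ≤ ‖ξ‖^(σ+2) := by
  by_cases h : ξ = 0
  · subst h; simp; positivity
  · have : 0 < ‖ξ‖ := norm_pos_iff.mpr h
    rw [Real.rpow_add this, Real.rpow_two, mul_comm]

lemma p6_one_le (σ : ℝ) (ξ : V) : ‖ξ‖ * ‖ξ‖^σ ≤ ‖ξ‖^(σ+1) := by
  by_cases h : ξ = 0
  · subst h; simp; positivity
  · have : 0 < ‖ξ‖ := norm_pos_iff.mpr h
    rw [Real.rpow_add this, Real.rpow_one, mul_comm]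

lemma p6_cont [Nontrivial V] {σ : ℝ} (hσ : -(Module.finrank ℝ V : ℝ) < σ) (F : 𝓢(V, ℂ)) (v : V) :
    Continuous (fun p : (ℝ × ℝ) × V => p5U (p5D v (p6w σ F p.1.2)) p.1.1 p.2) := by
  have hi := ((p6_int F (a := σ + 1) (by linarith))).const_mul (2 * Real.pi * ‖v‖)
  simp only [p5U, Real.fourierInv_eq', smul_eq_mul]
  refine continuous_of_dominated ?_ ?_ hi ?_
  · intro p
    refine AEStronglyMeasurable.mul (Continuous.aestronglyMeasurable (by fun_prop)) (p5_aesm ?_ _)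
    exact AEStronglyMeasurable.mul (Continuous.aestronglyMeasurable (by fun_prop)) (p6w_meas σ F _).aestronglyMeasurable
  · intro p
    refine Filter.Eventually.of_forall fun ξ => ?_
    rw [norm_mul, Complex.norm_exp_ofReal_mul_I, one_mul]
    refine (p5_norm_le _ _ ξ).trans ?_
    rw [p5D, norm_mul, p6w_norm]
    have h1 := p5D_bd v ξ
    have h2 := p6_one_le σ ξ
    calc _ ≤ (2 * Real.pi * ‖v‖ * ‖ξ‖) * (‖ξ‖^σ * ‖F ξ‖) := by gcongr
      _ = 2 * Real.pi * ‖v‖ * ((‖ξ‖ * ‖ξ‖^σ) * ‖F ξ‖) := by ring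
      _ ≤ _ := by gcongr
  · refine Filter.Eventually.of_forall fun ξ => ?_
    unfold p5D p6w
    fun_prop

/-- the amplitude -/
def p6h (σ κ s : ℝ) (v : V) (F : V → ℂ) : V → ℂ := fun ξ =>
  ((Real.exp (-(s/2) * ‖ξ‖^2) : ℝ) : ℂ) * (((2 * Real.pi * inner ℝ ξ v : ℝ) : ℂ) * I * (((‖ξ‖^(σ + 2*κ) : ℝ) : ℂ) * F ξ))

lemma p6_factor {σ κ s : ℝ} (hs : 0 < s) (v : V) (F : V → ℂ) (t : ℝ) (x : V) :
    p5U (p5D v (p6w σ F t)) s x = 𝓕⁻ (fun ξ : V => cexp (t * I * ‖ξ‖) *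
        (((‖ξ‖ ^ (-(2*κ)) * Real.exp (-(s/2) * ‖ξ‖^2) : ℝ) : ℂ) * p6h σ κ s v F ξ)) x := by
  unfold p5U
  refine congrFun (congrArg (fun g : V → ℂ => 𝓕⁻ g) (funext fun ξ => ?_)) x
  simp only [p5D, p6w, p6h]
  by_cases h : ξ = 0
  · subst h; simp
  have hp : 0 < ‖ξ‖ := norm_pos_iff.mpr h
  have e1 : Real.exp (-|s| * ‖ξ‖^2) = Real.exp (-(s/2) * ‖ξ‖^2) * Real.exp (-(s/2) * ‖ξ‖^2) := by
    rw [← Real.exp_add, abs_of_pos hs]; congr 1; ring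
  have e2 : ‖ξ‖^σ = ‖ξ‖^(-(2*κ)) * ‖ξ‖^(σ+2*κ) := by
    rw [← Real.rpow_add hp]; congr 1; ring
  rw [e1, e2]
  have e3 : I * t * ‖ξ‖ = t * I * ‖ξ‖ := by ring
  rw [e3]
  push_cast
  ring

lemma p6h_norm_le (σ κ s : ℝ) (v : V) (F : V → ℂ) (ξ : V) :
    ‖p6h σ κ s v F ξ‖ ≤ 2 * Real.pi * ‖v‖ * (Real.exp (-(s/2) * ‖ξ‖^2) * (‖ξ‖^(σ+2*κ+1) * ‖F ξ‖)) := by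
  rw [p6h, norm_mul, norm_mul, norm_mul _ (F ξ), Complex.norm_real, Complex.norm_real, Real.norm_of_nonneg (by positivity), Real.norm_of_nonneg (by positivity)]
  have h1 := p5D_bd v ξ
  have h2 := p6_one_le (σ + 2*κ) ξ
  calc _ ≤ Real.exp (-(s/2) * ‖ξ‖^2) * ((2 * Real.pi * ‖v‖ * ‖ξ‖) * (‖ξ‖^(σ+2*κ) * ‖F ξ‖)) := by gcongr
    _ = 2 * Real.pi * ‖v‖ * (Real.exp (-(s/2) * ‖ξ‖^2) * ((‖ξ‖ * ‖ξ‖^(σ+2*κ)) * ‖F ξ‖)) := by ring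
    _ ≤ _ := by gcongr

lemma p6h_memLp [Nontrivial V] {σ κ s : ℝ} (hs : 0 < s) (hσ : -(Module.finrank ℝ V : ℝ) < 2 * (σ + 2*κ+1)) (v : V) (F : 𝓢(V, ℂ)) :
    MemLp (p6h σ κ s v F) 2 := by
  refine MemLp.of_le_mul (c := 2 * Real.pi * ‖v‖) (p6_L2 F hσ) (Measurable.aestronglyMeasurable ?_) (Filter.Eventually.of_forall fun ξ => ?_)
  · have := F.continuous.measurable
    unfold p6h
    fun_prop
  · refine (p6h_norm_le σ κ s v F ξ).trans ?_
    rw [Real.norm_of_nonneg (by positivity)]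
    refine mul_le_mul_of_nonneg_left ?_ (by positivity)
    refine mul_le_of_le_one_left (by positivity) ?_
    rw [Real.exp_le_one_iff]
    nlinarith [sq_nonneg ‖ξ‖]

lemma p6h_sq {σ κ s α : ℝ} (hα : 2 * (σ + 2*κ+1) = 2 * (1+α) + 1) (hα1 : -1 < α) {v : V} (hv : ‖v‖ = 1) (F : V → ℂ) :
    eLpNorm (p6h σ κ s v F) 2 volume ^ (2:ℝ) ≤ ENNReal.ofReal (4 * Real.pi^2) *
      ∫⁻ ξ, ENNReal.ofReal (Real.exp (-s * ‖ξ‖^2) * ‖ξ‖^(2*(1+α))) * ‖((‖ξ‖^(1/2:ℝ) : ℝ) : ℂ) * F ξ‖ₑ^(2:ℝ) := by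
  rw [eLpNorm_eq_lintegral_rpow_enorm_toReal (by norm_num) (by norm_num), ← ENNReal.rpow_mul, ← lintegral_const_mul' _ _ ENNReal.ofReal_ne_top]
  simp only [ENNReal.toReal_ofNat, one_div, inv_mul_cancel₀ (by norm_num : (2:ℝ) ≠ 0), ENNReal.rpow_one]
  refine lintegral_mono fun ξ => ?_
  rw [← ofReal_norm, ← ofReal_norm, ENNReal.ofReal_rpow_of_nonneg (norm_nonneg _) (by norm_num),
    ENNReal.ofReal_rpow_of_nonneg (norm_nonneg _) (by norm_num), ← ENNReal.ofReal_mul (by positivity), ← ENNReal.ofReal_mul (by positivity)]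
  refine ENNReal.ofReal_le_ofReal ?_
  rw [Real.rpow_two, Real.rpow_two]
  have h1 := p6h_norm_le σ κ s v F ξ
  rw [hv, mul_one] at h1
  calc _ ≤ (2 * Real.pi * (Real.exp (-(s/2) * ‖ξ‖^2) * (‖ξ‖^(σ+2*κ+1) * ‖F ξ‖)))^2 := by gcongr
    _ = 4 * Real.pi^2 * (Real.exp (-(s/2) * ‖ξ‖^2)^2 * ((‖ξ‖^(σ+2*κ+1))^2 * ‖F ξ‖^2)) := by ring
    _ = _ := by
      rw [norm_mul, Complex.norm_real, Real.norm_of_nonneg (by positivity), mul_pow, ← Real.exp_nat_mul,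
        ← Real.rpow_natCast (‖ξ‖^(σ+2*κ+1)), ← Real.rpow_mul (norm_nonneg _), ← Real.rpow_natCast (‖ξ‖^(_:ℝ)), ← Real.rpow_mul (norm_nonneg _)]
      have e1 : ((2:ℕ):ℝ) * (-(s/2) * ‖ξ‖^2) = -s * ‖ξ‖^2 := by push_cast; ring
      have e2 : (σ+2*κ+1) * ((2:ℕ):ℝ) = 2 * (1+α) + 2⁻¹ * ((2:ℕ):ℝ) := by push_cast; linarith
      rw [e1, e2, Real.rpow_add' (norm_nonneg _) (by push_cast; linarith)]
      ring

end P6b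

section P6c

variable {V : Type*} [NormedAddCommGroup V] [InnerProductSpace ℝ V] [FiniteDimensional ℝ V]
  [MeasurableSpace V] [BorelSpace V]

theorem p6_main [Nontrivial V] {q r σ : ℝ} (hd : 2 ≤ Module.finrank ℝ V) (hq : 2 ≤ q) (hr : 2 ≤ r)
    (hadm : 2 / q + ((Module.finrank ℝ V : ℝ) - 1) / r ≤ ((Module.finrank ℝ V : ℝ) - 1) / 2)
    (hσ : σ = 1 / q + (Module.finrank ℝ V : ℝ) / r - ((Module.finrank ℝ V : ℝ) - 1) / 2) :
    ∃ C > (0:ℝ), ∀ F : 𝓢(V, ℂ), p3M q r (fun t x => 𝓕⁻ (p6w σ F t) x) ≤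
      ENNReal.ofReal C * eLpNorm (fun ξ => ((‖ξ‖^(1/2:ℝ) : ℝ) : ℂ) * F ξ) 2 volume := by
  have hdR : (2:ℝ) ≤ Module.finrank ℝ V := by exact_mod_cast hd
  set d : ℝ := (Module.finrank ℝ V : ℝ) with hdd
  have hr0 : 0 < r := by linarith
  have hq0 : 0 < q := by linarith
  have hqi : 0 < 1/q := by positivity
  have h2q : 2/q = 2 * (1/q) := by ring
  have hri : 0 < 1/r := by positivity
  have hdr : (d-1)/r = (d-1) * (1/r) := by ring
  have hdr' : d/r = d * (1/r) := by ring
  have hri2 : 1/r < 1/2 := by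
    rw [h2q, hdr] at hadm
    by_contra hcon
    push Not at hcon
    nlinarith
  have hr2 : 2 < r := by
    rw [one_div_lt_one_div hr0 (by norm_num)] at hri2; exact hri2
  set ς := 1/q + d/r - d/2 with hς
  have hσς : σ = ς + 1/2 := by rw [hσ, hς]; ring
  have hς0 : ς < 0 := by
    rw [h2q, hdr] at hadm
    rw [hς, hdr']
    nlinarith
  have hςd : -d/2 < ς := by
    rw [hς]
    have : 0 < d/r := by positivity
    linarith
  obtain ⟨κ, hκ, hκ2, hκ3⟩ : ∃ κ : ℝ, 0 < κ ∧ 2 * κ < -ς ∧ -1 < 2 * κ + ς := by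
    refine ⟨(max 0 (-1-ς) + -ς)/4, ?_, ?_, ?_⟩
    · have := le_max_left 0 (-1-ς); linarith
    · have : max 0 (-1-ς) < -ς := max_lt (by linarith) (by linarith)
      linarith
    · have := le_max_right 0 (-1-ς); linarith
  obtain ⟨C, hC, hFS⟩ := p4_FS (V := V) hd hq hr hadm hκ hκ2
  set α := 2 * κ + ς with hα
  set m := Module.finrank ℝ V with hm
  have hΓ : 0 < Real.Gamma (1+α) := Real.Gamma_pos_of_pos (by linarith)
  set K : ℝ := r * (r-1) * (d * ((C^2 * (1/2)^α) * (4 * Real.pi^2) * Real.Gamma (1+α))) with hK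
  have hr1 : 0 < r - 1 := by linarith
  have hK0 : 0 < K := by positivity
  refine ⟨K^(1/2:ℝ), by positivity, fun F => ?_⟩
  set g : V → ℂ := fun ξ => ((‖ξ‖^(1/2:ℝ) : ℝ) : ℂ) * F ξ with hg
  have hgm : Measurable g := by
    have := F.continuous.measurable
    rw [hg]; fun_prop
  -- per direction estimate
  have hdir : ∀ v : V, ‖v‖ = 1 → ∫⁻ s in Set.Ioi (0:ℝ), (p3M q r (fun t x => p5U (p5D v (p6w σ F t)) s x))^(2:ℝ) ≤
      ENNReal.ofReal ((C^2 * (1/2)^α) * (4 * Real.pi^2) * Real.Gamma (1+α)) * eLpNorm g 2 volume ^ (2:ℝ) := by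
    intro v hv
    have eg : eLpNorm g 2 volume ^ (2:ℝ) = ∫⁻ ξ, ‖g ξ‖ₑ^(2:ℝ) := by
      rw [eLpNorm_eq_lintegral_rpow_enorm_toReal (by norm_num) (by norm_num), ← ENNReal.rpow_mul]
      simp
    have hton := p6_ton (V := V) hκ3 (B := fun ξ => ‖g ξ‖ₑ^(2:ℝ)) (hgm.enorm.pow_const _)
    rw [eg, ENNReal.ofReal_mul (by positivity), mul_assoc]
    refine le_trans ?_ (mul_le_mul_right hton _)
    rw [← lintegral_const_mul' _ _ ENNReal.ofReal_ne_top]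
    refine setLIntegral_mono' measurableSet_Ioi fun s hs => ?_
    have hs : (0:ℝ) < s := hs
    have hmem : MemLp (p6h σ κ s v F) 2 := p6h_memLp hs (by rw [← hm, ← hdd]; linarith) v F
    have h1 := hFS (s/2) (by positivity) _ hmem
    have e1 : (fun (t : ℝ) (x : V) => p5U (p5D v (p6w σ F t)) s x) = fun (t : ℝ) x => 𝓕⁻ (fun ξ : V => cexp (t * I * ‖ξ‖) *
        (((‖ξ‖ ^ (-(2*κ)) * Real.exp (-(s/2) * ‖ξ‖^2) : ℝ) : ℂ) * p6h σ κ s v F ξ)) x := by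
      ext t x; exact p6_factor hs v F t x
    rw [e1]
    refine (ENNReal.rpow_le_rpow h1 (by norm_num)).trans ?_
    rw [ENNReal.mul_rpow_of_nonneg _ _ (by norm_num), ENNReal.ofReal_rpow_of_nonneg (by positivity) (by norm_num)]
    have h2 := p6h_sq (s := s) (σ := σ) (κ := κ) (α := α) (by rw [hα, hσς]; ring) hκ3 hv F
    refine (mul_le_mul_right h2 _).trans (le_of_eq ?_)
    rw [← mul_assoc, ← mul_assoc, ← ENNReal.ofReal_mul (by positivity), ← ENNReal.ofReal_mul (by positivity)]
    congr 2
    rw [Real.rpow_two, mul_pow, ← Real.rpow_natCast ((s/2)^(_:ℝ)), ← Real.rpow_mul (by positivity)]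
    have e2 : (κ + ς/2) * ((2:ℕ):ℝ) = α := by push_cast; rw [hα]; ring
    have e3 : s/2 = (1/2) * s := by ring
    rw [e2, e3, Real.mul_rpow (by norm_num) hs.le]
    ring
  -- square
  have hsq : (p3M q r (fun t x => 𝓕⁻ (p6w σ F t) x))^(2:ℝ) ≤ ENNReal.ofReal K * eLpNorm g 2 volume ^ (2:ℝ) := by
    have hn : ∀ t ξ, ‖ξ‖^2 * ‖p6w σ F t ξ‖ ≤ ‖ξ‖^(σ+2) * ‖F ξ‖ := by
      intro t ξ
      rw [p6w_norm, ← mul_assoc]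
      gcongr
      exact p6_sq_le σ ξ
    have hLP : ∀ t, (∫⁻ x, ‖𝓕⁻ (p6w σ F t) x‖ₑ^r)^(2/r) ≤ ENNReal.ofReal (r * (r-1)) * ∫⁻ s in Set.Ioi (0:ℝ),
        ∑ j, (∫⁻ x, ‖p5U (p5D (stdOrthonormalBasis ℝ V j) (p6w σ F t)) s x‖ₑ^r)^(2/r) := by
      intro t
      have hmeas := p6w_meas σ F t
      have hmeas2 : Measurable (fun ξ : V => ‖ξ‖^2 * ‖p6w σ F t ξ‖) := by fun_prop
      refine p5_LP hr2 ?_ ?_ ?_ ?_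
      · refine (p6_int F (a := σ) (by rw [← hm, ← hdd]; linarith)).mono hmeas.aestronglyMeasurable (Filter.Eventually.of_forall fun ξ => ?_)
        rw [p6w_norm]; exact Real.le_norm_self _
      · refine (p6_int F (a := σ + 2) (by rw [← hm, ← hdd]; linarith)).mono hmeas2.aestronglyMeasurable (Filter.Eventually.of_forall fun ξ => ?_)
        rw [Real.norm_of_nonneg (by positivity)]
        exact (hn t ξ).trans (Real.le_norm_self _)
      · refine (p6_L2 F (a := σ) (by rw [← hm, ← hdd]; linarith)).mono hmeas.aestronglyMeasurable (Filter.Eventually.of_forall fun ξ => ?_)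
        rw [p6w_norm]; exact Real.le_norm_self _
      · refine (p6_L2 F (a := σ + 2) (by rw [← hm, ← hdd]; linarith)).mono hmeas2.aestronglyMeasurable (Filter.Eventually.of_forall fun ξ => ?_)
        rw [Real.norm_of_nonneg (by positivity)]
        exact (hn t ξ).trans (Real.le_norm_self _)
    have hmk := p6_mink (V := V) (ι := Fin m) hq hr0 (D := fun j s t x => p5U (p5D (stdOrthonormalBasis ℝ V j) (p6w σ F t)) s x)
      (fun j => p6_cont (by rw [← hm, ← hdd]; linarith) F (stdOrthonormalBasis ℝ V j))
    have e1 : (p3M q r (fun t x => 𝓕⁻ (p6w σ F t) x))^(2:ℝ) =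
        (∫⁻ t, ((∫⁻ x, ‖𝓕⁻ (p6w σ F t) x‖ₑ^r)^(2/r))^(q/2))^(2/q) := by
      simp only [p3M, ← ENNReal.rpow_mul]
      have e2 : 2/r * (q/2) = q/r := by field_simp
      have e3 : 1/q*2 = 2/q := by ring
      rw [e2, e3]
    rw [e1]
    have hrr : ENNReal.ofReal (r * (r-1)) ^ (q/2) ≠ ⊤ := ENNReal.rpow_ne_top_of_nonneg (by positivity) ENNReal.ofReal_ne_top
    calc _ ≤ (∫⁻ t, (ENNReal.ofReal (r * (r-1)) * ∫⁻ s in Set.Ioi (0:ℝ),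
            ∑ j, (∫⁻ x, ‖p5U (p5D (stdOrthonormalBasis ℝ V j) (p6w σ F t)) s x‖ₑ^r)^(2/r))^(q/2))^(2/q) := by
          gcongr with t
          exact hLP t
      _ = ENNReal.ofReal (r * (r-1)) * (∫⁻ t, (∫⁻ s in Set.Ioi (0:ℝ),
            ∑ j, (∫⁻ x, ‖p5U (p5D (stdOrthonormalBasis ℝ V j) (p6w σ F t)) s x‖ₑ^r)^(2/r))^(q/2))^(2/q) := by
          simp_rw [ENNReal.mul_rpow_of_nonneg _ _ (by positivity : 0 ≤ q/2)]
          rw [lintegral_const_mul' _ _ hrr, ENNReal.mul_rpow_of_nonneg _ _ (by positivity), ← ENNReal.rpow_mul]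
          have e2 : q/2 * (2/q) = 1 := by field_simp
          rw [e2, ENNReal.rpow_one]
      _ ≤ ENNReal.ofReal (r * (r-1)) * ∫⁻ s in Set.Ioi (0:ℝ), ∑ j : Fin m,
            (p3M q r (fun t x => p5U (p5D (stdOrthonormalBasis ℝ V j) (p6w σ F t)) s x))^(2:ℝ) := by
          gcongr
      _ ≤ ENNReal.ofReal (r * (r-1)) * ∑ j : Fin m, ∫⁻ s in Set.Ioi (0:ℝ),
            (p3M q r (fun t x => p5U (p5D (stdOrthonormalBasis ℝ V j) (p6w σ F t)) s x))^(2:ℝ) := by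
          gcongr
          rw [lintegral_finset_sum]
          intro j _
          have hc := p6_cont (V := V) (σ := σ) (by rw [← hm, ← hdd]; linarith) F (stdOrthonormalBasis ℝ V j)
          have h3 : Measurable (fun p : (ℝ × ℝ) × V => ‖p5U (p5D (stdOrthonormalBasis ℝ V j) (p6w σ F p.1.2)) p.1.1 p.2‖ₑ^r) :=
            hc.measurable.enorm.pow_const _
          exact (((h3.lintegral_prod_right').pow_const (q/r)).lintegral_prod_right'.pow_const (1/q)).pow_const 2
      _ ≤ ENNReal.ofReal (r * (r-1)) * ∑ j : Fin m, ENNReal.ofReal ((C^2 * (1/2)^α) * (4 * Real.pi^2) * Real.Gamma (1+α)) * eLpNorm g 2 volume ^ (2:ℝ) := by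
          gcongr with j
          exact hdir _ ((stdOrthonormalBasis ℝ V).norm_eq_one j)
      _ = _ := by
          rw [Finset.sum_const, Finset.card_univ, Fintype.card_fin, nsmul_eq_mul, hK, ENNReal.ofReal_mul (by positivity : 0 ≤ r * (r-1)),
            ENNReal.ofReal_mul (by positivity : 0 ≤ d), hdd, ENNReal.ofReal_natCast]
          ring
  have h4 := ENNReal.rpow_le_rpow hsq (by norm_num : (0:ℝ) ≤ 1/2)
  rw [ENNReal.mul_rpow_of_nonneg _ _ (by norm_num), ← ENNReal.rpow_mul, ← ENNReal.rpow_mul, mul_one_div_cancel (by norm_num), ENNReal.rpow_one, ENNReal.rpow_one,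
    ENNReal.ofReal_rpow_of_nonneg hK0.le (by norm_num)] at h4
  exact h4

end P6c

section P7

lemma p7_fourier_eq {n : ℕ} {G : EuclideanSpace ℝ (Fin n) → ℂ} (hc : Continuous G) (hG : Integrable G) :
    𝓕 (𝓕⁻ G) = G ∨ 𝓕 (𝓕⁻ G) = 0 := by
  by_cases h : Integrable (𝓕⁻ G)
  · left
    have h2 : Integrable (𝓕 G) := by
      have e : 𝓕 G = fun x => 𝓕⁻ G (-x) := by
        ext x; rw [Real.fourierInv_eq_fourier_neg, neg_neg]
      rw [e]; exact h.comp_neg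
    exact hc.fourier_fourierInv_eq hG h2
  · right
    ext w
    rw [Real.fourier_eq, Pi.zero_apply]
    refine integral_undef ?_
    rw [← Real.fourierIntegral_convergent_iff w] at h
    exact h

theorem p7_main (n : ℕ) (hn : 2 ≤ n) (q r σ : ℝ)
    (hq : 2 ≤ q) (hr : 2 ≤ r)
    (hadm : 2 / q + ((n : ℝ) - 1) / r ≤ ((n : ℝ) - 1) / 2)
    (hσ : σ = 1 / q + (n : ℝ) / r - ((n : ℝ) - 1) / 2) :
    ∃ C > (0 : ℝ), ∀ f : 𝓢(EuclideanSpace ℝ (Fin n), ℂ),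
      mixedNorm n q r (fun x t => mOp n (powMult σ) (mOp n (expMult t) (⇑f)) x) ≤
        ENNReal.ofReal C * sobNorm n (1 / 2) (⇑f) := by
  have hne : Nonempty (Fin n) := ⟨⟨0, by omega⟩⟩
  have hnt : Nontrivial (EuclideanSpace ℝ (Fin n)) :=
    Module.nontrivial_of_finrank_pos (R := ℝ) (by rw [finrank_euclideanSpace_fin]; omega)
  have hfr : Module.finrank ℝ (EuclideanSpace ℝ (Fin n)) = n := finrank_euclideanSpace_fin
  obtain ⟨C, hC, hmain⟩ := p6_main (V := EuclideanSpace ℝ (Fin n)) (q := q) (r := r) (σ := σ)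
    (by rw [hfr]; exact hn) hq hr (by rw [hfr]; exact hadm) (by rw [hfr]; exact hσ)
  refine ⟨C, hC, fun f => ?_⟩
  set F : 𝓢(EuclideanSpace ℝ (Fin n), ℂ) := 𝓕 f with hF
  have hFc : ∀ ξ, 𝓕 (⇑f) ξ = F ξ := fun ξ => rfl
  have hrhs : sobNorm n (1/2) (⇑f) =
      eLpNorm (fun ξ => ((‖ξ‖^(1/2:ℝ) : ℝ) : ℂ) * F ξ) 2 volume := by
    have hm : Measurable (fun ξ : EuclideanSpace ℝ (Fin n) => ((‖ξ‖^(1/2:ℝ) : ℝ) : ℂ) * F ξ) := by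
      have := F.continuous.measurable
      fun_prop
    have hb : ∀ ξ : EuclideanSpace ℝ (Fin n), ‖((‖ξ‖^(1/2:ℝ) : ℝ) : ℂ) * F ξ‖ ≤ ‖‖ξ‖^(1/2:ℝ) * ‖F ξ‖‖ := by
      intro ξ
      rw [norm_mul, norm_mul, Complex.norm_real, norm_norm]
    have hn0 : (0:ℝ) ≤ n := by positivity
    have h1 := (p6_int F (a := 1/2) (by rw [hfr]; linarith)).mono hm.aestronglyMeasurable
      (Filter.Eventually.of_forall hb)
    have h2 := (p6_L2 F (a := 1/2) (by rw [hfr]; linarith)).mono hm.aestronglyMeasurable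
      (Filter.Eventually.of_forall hb)
    rw [← p0_plancherel h1 h2]
    rfl
  rw [hrhs]
  refine le_trans ?_ (hmain F)
  unfold mixedNorm p3M
  have hpt : ∀ (t : ℝ) x, (‖mOp n (powMult σ) (mOp n (expMult t) (⇑f)) x‖₊ : ℝ≥0∞) ≤ ‖𝓕⁻ (p6w σ F t) x‖ₑ := by
    intro t x
    have hc : Continuous (fun ξ : EuclideanSpace ℝ (Fin n) => expMult t ‖ξ‖ * 𝓕 (⇑f) ξ) := by
      have h1 : Continuous (𝓕 (⇑f)) := F.continuous
      unfold expMult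
      fun_prop
    have hi : Integrable (fun ξ : EuclideanSpace ℝ (Fin n) => expMult t ‖ξ‖ * 𝓕 (⇑f) ξ) := by
      refine (F.integrable (μ := volume)).mono hc.aestronglyMeasurable (Filter.Eventually.of_forall fun ξ => ?_)
      rw [norm_mul, hFc, expMult, Complex.norm_exp]
      simp
    have e0 : mOp n (powMult σ) (mOp n (expMult t) (⇑f)) x =
        𝓕⁻ (fun ξ : EuclideanSpace ℝ (Fin n) => powMult σ ‖ξ‖ *
          𝓕 (𝓕⁻ (fun ξ : EuclideanSpace ℝ (Fin n) => expMult t ‖ξ‖ * 𝓕 (⇑f) ξ)) ξ) x := rfl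
    rw [e0]
    rcases p7_fourier_eq hc hi with h | h
    · rw [h]
      exact le_of_eq rfl
    · rw [h]
      have : (fun ξ : EuclideanSpace ℝ (Fin n) => powMult σ ‖ξ‖ * (0 : EuclideanSpace ℝ (Fin n) → ℂ) ξ) = fun _ => 0 := by
        ext ξ; simp
      rw [this, Real.fourierInv_eq]
      simp
  gcongr with t x
  exact hpt t x

end P7

/-- Strichartz inequalities for the free wave propagator. -/
theorem strichartz_free_wave (n : ℕ) (hn : 2 ≤ n) (q r σ : ℝ)
    (hq : 2 ≤ q) (hr : 2 ≤ r)
    (hadm : 2 / q + ((n : ℝ) - 1) / r ≤ ((n : ℝ) - 1) / 2)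
    (hσ : σ = 1 / q + (n : ℝ) / r - ((n : ℝ) - 1) / 2) :
    ∃ C > (0 : ℝ), ∀ f : 𝓢(EuclideanSpace ℝ (Fin n), ℂ),
      mixedNorm n q r (fun x t => mOp n (powMult σ) (mOp n (expMult t) (⇑f)) x) ≤
        ENNReal.ofReal C * sobNorm n (1 / 2) (⇑f) := by
  exact p7_main n hn q r σ hq hr hadm hσ


end
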